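/- Let c be a rational number with c ∉ {−5, −5/2, −155/72, −2, −5/4, 0, 19/16}. If c ∈ Im λ, then the fourth dynatomic polynomial Φ_{4,c} is irreducible over ℚ, and its Galois group G_c is isomorphic to the group 𝒢. -/

import Mathlib

open Polynomial

/-- The fourth dynatomic polynomial of `x^2 + c`. -/
noncomputable def Phi4 {K : Type*} [Field K] (c : K) : K[X] :=
  X ^ 12 + C (6 * c) * X ^ 10 + X ^ 9 + C (15 * c ^ 2 + 3 * c) * X ^ 8 +
    C (4 * c) * X ^ 7 + C (20 * c ^ 3 + 12 * c ^ 2 + 1) * X ^ 6 +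
    C (6 * c ^ 2 + 2 * c) * X ^ 5 +
    C (15 * c ^ 4 + 18 * c ^ 3 + 3 * c ^ 2 + 4 * c) * X ^ 4 +
    C (4 * c ^ 3 + 4 * c ^ 2 + 1) * X ^ 3 +
    C (6 * c ^ 5 + 12 * c ^ 4 + 6 * c ^ 3 + 5 * c ^ 2 + c) * X ^ 2 +
    C (c ^ 4 + 2 * c ^ 3 + c ^ 2 + 2 * c) * X +
    C (c ^ 6 + 3 * c ^ 5 + 3 * c ^ 4 + 3 * c ^ 3 + 2 * c ^ 2 + 1)

/-- The group 𝒢 ⊆ S₁₂, generated by (5,8,7,6)(9,12,11,10),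
(1,3)(2,4)(5,10,7,12)(6,11,8,9) and (1,12,7)(2,9,8)(3,10,5)(4,11,6)
(here written on {0,…,11}). -/
def Ggroup : Subgroup (Equiv.Perm (Fin 12)) :=
  Subgroup.closure
    {([4, 7, 6, 5] : List (Fin 12)).formPerm * ([8, 11, 10, 9] : List (Fin 12)).formPerm,
     ([0, 2] : List (Fin 12)).formPerm * ([1, 3] : List (Fin 12)).formPerm *
       ([4, 9, 6, 11] : List (Fin 12)).formPerm * ([5, 10, 7, 8] : List (Fin 12)).formPerm,
     ([0, 11, 6] : List (Fin 12)).formPerm * ([1, 8, 7] : List (Fin 12)).formPerm *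
       ([2, 9, 4] : List (Fin 12)).formPerm * ([3, 10, 5] : List (Fin 12)).formPerm}

open Polynomial

namespace P4

/-- The curve y² = x³ + A x² + B x. -/
abbrev EC (A B : ℚ) : WeierstrassCurve.Affine ℚ := ⟨0, A, 0, B, 0⟩

/-- The point `S` is affine with the coordinates `(x, y)`. -/
def IsPt {A B : ℚ} (S : (EC A B).Point) (x y : ℚ) : Prop :=
  ∃ h : (EC A B).Nonsingular x y, S = WeierstrassCurve.Affine.Point.some x y h

section
variable {A B : ℚ}

lemma IsPt.eqn {S : (EC A B).Point} {x y : ℚ} (h : IsPt S x y) :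
    y ^ 2 = x ^ 3 + A * x ^ 2 + B * x := by
  obtain ⟨h, -⟩ := h
  have := (WeierstrassCurve.Affine.equation_iff _ _).1 h.1
  simpa using this

lemma IsPt.inj {S : (EC A B).Point} {x y x' y' : ℚ} (h : IsPt S x y) (h' : IsPt S x' y') :
    x = x' ∧ y = y' := by
  obtain ⟨h, rfl⟩ := h
  obtain ⟨h', e⟩ := h'
  simpa using e

lemma IsPt.ext {S S' : (EC A B).Point} {x y : ℚ} (h : IsPt S x y) (h' : IsPt S' x y) :
    S = S' := by
  obtain ⟨h, rfl⟩ := h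
  obtain ⟨h', rfl⟩ := h'
  rfl

lemma IsPt.ne_zero {S : (EC A B).Point} {x y : ℚ} (h : IsPt S x y) : S ≠ 0 := by
  obtain ⟨h, rfl⟩ := h
  exact WeierstrassCurve.Affine.Point.some_ne_zero _

lemma exists_isPt_of_ne {S : (EC A B).Point} (h : S ≠ 0) : ∃ x y, IsPt S x y := by
  rcases S with _ | ⟨x, y, hh⟩
  · exact absurd rfl h
  · exact ⟨x, y, hh, rfl⟩

lemma exists_isPt (hB : B * (A ^ 2 - 4 * B) ≠ 0) {x y : ℚ}
    (h : y ^ 2 = x ^ 3 + A * x ^ 2 + B * x) : ∃ S : (EC A B).Point, IsPt S x y := by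
  have hd : (EC A B).Δ ≠ 0 := by
    have : (EC A B).Δ = 16 * B * (B * (A ^ 2 - 4 * B)) := by
      simp [WeierstrassCurve.Δ, WeierstrassCurve.b₂, WeierstrassCurve.b₄, WeierstrassCurve.b₆,
        WeierstrassCurve.b₈]
      ring
    rw [this]
    have hb : B ≠ 0 := left_ne_zero_of_mul hB
    exact mul_ne_zero (mul_ne_zero (by norm_num) hb) hB
  have he : (EC A B).Equation x y := by
    rw [WeierstrassCurve.Affine.equation_iff]
    simpa using h
  exact ⟨_, ((WeierstrassCurve.Affine.equation_iff_nonsingular_of_Δ_ne_zero hd).1 he), rfl⟩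

lemma IsPt.neg {S : (EC A B).Point} {x y : ℚ} (h : IsPt S x y) : IsPt (-S) x (-y) := by
  obtain ⟨h, rfl⟩ := h
  rw [WeierstrassCurve.Affine.Point.neg_some]
  have e : (EC A B).negY x y = -y := by simp [WeierstrassCurve.Affine.negY]
  refine ⟨by simpa [e] using (WeierstrassCurve.Affine.nonsingular_neg x y).2 h, ?_⟩
  simp

lemma IsPt.add {S S' : (EC A B).Point} {x y x' y' l : ℚ} (h : IsPt S x y) (h' : IsPt S' x' y')
    (hx : x ≠ x') (hl : l * (x - x') = y - y') :
    IsPt (S + S') (l ^ 2 - A - x - x') (l * (x - (l ^ 2 - A - x - x')) - y) := by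
  obtain ⟨h, rfl⟩ := h
  obtain ⟨h', rfl⟩ := h'
  have hs : (EC A B).slope x x' y y' = l := by
    rw [WeierstrassCurve.Affine.slope_of_X_ne hx, div_eq_iff (sub_ne_zero.2 hx), hl]
  have e1 : (EC A B).addX x x' ((EC A B).slope x x' y y') = l ^ 2 - A - x - x' := by
    rw [hs]; simp [WeierstrassCurve.Affine.addX]
  have e2 : (EC A B).addY x x' y ((EC A B).slope x x' y y') =
      l * (x - (l ^ 2 - A - x - x')) - y := by
    rw [hs]
    simp [WeierstrassCurve.Affine.addX, WeierstrassCurve.Affine.addY,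
      WeierstrassCurve.Affine.negAddY, WeierstrassCurve.Affine.negY]
    ring
  rw [WeierstrassCurve.Affine.Point.add_of_X_ne hx]
  rw [← e2, ← e1]
  exact ⟨WeierstrassCurve.Affine.nonsingular_add h h' (fun q => hx q.1), rfl⟩

lemma IsPt.dbl {S : (EC A B).Point} {x y l : ℚ} (h : IsPt S x y)
    (hy : y ≠ 0) (hl : l * (2 * y) = 3 * x ^ 2 + 2 * A * x + B) :
    IsPt (S + S) (l ^ 2 - A - x - x) (l * (x - (l ^ 2 - A - x - x)) - y) := by
  obtain ⟨h, rfl⟩ := h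
  have hy' : y ≠ (EC A B).negY x y := by
    simp only [WeierstrassCurve.Affine.negY]
    intro q
    apply hy
    linarith
  have hs : (EC A B).slope x x y y = l := by
    rw [WeierstrassCurve.Affine.slope_of_Y_ne rfl hy', div_eq_iff (sub_ne_zero.2 hy')]
    simp [WeierstrassCurve.Affine.negY]
    linarith
  have e1 : (EC A B).addX x x ((EC A B).slope x x y y) = l ^ 2 - A - x - x := by
    rw [hs]; simp [WeierstrassCurve.Affine.addX]
  have e2 : (EC A B).addY x x y ((EC A B).slope x x y y) =
      l * (x - (l ^ 2 - A - x - x)) - y := by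
    rw [hs]
    simp [WeierstrassCurve.Affine.addX, WeierstrassCurve.Affine.addY,
      WeierstrassCurve.Affine.negAddY, WeierstrassCurve.Affine.negY]
    ring
  rw [WeierstrassCurve.Affine.Point.add_self_of_Y_ne hy']
  rw [← e2, ← e1]
  exact ⟨WeierstrassCurve.Affine.nonsingular_add h h (fun q => hy' q.2), rfl⟩

lemma IsPt.add_eq {S S' : (EC A B).Point} {x y x' y' : ℚ} (h : IsPt S x y) (h' : IsPt S' x' y')
    (hx : x ≠ x') (l x'' y'' : ℚ) (hl : l * (x - x') = y - y') (h1 : x'' = l ^ 2 - A - x - x')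
    (h2 : y'' = l * (x - x'') - y) : IsPt (S + S') x'' y'' := by
  subst h1; subst h2; exact h.add h' hx hl

lemma IsPt.dbl_eq {S : (EC A B).Point} {x y : ℚ} (h : IsPt S x y)
    (hy : y ≠ 0) (l x'' y'' : ℚ) (hl : l * (2 * y) = 3 * x ^ 2 + 2 * A * x + B)
    (h1 : x'' = l ^ 2 - A - x - x) (h2 : y'' = l * (x - x'') - y) : IsPt (S + S) x'' y'' := by
  subst h1; subst h2; exact h.dbl hy hl

lemma IsPt.eq_or_neg {S S' : (EC A B).Point} {x y y' : ℚ} (h : IsPt S x y) (h' : IsPt S' x y') :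
    S = S' ∨ S = -S' := by
  have e1 := h.eqn
  have e2 := h'.eqn
  have : (y - y') * (y + y') = 0 := by linear_combination e1 - e2
  rcases mul_eq_zero.1 this with q | q
  · left; have : y = y' := by linarith
    subst this; exact h.ext h'
  · right; have : y = -y' := by linarith
    subst this; exact h.ext h'.neg

lemma IsPt.dbl_zero {S : (EC A B).Point} {x : ℚ} (h : IsPt S x 0) : S + S = 0 := by
  have := h.neg
  rw [neg_zero] at this
  have e := h.ext this
  nth_rewrite 2 [e]
  simp

lemma line_K1 {x1 y1 x2 y2 l : ℚ} (e1 : y1 ^ 2 = x1 ^ 3 + A * x1 ^ 2 + B * x1)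
    (e2 : y2 ^ 2 = x2 ^ 3 + A * x2 ^ 2 + B * x2) (hx : x1 ≠ x2) (hl : l * (x1 - x2) = y1 - y2) :
    x1 * x2 + (x1 + x2) * (l ^ 2 - A - x1 - x2) = B - 2 * l * (y1 - l * x1) ∧
    x1 * x2 * (l ^ 2 - A - x1 - x2) = (y1 - l * x1) ^ 2 := by
  have h0 : x1 - x2 ≠ 0 := sub_ne_zero.2 hx
  have hA : x1 * x2 + (x1 + x2) * (l ^ 2 - A - x1 - x2) = B - 2 * l * (y1 - l * x1) := by
    apply mul_left_cancel₀ h0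
    have : y2 = y1 - l * (x1 - x2) := by linarith
    subst this
    linear_combination (e1 - e2)
  refine ⟨hA, ?_⟩
  linear_combination x1 * hA - e1

lemma v_div_lt {p : ℕ} [Fact p.Prime] {a b : ℚ} (ha : Rat.padicValuation p a < 1)
    (hb : Rat.padicValuation p b = 1) : Rat.padicValuation p (a / b) < 1 := by
  rw [map_div₀, hb, div_one]; exact ha

lemma v_mul_lt {p : ℕ} [Fact p.Prime] {a b : ℚ} (ha : Rat.padicValuation p a < 1)
    (hb : Rat.padicValuation p b ≤ 1) : Rat.padicValuation p (a * b) < 1 := by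
  rw [map_mul]
  calc _ ≤ Rat.padicValuation p a * 1 := by gcongr
    _ < 1 := by simpa using ha

lemma v_mul_lt' {p : ℕ} [Fact p.Prime] {a b : ℚ} (ha : Rat.padicValuation p a ≤ 1)
    (hb : Rat.padicValuation p b < 1) : Rat.padicValuation p (a * b) < 1 := by
  rw [mul_comm]; exact v_mul_lt hb ha

lemma v_mul_le {p : ℕ} [Fact p.Prime] {a b : ℚ} (ha : Rat.padicValuation p a ≤ 1)
    (hb : Rat.padicValuation p b ≤ 1) : Rat.padicValuation p (a * b) ≤ 1 := by
  rw [map_mul]; exact mul_le_one' ha hb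

lemma v_pow_le {p : ℕ} [Fact p.Prime] {a : ℚ} (ha : Rat.padicValuation p a ≤ 1) (n : ℕ) :
    Rat.padicValuation p (a ^ n) ≤ 1 := by
  rw [map_pow]; exact pow_le_one' ha n

lemma v_pow_lt {p : ℕ} [Fact p.Prime] {a : ℚ} (ha : Rat.padicValuation p a < 1) {n : ℕ}
    (hn : n ≠ 0) : Rat.padicValuation p (a ^ n) < 1 := by
  rw [map_pow]; exact pow_lt_one' ha hn

lemma v_int {p : ℕ} [Fact p.Prime] (n : ℤ) : Rat.padicValuation p (n : ℚ) ≤ 1 := by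
  rw [Rat.padicValuation_cast]; exact Int.padicValuation_le_one p n

lemma v_nat {p : ℕ} [Fact p.Prime] (n : ℕ) : Rat.padicValuation p (n : ℚ) ≤ 1 := by
  exact_mod_cast v_int (p := p) n

lemma v_unit_sub {p : ℕ} [Fact p.Prime] {a : ℚ} (ha : Rat.padicValuation p a < 1) :
    Rat.padicValuation p (1 - a) = 1 := Valuation.map_one_sub_of_lt _ ha

lemma v_unit_ne {p : ℕ} [Fact p.Prime] {a : ℚ} (ha : Rat.padicValuation p a = 1) : a ≠ 0 := by
  rintro rfl; simp at ha

/-- Adding a point of the kernel of reduction does not change the reduction. -/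
lemma val_key (p : ℕ) [Fact p.Prime] {S1 S2 : (EC A B).Point} {x1 y1 x2 y2 : ℚ}
    (hA : Rat.padicValuation p A ≤ 1) (hB : Rat.padicValuation p B ≤ 1)
    (h1 : IsPt S1 x1 y1) (h2 : IsPt S2 x2 y2) (hx1 : 1 < Rat.padicValuation p x1)
    (hx2 : Rat.padicValuation p x2 ≤ 1) (hy2 : Rat.padicValuation p y2 ≤ 1) :
    ∃ x3 y3, IsPt (S1 + S2) x3 y3 ∧ Rat.padicValuation p x3 ≤ 1 ∧ Rat.padicValuation p y3 ≤ 1 ∧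
      Rat.padicValuation p (x3 - x2) < 1 ∧ Rat.padicValuation p (y3 - y2) < 1 := by
  have hne : x1 ≠ x2 := by rintro rfl; exact absurd hx1 (not_lt.2 hx2)
  have e1 := h1.eqn
  have e2 := h2.eqn
  have hx0 : x1 ≠ 0 := by rintro rfl; simp at hx1
  have hi : Rat.padicValuation p (x1⁻¹) < 1 := by
    rw [map_inv₀]; exact inv_lt_one_of_one_lt₀ hx1
  have hr : Rat.padicValuation p (1 + (A * x1⁻¹ + B * x1⁻¹ ^ 2)) = 1 := by
    apply Valuation.map_one_add_of_lt
    apply Valuation.map_add_lt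
    · exact v_mul_lt' hA hi
    · exact v_mul_lt' hB (v_pow_lt hi two_ne_zero)
  have hy1 : Rat.padicValuation p y1 ^ 2 = Rat.padicValuation p x1 ^ 3 := by
    have : y1 ^ 2 = x1 ^ 3 * (1 + (A * x1⁻¹ + B * x1⁻¹ ^ 2)) := by
      rw [e1]; field_simp; ring
    rw [← map_pow, this, map_mul, hr, map_pow, mul_one]
  have hy0 : y1 ≠ 0 := by
    rintro rfl
    rw [map_zero, zero_pow two_ne_zero] at hy1
    have := pow_eq_zero_iff (three_ne_zero) |>.1 hy1.symm
    rw [this] at hx1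
    simp at hx1
  obtain ⟨t, ht⟩ : ∃ t, t = x1 / y1 := ⟨_, rfl⟩
  obtain ⟨e, he⟩ : ∃ e, e = 1 / y1 := ⟨_, rfl⟩
  have ht0 : t ≠ 0 := by rw [ht]; exact div_ne_zero hx0 hy0
  have vt : Rat.padicValuation p t < 1 := by
    have : Rat.padicValuation p t ^ 2 < 1 := by
      have : t ^ 2 = x1⁻¹ * (1 + (A * x1⁻¹ + B * x1⁻¹ ^ 2))⁻¹ := by
        have hr0 := v_unit_ne hr
        rw [ht, div_pow, e1]
        field_simp
        congr 1; ring
      rw [← map_pow, this, map_mul, map_inv₀ _ (1 + _), hr]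
      simpa using hi
    by_contra hcon
    exact absurd this (not_lt.2 (one_le_pow_of_one_le' (not_lt.1 hcon) 2))
  have ve : Rat.padicValuation p e < 1 := by
    have : e = t * x1⁻¹ := by rw [he, ht]; field_simp
    rw [this]; exact v_mul_lt vt hi.le
  have hq : e * (1 - (A * t ^ 2 + B * t * e)) = t ^ 3 := by
    rw [he, ht]; field_simp; linear_combination e1
  have vQ : Rat.padicValuation p (1 - (A * t ^ 2 + B * t * e)) = 1 := by
    apply v_unit_sub
    apply Valuation.map_add_lt
    · exact v_mul_lt' hA (v_pow_lt vt two_ne_zero)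
    · exact v_mul_lt (v_mul_lt' hB vt) ve.le
  obtain ⟨Q, hQ⟩ : ∃ Q, Q = 1 - (A * t ^ 2 + B * t * e) := ⟨_, rfl⟩
  rw [← hQ] at hq vQ
  have hQ0 := v_unit_ne vQ
  have he' : e = t ^ 3 / Q := by rw [eq_div_iff hQ0, hq]
  have vD : Rat.padicValuation p (1 - x2 * t ^ 2 / Q) = 1 :=
    v_unit_sub (v_div_lt (v_mul_lt' hx2 (v_pow_lt vt two_ne_zero)) vQ)
  have vF : Rat.padicValuation p (1 - y2 * e) = 1 := v_unit_sub (v_mul_lt' hy2 ve)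
  have vG : Rat.padicValuation p (1 - -(e * y2)) = 1 :=
    v_unit_sub (by rw [Valuation.map_neg]; exact v_mul_lt ve hy2)
  obtain ⟨D, hD⟩ : ∃ D, D = 1 - x2 * t ^ 2 / Q := ⟨_, rfl⟩
  obtain ⟨F, hF⟩ : ∃ F, F = 1 - y2 * e := ⟨_, rfl⟩
  obtain ⟨G, hG⟩ : ∃ G, G = 1 - -(e * y2) := ⟨_, rfl⟩
  rw [← hD] at vD
  rw [← hF] at vF
  rw [← hG] at vG
  have hD0 := v_unit_ne vD
  have hF0 := v_unit_ne vF
  have hG0 := v_unit_ne vG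
  obtain ⟨k, hk⟩ : ∃ k, k = t * D / F := ⟨_, rfl⟩
  have hk0 : k ≠ 0 := by rw [hk]; positivity
  have vk : Rat.padicValuation p k < 1 := by
    rw [hk]; exact v_div_lt (v_mul_lt vt vD.le) vF
  obtain ⟨n, hn⟩ : ∃ n, n = x2 - k * y2 := ⟨_, rfl⟩
  have vn : Rat.padicValuation p n ≤ 1 := by
    rw [hn]; exact Valuation.map_sub_le _ hx2 (v_mul_lt vk hy2).le
  obtain ⟨ε, hε⟩ : ∃ ε, ε = e / k ^ 2 * (B + 2 * A * n + 3 * n ^ 2) := ⟨_, rfl⟩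
  have vε : Rat.padicValuation p ε < 1 := by
    have : ε = t * (F / D) ^ 2 / Q * (B + 2 * A * n + 3 * n ^ 2) := by
      rw [hε, hk, he']; field_simp
    rw [this]
    apply v_mul_lt
    · refine v_div_lt (v_mul_lt vt (v_pow_le ?_ 2)) vQ
      rw [map_div₀, vF, vD, div_one]
    · refine Valuation.map_add_le _ (Valuation.map_add_le _ hB ?_) ?_
      · exact v_mul_le (v_mul_le (by exact_mod_cast v_nat 2) hA) vn
      · exact v_mul_le (by exact_mod_cast v_nat 3) (v_pow_le vn 2)
  have hkd : k * (1 - y2 * e) = t - x2 * e := by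
    rw [← hF, hk, div_mul_cancel₀ _ hF0, hD, he']; field_simp
  have hkl : k * (y1 - y2) = x1 - x2 := by
    have : y1 * (k * (1 - y2 * e)) = y1 * (t - x2 * e) := by rw [hkd]
    rw [he, ht] at this
    field_simp at this
    linarith
  have hl : 1 / k * (x1 - x2) = y1 - y2 := by
    rw [← hkl]; field_simp
  have hP := h1.add h2 hne hl
  obtain ⟨K1, -⟩ := line_K1 e1 e2 hne hl
  obtain ⟨x3, hx3⟩ : ∃ x3, x3 = (1 / k) ^ 2 - A - x1 - x2 := ⟨_, rfl⟩
  rw [← hx3] at hP K1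
  obtain ⟨y3, hy3⟩ : ∃ y3, y3 = 1 / k * (x1 - x3) - y1 := ⟨_, rfl⟩
  rw [← hy3] at hP
  have ex3 : x3 = x2 - k * (y3 + y2) := by
    rw [hy3]; field_simp; linarith
  have ey3 : y3 * G = y2 - ε := by
    have h3 : (y1 * y2 - y1 * y3 - y2 * y3) * k ^ 2= B + 2 * A * n + 3 * n ^ 2 := by
      have g1 : k * y1 = x1 - n := by rw [hn]; linarith
      have g2 : k * y2 = x2 - n := by rw [hn]; linarith
      have g3 : k * y3 = n - x3 := by rw [hn, ex3]; ring
      have g4 : y1 - 1 / k * x1 = - n * (1 / k) := by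
        field_simp; linarith
      rw [g4] at K1
      have : (y1 * y2 - y1 * y3 - y2 * y3) * k ^ 2 =
          (k * y1) * (k * y2) - (k * y1) * (k * y3) - (k * y2) * (k * y3) := by ring
      rw [this, g1, g2, g3]
      linear_combination K1 - 2 * n * hx3
    have h4 : y1 * e = 1 := by rw [he]; field_simp
    have h5 : ε * k ^ 2 = e * (B + 2 * A * n + 3 * n ^ 2) := by rw [hε]; field_simp
    rw [← h3] at h5
    have h6 : ε = e * (y1 * y2 - y1 * y3 - y2 * y3) := by
      apply mul_right_cancel₀ (pow_ne_zero 2 hk0); linear_combination h5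
    rw [h6, hG]
    linear_combination (y2 - y3) * h4
  have ey3' : y3 = (y2 - ε) / G := by rw [eq_div_iff hG0, ey3]
  have vy3 : Rat.padicValuation p y3 ≤ 1 := by
    rw [ey3', map_div₀, vG, div_one]; exact Valuation.map_sub_le _ hy2 vε.le
  have vxx : Rat.padicValuation p (x3 - x2) < 1 := by
    have : x3 - x2 = -(k * (y3 + y2)) := by rw [ex3]; ring
    rw [this, Valuation.map_neg]
    exact v_mul_lt vk (Valuation.map_add_le _ vy3 hy2)
  refine ⟨x3, y3, hP, ?_, vy3, vxx, ?_⟩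
  · have : x3 = (x3 - x2) + x2 := by ring
    rw [this]; exact Valuation.map_add_le _ vxx.le hx2
  · have : y3 - y2 = (-ε - e * y2 * y2) / G := by
      rw [eq_div_iff hG0, sub_mul, ey3, hG]; ring
    rw [this]
    refine v_div_lt (Valuation.map_sub_lt _ ?_ (v_mul_lt (v_mul_lt ve hy2) hy2)) vG
    rw [Valuation.map_neg]; exact vε

/-- Membership in the kernel of reduction. -/
def InK (p : ℕ) [Fact p.Prime] (S : (EC A B).Point) : Prop :=
  ∀ x y, IsPt S x y → 1 < Rat.padicValuation p x

variable {p : ℕ} [Fact p.Prime]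

lemma v_y_le (hA : Rat.padicValuation p A ≤ 1) (hB : Rat.padicValuation p B ≤ 1)
    {x y : ℚ} (h : y ^ 2 = x ^ 3 + A * x ^ 2 + B * x) (hx : Rat.padicValuation p x ≤ 1) :
    Rat.padicValuation p y ≤ 1 := by
  have : Rat.padicValuation p y ^ 2 ≤ 1 := by
    rw [← map_pow, h]
    exact Valuation.map_add_le _ (Valuation.map_add_le _ (v_pow_le hx 3)
      (v_mul_le hA (v_pow_le hx 2))) (v_mul_le hB hx)
  by_contra hcon
  exact absurd this (not_le.2 (one_lt_pow' (not_le.1 hcon) two_ne_zero))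

lemma InK.zero : InK p (0 : (EC A B).Point) := fun _ _ h => absurd rfl h.ne_zero

lemma InK.neg {S : (EC A B).Point} (h : InK p S) : InK p (-S) := by
  intro x y hxy
  have := hxy.neg
  rw [neg_neg] at this
  exact h _ _ this

lemma InK.add_red (hA : Rat.padicValuation p A ≤ 1) (hB : Rat.padicValuation p B ≤ 1)
    {S1 S2 : (EC A B).Point} (h1 : InK p S1) {x2 y2 : ℚ} (h2 : IsPt S2 x2 y2)
    (hx2 : Rat.padicValuation p x2 ≤ 1) :
    ∃ x3 y3, IsPt (S1 + S2) x3 y3 ∧ Rat.padicValuation p x3 ≤ 1 ∧ Rat.padicValuation p y3 ≤ 1 ∧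
      Rat.padicValuation p (x3 - x2) < 1 ∧ Rat.padicValuation p (y3 - y2) < 1 := by
  have hy2 := v_y_le hA hB h2.eqn hx2
  by_cases h0 : S1 = 0
  · subst h0
    rw [zero_add]
    exact ⟨x2, y2, h2, hx2, hy2, by simp, by simp⟩
  · obtain ⟨x1, y1, h11⟩ := exists_isPt_of_ne h0
    exact val_key p hA hB h11 h2 (h1 _ _ h11) hx2 hy2

lemma InK.add (hA : Rat.padicValuation p A ≤ 1) (hB : Rat.padicValuation p B ≤ 1)
    {S1 S2 : (EC A B).Point} (h1 : InK p S1) (h2 : InK p S2) : InK p (S1 + S2) := by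
  intro x y hxy
  by_contra hcon
  rw [not_lt] at hcon
  obtain ⟨x3, y3, h3, h4, -⟩ := h1.neg.add_red hA hB hxy hcon
  rw [neg_add_cancel_left] at h3
  exact absurd (h2 _ _ h3) (not_lt.2 h4)

lemma InK.zsmul (hA : Rat.padicValuation p A ≤ 1) (hB : Rat.padicValuation p B ≤ 1)
    {S : (EC A B).Point} (h : InK p S) (n : ℤ) : InK p (n • S) := by
  induction n using Int.induction_on with
  | zero => simpa using InK.zero
  | succ i hi => rw [add_zsmul, one_zsmul]; exact hi.add hA hB h
  | pred i hi => rw [sub_zsmul, one_zsmul]; exact hi.add hA hB h.neg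

lemma IsPt.addT {S T : (EC A B).Point} {x y : ℚ} (h : IsPt S x y) (hT : IsPt T 0 0)
    (hx : x ≠ 0) : IsPt (S + T) (B / x) (-(B * y) / x ^ 2) := by
  have e := h.eqn
  refine h.add_eq hT hx (y / x) _ _ (by field_simp; ring) ?_ ?_
  · field_simp; linear_combination -e
  · field_simp; linear_combination 0 * e

lemma InK.of_T {S T : (EC A B).Point} {x y : ℚ} (h : IsPt S x y) (hT : IsPt T 0 0)
    (hx : Rat.padicValuation p x < 1) (hB : Rat.padicValuation p B = 1) : InK p (S + T) := by
  intro x' y' h'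
  by_cases hx0 : x = 0
  · subst hx0
    have e := h.eqn
    have : y = 0 := by simpa using e
    subst this
    rw [h.ext hT, hT.dbl_zero] at h'
    exact absurd rfl h'.ne_zero
  · obtain ⟨e, -⟩ := h'.inj (h.addT hT hx0)
    rw [e, map_div₀, hB, one_div]
    refine (one_lt_inv₀ ?_).2 hx
    simpa [zero_lt_iff] using hx0

/-- If `n ≡ r²` modulo `p` with `r` rational, then `n` is a square mod `p`. -/
lemma isSquare_of_val {n : ℤ} {r : ℚ} (h : Rat.padicValuation p (r ^ 2 - n) < 1) :
    IsSquare (n : ZMod p) := by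
  have hr : Rat.padicValuation p r ≤ 1 := by
    have : Rat.padicValuation p r ^ 2 ≤ 1 := by
      have e : r ^ 2 = (r ^ 2 - n) + n := by ring
      rw [← map_pow, e]
      exact Valuation.map_add_le _ h.le (v_int n)
    by_contra hcon
    exact absurd this (not_le.2 (one_lt_pow' (not_le.1 hcon) two_ne_zero))
  have hd := Rat.padicValuation_le_one_iff.1 hr
  have h2 : Rat.padicValuation p ((r.num ^ 2 - n * r.den ^ 2 : ℤ) : ℚ) < 1 := by
    have : ((r.num ^ 2 - n * r.den ^ 2 : ℤ) : ℚ) = (r ^ 2 - n) * ((r.den : ℚ) ^ 2) := by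
      have hden : (r.den : ℚ) ≠ 0 := by exact_mod_cast r.den_nz
      have := Rat.mul_den_eq_num r
      push_cast
      rw [← this]; ring
    rw [this]
    exact v_mul_lt h (v_pow_le (v_nat _) 2)
  rw [Rat.padicValuation_cast, Int.padicValuation_lt_one_iff] at h2
  have h3 := (ZMod.intCast_zmod_eq_zero_iff_dvd _ p).2 h2
  push_cast at h3
  have hd' : (r.den : ZMod p) ≠ 0 := by
    rwa [Ne, ZMod.natCast_eq_zero_iff]
  refine ⟨r.num / r.den, ?_⟩
  field_simp
  linear_combination -h3
end
end P4

open Polynomial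
namespace P4

lemma coprime_mul_pow {f g b k : ℕ} (hk : k ≠ 0) (h : f * g = b ^ k) (hc : Nat.Coprime f g) :
    ∃ m n, f = m ^ k ∧ g = n ^ k ∧ b = m * n ∧ Nat.Coprime m n := by
  obtain ⟨m, hm⟩ := exists_eq_pow_of_mul_eq_pow (Nat.isUnit_iff.2 hc) h
  obtain ⟨n, hn⟩ := exists_eq_pow_of_mul_eq_pow (Nat.isUnit_iff.2 hc.symm)
    (show g * f = b ^ k by rw [mul_comm, h])
  refine ⟨m, n, hm, hn, ?_, ?_⟩
  · rw [hm, hn, ← mul_pow] at h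
    exact (Nat.pow_left_injective hk h).symm
  · rw [hm, hn] at hc
    exact (Nat.coprime_pow_left_iff (Nat.pos_of_ne_zero hk) _ _).1
      ((Nat.coprime_pow_right_iff (Nat.pos_of_ne_zero hk) _ _).1 hc)

lemma sqfree_aux {p b N k : ℕ} (hp : p.Prime) (hpb : ¬ p ∣ b) (h : p * p ∣ N * b ^ k) :
    p * p ∣ N := by
  have : Nat.Coprime (p * p) (b ^ k) := by
    apply Nat.Coprime.pow_right
    exact Nat.Coprime.mul_left ((Nat.Prime.coprime_iff_not_dvd hp).2 hpb)
      ((Nat.Prime.coprime_iff_not_dvd hp).2 hpb)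
  exact this.dvd_of_dvd_mul_right h

lemma pp_not_dvd_ten {p : ℕ} (hp : p.Prime) (h : p * p ∣ 10) : False := by
  have h2 := hp.two_le
  have : p * p ≤ 10 := Nat.le_of_dvd (by norm_num) h
  have : p ≤ 3 := by nlinarith
  interval_cases p <;> revert h <;> decide

lemma pow4_even {n : ℕ} (h : Even n) : ∃ t, n ^ 4 = 16 * t := by
  obtain ⟨k, rfl⟩ := h
  exact ⟨k ^ 4, by ring⟩

lemma pow4_odd {n : ℕ} (h : Odd n) : ∃ t, n ^ 4 = 16 * t + 1 := by
  refine ⟨n ^ 4 / 16, ?_⟩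
  have : n ^ 4 % 16 = 1 := by
    have h2 : n % 2 = 1 := Nat.odd_iff.1 h
    have h3 : n % 16 < 16 := Nat.mod_lt _ (by norm_num)
    rw [Nat.pow_mod]
    have h4 : (n % 16) % 2 = 1 := by omega
    generalize n % 16 = r at *
    interval_cases r <;> simp_all
  omega

lemma sq_mod8 (n : ℕ) : n ^ 2 % 8 = 0 ∨ n ^ 2 % 8 = 1 ∨ n ^ 2 % 8 = 4 := by
  have h3 : n % 8 < 8 := Nat.mod_lt _ (by norm_num)
  rw [Nat.pow_mod]
  generalize n % 8 = r at *
  interval_cases r <;> simp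

lemma sq_mod16 (n : ℕ) : n ^ 2 % 16 = 0 ∨ n ^ 2 % 16 = 1 ∨ n ^ 2 % 16 = 4 ∨ n ^ 2 % 16 = 9 := by
  have h3 : n % 16 < 16 := Nat.mod_lt _ (by norm_num)
  rw [Nat.pow_mod]
  generalize n % 16 = r at *
  interval_cases r <;> simp

lemma d40_odd {a b y : ℕ} (hab : Nat.Coprime a b)
    (h : y ^ 2 = a ^ 4 + 40 * b ^ 4) : Odd a := by
  by_contra ha
  rw [Nat.not_odd_iff_even] at ha
  have hb : Odd b := by
    by_contra hb
    rw [Nat.not_odd_iff_even] at hb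
    have := Nat.dvd_gcd ha.two_dvd hb.two_dvd
    rw [hab] at this
    omega
  obtain ⟨s, hs⟩ := pow4_even ha
  obtain ⟨t, ht⟩ := pow4_odd hb
  have := sq_mod16 y
  omega

lemma odd_of_coprime_even {a b : ℕ} (h : Nat.Coprime a b) (hb : Even b) : Odd a := by
  by_contra ha
  rw [Nat.not_odd_iff_even] at ha
  have := Nat.dvd_gcd ha.two_dvd hb.two_dvd
  rw [h] at this
  omega

/-- first descent -/
lemma d40_first {a b y : ℕ} (ha : 0 < a) (hb : 0 < b) (hab : Nat.Coprime a b) (hev : Even b)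
    (h : y ^ 2 = a ^ 4 + 40 * b ^ 4) :
    ∃ m n, 0 < m ∧ 0 < n ∧ Nat.Coprime m n ∧ b = m * n ∧ Odd m ∧ Even n ∧
      a ^ 2 + 10 * n ^ 4 = m ^ 4 := by
  have hao := d40_odd hab h
  have hyo : Odd y := by
    by_contra hy
    rw [Nat.not_odd_iff_even] at hy
    obtain ⟨s, hs⟩ := pow4_odd hao
    obtain ⟨k, rfl⟩ := hy
    have : (k + k) ^ 2 = 4 * k ^ 2 := by ring
    omega
  have hlt : a ^ 2 < y := by
    have : (a ^ 2) ^ 2 < y ^ 2 := by rw [h]; nlinarith [pow_pos hb 4]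
    exact lt_of_pow_lt_pow_left₀ 2 (by omega) this
  obtain ⟨f, hf⟩ : ∃ f, y = a ^ 2 + 2 * f := by
    have h2 : Odd (a ^ 2) := hao.pow
    rcases h2 with ⟨u, hu⟩
    rcases hyo with ⟨w, hw⟩
    exact ⟨w - u, by omega⟩
  obtain ⟨g, hg⟩ : ∃ g, g = f + a ^ 2 := ⟨_, rfl⟩
  have hfg : f * g = 10 * b ^ 4 := by
    rw [hf] at h
    rw [hg]
    nlinarith
  have hcop : Nat.Coprime f g := by
    refine Nat.coprime_of_dvd fun p hp h1 h2 => ?_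
    have h3 : p ∣ a := by
      have : p ∣ a ^ 2 := (Nat.dvd_add_right h1).1 (by rwa [← hg])
      exact hp.dvd_of_dvd_pow this
    have h4 : ¬ p ∣ b := fun h4 => by
      have := Nat.dvd_gcd h3 h4
      rw [hab] at this
      exact hp.one_lt.ne' (Nat.dvd_one.1 this)
    have h5 : p * p ∣ 10 * b ^ 4 := by rw [← hfg]; exact mul_dvd_mul h1 h2
    exact pp_not_dvd_ten hp (sqfree_aux hp h4 h5)
  obtain ⟨q, hq⟩ : ∃ q, a ^ 2 = 8 * q + 1 := by
    obtain ⟨u, hu⟩ := hao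
    refine ⟨a ^ 2 / 8, ?_⟩
    have h1 := sq_mod8 a
    have h2 : a ^ 2 = 4 * (u ^ 2 + u) + 1 := by rw [hu]; ring
    omega
  have h2 : 2 ∣ f ∨ 2 ∣ g := (Nat.Prime.dvd_mul Nat.prime_two).1 (by rw [hfg]; omega)
  have h5 : 5 ∣ f ∨ 5 ∣ g := (Nat.Prime.dvd_mul Nat.prime_five).1 (by rw [hfg]; omega)
  have key : ∀ F G : ℕ, F * G = b ^ 4 → F ∣ f → G ∣ g → ∃ m n, F = m ^ 4 ∧ G = n ^ 4 ∧
      b = m * n ∧ Nat.Coprime m n := fun F G e1 e2 e3 =>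
    coprime_mul_pow (by norm_num) e1 (Nat.Coprime.of_dvd e2 e3 hcop)
  rcases h2 with ⟨f', rfl⟩ | ⟨g', hg'⟩
  · have h5' : 5 ∣ f' ∨ 5 ∣ g := by
      rcases h5 with h5 | h5
      · left; omega
      · right; exact h5
    rcases h5' with ⟨f'', rfl⟩ | ⟨g', hg'⟩
    · obtain ⟨m, n, e1, e2, e3, e4⟩ := key f'' g (by nlinarith) ⟨10, by ring⟩ dvd_rfl
      have hm : 0 < m := by rcases Nat.eq_zero_or_pos m with rfl | h; simp at e3; omega; exact h
      have hn : 0 < n := by rcases Nat.eq_zero_or_pos n with rfl | h; simp at e3; omega; exact h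
      have hno : Odd n := by
        by_contra hno
        rw [Nat.not_odd_iff_even] at hno
        obtain ⟨t, ht⟩ := pow4_even hno
        omega
      have hme : Even m := by
        rw [e3] at hev
        rcases Nat.even_mul.1 hev with h | h
        · exact h
        · exact absurd h (Nat.not_even_iff_odd.2 hno)
      exact ⟨n, m, hn, hm, e4.symm, by rw [e3, mul_comm], hno, hme, by omega⟩
    · exfalso
      obtain ⟨m, n, e1, e2, e3, e4⟩ := key f' g' (by rw [hg'] at hfg; nlinarith) ⟨2, by ring⟩
        ⟨5, by rw [hg']; ring⟩
      rcases Nat.even_or_odd n with hn | hn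
      · obtain ⟨t, ht⟩ := pow4_even hn
        omega
      · have hm : Even m := by
          rw [e3] at hev
          rcases Nat.even_mul.1 hev with h | h
          · exact h
          · exact absurd h (Nat.not_even_iff_odd.2 hn)
        obtain ⟨t, ht⟩ := pow4_even hm
        obtain ⟨s, hs⟩ := pow4_odd hn
        omega
  · exfalso
    rcases h5 with ⟨f', rfl⟩ | h5
    · obtain ⟨m, n, e1, e2, e3, e4⟩ := key f' g' (by rw [hg'] at hfg; nlinarith) ⟨5, by ring⟩
        ⟨2, by rw [hg']; ring⟩
      rcases Nat.even_or_odd m with hm | hm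
      · obtain ⟨t, ht⟩ := pow4_even hm
        omega
      · have hn : Even n := by
          rw [e3] at hev
          rcases Nat.even_mul.1 hev with h | h
          · exact absurd h (Nat.not_even_iff_odd.2 hm)
          · exact h
        obtain ⟨t, ht⟩ := pow4_even hn
        obtain ⟨s, hs⟩ := pow4_odd hm
        omega
    · obtain ⟨g'', rfl⟩ : 5 ∣ g' := by omega
      obtain ⟨m, n, e1, e2, e3, e4⟩ := key f g'' (by rw [hg'] at hfg; nlinarith) dvd_rfl
        ⟨10, by rw [hg']; ring⟩
      rcases Nat.even_or_odd m with hm | hm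
      · obtain ⟨t, ht⟩ := pow4_even hm
        omega
      · have hn : Even n := by
          rw [e3] at hev
          rcases Nat.even_mul.1 hev with h | h
          · exact absurd h (Nat.not_even_iff_odd.2 hm)
          · exact h
        obtain ⟨t, ht⟩ := pow4_even hn
        obtain ⟨s, hs⟩ := pow4_odd hm
        omega

/-- second descent -/
lemma d40_second {a m n : ℕ} (ha : Odd a) (hn0 : 0 < n) (hm : Odd m) (hn : Even n)
    (hc : Nat.Coprime m n) (h : a ^ 2 + 10 * n ^ 4 = m ^ 4) :
    ∃ k l, 0 < k ∧ 0 < l ∧ Nat.Coprime k l ∧ n = 2 * k * l ∧ m ^ 2 = k ^ 4 + 40 * l ^ 4 ∧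
      (a + 40 * l ^ 4 = k ^ 4 ∨ a + k ^ 4 = 40 * l ^ 4) := by
  have hlt : a < m ^ 2 := by
    have : a ^ 2 < (m ^ 2) ^ 2 := by
      have := pow_pos hn0 4
      nlinarith
    exact lt_of_pow_lt_pow_left₀ 2 (by omega) this
  obtain ⟨f, hf⟩ : ∃ f, m ^ 2 = a + 2 * f := by
    have h2 : Odd (m ^ 2) := hm.pow
    rcases h2 with ⟨u, hu⟩
    rcases ha with ⟨w, hw⟩
    exact ⟨u - w, by omega⟩
  obtain ⟨g, hg⟩ : ∃ g, g = f + a := ⟨_, rfl⟩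
  obtain ⟨n', hn'⟩ := hn
  have hn'' : n = 2 * n' := by omega
  subst hn''
  have hfg : f * g = 40 * n' ^ 4 := by
    have : (a + 2 * f) ^ 2 = m ^ 4 := by rw [← hf]; ring
    rw [hg]
    nlinarith
  have hm2 : m ^ 2 = f + g := by omega
  have hcop : Nat.Coprime f g := by
    refine Nat.coprime_of_dvd fun p hp h1 h2 => ?_
    have h3 : p ∣ m := by
      have : p ∣ m ^ 2 := by rw [hm2]; exact dvd_add h1 h2
      exact hp.dvd_of_dvd_pow this
    have h3' : p ∣ a := (Nat.dvd_add_right h1).1 (by rwa [← hg])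
    have h4 : ¬ p ∣ 2 * n' := fun h4 => by
      have := Nat.dvd_gcd h3 h4
      rw [hc] at this
      exact hp.one_lt.ne' (Nat.dvd_one.1 this)
    have h5 : p * p ∣ 10 * (2 * n') ^ 4 := by
      have e : 10 * (2 * n') ^ 4 = 4 * (f * g) := by rw [hfg]; ring
      rw [e]; exact (mul_dvd_mul h1 h2).mul_left _
    exact pp_not_dvd_ten hp (sqfree_aux hp h4 h5)
  have key : ∀ F G : ℕ, F * G = n' ^ 4 → F ∣ f → G ∣ g → ∃ m n, F = m ^ 4 ∧ G = n ^ 4 ∧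
      n' = m * n ∧ Nat.Coprime m n := fun F G e1 e2 e3 =>
    coprime_mul_pow (by norm_num) e1 (Nat.Coprime.of_dvd e2 e3 hcop)
  have pos : ∀ m n : ℕ, n' = m * n → 0 < m ∧ 0 < n := by
    intro m n e
    constructor
    · rcases Nat.eq_zero_or_pos m with rfl | h
      · simp at e; omega
      · exact h
    · rcases Nat.eq_zero_or_pos n with rfl | h
      · simp at e; omega
      · exact h
  have h5 : 5 ∣ f ∨ 5 ∣ g := (Nat.Prime.dvd_mul Nat.prime_five).1 (by rw [hfg]; omega)
  have h8 : 8 ∣ f ∨ 8 ∣ g := by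
    have h2 : 2 ∣ f ∨ 2 ∣ g := (Nat.Prime.dvd_mul Nat.prime_two).1 (by rw [hfg]; omega)
    have h8 : 2 ^ 3 ∣ f * g := by rw [hfg]; exact ⟨5 * n' ^ 4, by ring⟩
    rcases h2 with h2 | h2
    · left
      have : Nat.Coprime (2 ^ 3) g := Nat.Coprime.pow_left 3 (Nat.Coprime.of_dvd h2 dvd_rfl hcop)
      exact this.dvd_of_dvd_mul_right h8
    · right
      have : Nat.Coprime (2 ^ 3) f :=
        Nat.Coprime.pow_left 3 (Nat.Coprime.of_dvd h2 dvd_rfl hcop.symm)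
      exact this.dvd_of_dvd_mul_left h8
  have h8sq : ∀ k l : ℕ, m ^ 2 = 8 * k ^ 4 + 5 * l ^ 4 → False := by
    intro k l hkl
    have hmo : m ^ 2 % 8 = 1 := by
      have h1 := sq_mod8 m
      obtain ⟨u, hu⟩ := hm
      have h2 : m ^ 2 = 4 * (u ^ 2 + u) + 1 := by rw [hu]; ring
      omega
    rcases Nat.even_or_odd l with hl | hl
    · obtain ⟨t, ht⟩ := pow4_even hl
      omega
    · obtain ⟨t, ht⟩ := pow4_odd hl
      omega
  rcases h8 with ⟨f', hf'⟩ | ⟨g', hg'⟩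
  · rcases h5 with h5 | ⟨g', hg'⟩
    · obtain ⟨f'', rfl⟩ : 5 ∣ f' := by omega
      obtain ⟨k, l, e1, e2, e3, e4⟩ := key f'' g (by rw [hf'] at hfg; nlinarith)
        ⟨40, by rw [hf']; ring⟩ dvd_rfl
      obtain ⟨p1, p2⟩ := pos k l e3
      exact ⟨l, k, p2, p1, e4.symm, by rw [e3]; ring, by omega, by omega⟩
    · exfalso
      obtain ⟨k, l, e1, e2, e3, e4⟩ := key f' g' (by rw [hf', hg'] at hfg; nlinarith)
        ⟨8, by rw [hf']; ring⟩ ⟨5, by rw [hg']; ring⟩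
      exact h8sq k l (by omega)
  · rcases h5 with ⟨f', hf'⟩ | h5
    · exfalso
      obtain ⟨k, l, e1, e2, e3, e4⟩ := key f' g' (by rw [hf', hg'] at hfg; nlinarith)
        ⟨5, by rw [hf']; ring⟩ ⟨8, by rw [hg']; ring⟩
      exact h8sq l k (by omega)
    · obtain ⟨g'', rfl⟩ : 5 ∣ g' := by omega
      obtain ⟨k, l, e1, e2, e3, e4⟩ := key f g'' (by rw [hg'] at hfg; nlinarith) dvd_rfl
        ⟨40, by rw [hg']; ring⟩
      obtain ⟨p1, p2⟩ := pos k l e3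
      exact ⟨k, l, p1, p2, e4, by rw [e3]; ring, by omega, by omega⟩
end P4

open Polynomial
namespace P4

lemma IsPt.dblX {A B : ℚ} {S : (EC A B).Point} {x y : ℚ} (h : IsPt S x y) (hy : y ≠ 0) :
    ∃ Y, IsPt (S + S) ((x ^ 2 - B) ^ 2 / (4 * y ^ 2)) Y := by
  have e := h.eqn
  refine ⟨_, h.dbl_eq hy ((3 * x ^ 2 + 2 * A * x + B) / (2 * y)) _ _ (by field_simp) ?_ rfl⟩
  field_simp
  linear_combination (16 * A + 32 * x) * e

lemma reduce_frac {p q : ℤ} (hp : p ≠ 0) (hq : q ≠ 0) : ∃ a b : ℕ, 0 < a ∧ 0 < b ∧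
    Nat.Coprime a b ∧ a ∣ p.natAbs ∧ b ∣ q.natAbs ∧ a * q.natAbs = b * p.natAbs ∧
    ((p : ℚ) / q) ^ 2 = ((a : ℚ) / b) ^ 2 := by
  have hp' : 0 < p.natAbs := Int.natAbs_pos.2 hp
  have hq' : 0 < q.natAbs := Int.natAbs_pos.2 hq
  obtain ⟨g, a, b, hg, hab, h1, h2⟩ := Nat.exists_coprime' (m := p.natAbs) (n := q.natAbs)
    (Nat.gcd_pos_of_pos_left _ hp')
  have ha : 0 < a := by
    rcases Nat.eq_zero_or_pos a with rfl | h
    · simp at h1; omega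
    · exact h
  have hb : 0 < b := by
    rcases Nat.eq_zero_or_pos b with rfl | h
    · simp at h2; omega
    · exact h
  refine ⟨a, b, ha, hb, hab, ⟨g, h1⟩, ⟨g, h2⟩, by rw [h1, h2]; ring, ?_⟩
  have e1 : (p : ℚ) ^ 2 = (a * g : ℚ) ^ 2 := by
    have : (p ^ 2 : ℤ) = ((p.natAbs : ℤ)) ^ 2 := (Int.natAbs_sq p).symm
    rw [h1] at this
    exact_mod_cast this
  have e2 : (q : ℚ) ^ 2 = (b * g : ℚ) ^ 2 := by
    have : (q ^ 2 : ℤ) = ((q.natAbs : ℤ)) ^ 2 := (Int.natAbs_sq q).symm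
    rw [h2] at this
    exact_mod_cast this
  rw [div_pow, div_pow, e1, e2]
  have : (g : ℚ) ≠ 0 := by exact_mod_cast hg.ne'
  have : (b : ℚ) ≠ 0 := by exact_mod_cast hb.ne'
  field_simp

lemma y40 {a b : ℕ} (ha : 0 < a) (hb : 0 < b) {S : (EC 0 40).Point} {Y : ℚ}
    (h : IsPt S (((a : ℚ) / b) ^ 2) Y) :
    ∃ y : ℕ, y ^ 2 = a ^ 4 + 40 * b ^ 4 ∧ Y ^ 2 = (a * y / b ^ 3 : ℚ) ^ 2 := by
  have e := h.eqn
  have ha' : (a : ℚ) ≠ 0 := by exact_mod_cast ha.ne'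
  have hb' : (b : ℚ) ≠ 0 := by exact_mod_cast hb.ne'
  have : IsSquare ((a ^ 4 + 40 * b ^ 4 : ℕ) : ℚ) := by
    refine ⟨Y * b ^ 3 / a, ?_⟩
    push_cast
    field_simp
    rw [e]
    field_simp
    ring
  rw [Rat.isSquare_natCast_iff] at this
  obtain ⟨y, hy⟩ := this
  have hy2 : (y : ℚ) ^ 2 = a ^ 4 + 40 * b ^ 4 := by
    have : y ^ 2 = a ^ 4 + 40 * b ^ 4 := by rw [hy]; ring
    exact_mod_cast this
  refine ⟨y, by rw [hy]; ring, ?_⟩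
  have e3 : (a * y / b ^ 3 : ℚ) ^ 2 = a ^ 2 * y ^ 2 / b ^ 6 := by field_simp
  rw [e3, e, hy2]
  field_simp
  ring

/-- if `b` is even then `S` is divisible by two -/
lemma half40 {a b : ℕ} (ha : 0 < a) (hb : 0 < b) (hab : Nat.Coprime a b) (hev : Even b)
    {S : (EC 0 40).Point} {Y : ℚ} (h : IsPt S (((a : ℚ) / b) ^ 2) Y) :
    ∃ (k l m : ℕ) (S' : (EC 0 40).Point) (Y' : ℚ), 0 < k ∧ 0 < l ∧ Nat.Coprime k l ∧
      IsPt S' (((k : ℚ) / l) ^ 2) Y' ∧ b = 2 * k * l * m ∧ m ^ 2 = k ^ 4 + 40 * l ^ 4 ∧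
      (S = S' + S' ∨ S = -(S' + S')) := by
  obtain ⟨y, hy, -⟩ := y40 ha hb h
  obtain ⟨m, n, hm, hn, hc, hbe, hmo, hne, e⟩ := d40_first ha hb hab hev hy
  obtain ⟨k, l, hk, hl, hkl, hnn, e2, e3⟩ := d40_second (d40_odd hab hy) hn hmo hne hc e
  have hk' : (k : ℚ) ≠ 0 := by exact_mod_cast hk.ne'
  have hl' : (l : ℚ) ≠ 0 := by exact_mod_cast hl.ne'
  have hm' : (m : ℚ) ≠ 0 := by exact_mod_cast hm.ne'
  have e2' : (m : ℚ) ^ 2 = k ^ 4 + 40 * l ^ 4 := by exact_mod_cast e2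
  obtain ⟨S', hS'⟩ := exists_isPt (A := 0) (B := 40) (by norm_num) (x := ((k : ℚ) / l) ^ 2)
    (y := k * m / l ^ 3) (by
      field_simp
      rw [e2']; ring)
  have hbq : (b : ℚ) = 2 * k * l * m := by rw [hbe, hnn]; push_cast; ring
  obtain ⟨Y'', hd⟩ := hS'.dblX (by positivity)
  have hx : ((((k : ℚ) / l) ^ 2) ^ 2 - 40) ^ 2 / (4 * (k * m / l ^ 3 : ℚ) ^ 2) =
      ((a : ℚ) / b) ^ 2 := by
    have : (a : ℚ) ^ 2 = (k ^ 4 - 40 * l ^ 4) ^ 2 := by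
      rcases e3 with e3 | e3
      · have : (a : ℚ) + 40 * l ^ 4 = k ^ 4 := by exact_mod_cast e3
        rw [← this]; ring
      · have : (a : ℚ) + k ^ 4 = 40 * l ^ 4 := by exact_mod_cast e3
        rw [← this]; ring
    rw [hbq, div_pow (a : ℚ), this]
    field_simp
    ring
  rw [hx] at hd
  exact ⟨k, l, m, S', _, hk, hl, hkl, hS', by rw [hbe, hnn]; ring, e2, h.eq_or_neg hd⟩

lemma four_split {U V W Z : ℤ} (hU : U ≠ 0) (h : U * V = - (Z * W)) (hW : W ≠ 0) :
    ∃ g u w k : ℤ, U = g * u ∧ W = g * w ∧ V = w * k ∧ Z = - (u * k) := by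
  obtain ⟨g, u, w, hg, hc, h1, h2⟩ := Int.exists_gcd_one' (m := U) (n := W)
    (Int.gcd_pos_of_ne_zero_left _ hU)
  have hg0 : (g : ℤ) ≠ 0 := by exact_mod_cast hg.ne'
  have h3 : u * V = -(Z * w) := by
    apply mul_left_cancel₀ hg0
    rw [h1, h2] at h
    linarith
  have h4 : w ∣ V := by
    have : w ∣ u * V := by rw [h3]; exact ⟨-Z, by ring⟩
    have hco : IsCoprime w u := (Int.isCoprime_iff_gcd_eq_one.2 hc).symm
    exact hco.dvd_of_dvd_mul_left this
  obtain ⟨k, rfl⟩ := h4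
  have hw : w ≠ 0 := by rintro rfl; simp at h2; exact hW h2
  refine ⟨g, u, w, k, by rw [h1]; ring, by rw [h2]; ring, rfl, ?_⟩
  apply mul_left_cancel₀ hw
  linarith

lemma max_split {u w k g M : ℤ} (h1 : |g * u| ≤ M) (h2 : |g * w| ≤ M) (h3 : |w * k| ≤ M)
    (h4 : |u * k| ≤ M) : (u ^ 2 ≤ M ∧ w ^ 2 ≤ M) ∨ (g ^ 2 ≤ M ∧ k ^ 2 ≤ M) := by
  by_contra hcon
  rw [not_or, not_and_or, not_and_or] at hcon
  have key : ∀ x y : ℤ, |x * y| ≤ M → ¬ x ^ 2 ≤ M → ¬ y ^ 2 ≤ M → False := by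
    intro x y h hx hy
    rw [abs_mul] at h
    rw [← sq_abs] at hx hy
    have := abs_nonneg x
    have := abs_nonneg y
    rcases le_total |x| |y| with q | q <;> nlinarith
  obtain ⟨a | a, b | b⟩ := hcon
  · exact key _ _ h1 b a
  · exact key _ _ h4 a b
  · exact key _ _ h2 b a
  · exact key _ _ h3 a b

lemma plus40 {S P : (EC 0 40).Point} {ξ w η : ℚ} (hP : IsPt P 9 (3 * η)) (hη : η ^ 2 = 121)
    (h : IsPt S (ξ ^ 2) (ξ * w)) (hw : w ^ 2 = ξ ^ 4 + 40) (hξ : ξ ^ 2 - 9 ≠ 0) :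
    ∃ Y, IsPt (S + P) (((η * ξ - 3 * w) / (ξ ^ 2 - 9)) ^ 2) Y := by
  refine ⟨_, h.add_eq hP (sub_ne_zero.1 hξ) ((ξ * w - 3 * η) / (ξ ^ 2 - 9)) _ _ ?_ ?_ rfl⟩
  · field_simp
  · field_simp
    linear_combination (-ξ ^ 2 + 9) * hw + (ξ ^ 2 - 9) * hη

lemma even_reduce {u w : ℤ} (hu : Odd u) (hw : Even w) (hw0 : w ≠ 0) :
    ∃ a b : ℕ, 0 < a ∧ 0 < b ∧ Nat.Coprime a b ∧ Even b ∧ (b : ℤ) ^ 2 ≤ w ^ 2 ∧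
    ((u : ℚ) / w) ^ 2 = ((a : ℚ) / b) ^ 2 := by
  have hu0 : u ≠ 0 := by rintro rfl; simp at hu
  obtain ⟨a, b, ha, hb, hab, h1, h2, h3, h4⟩ := reduce_frac hu0 hw0
  refine ⟨a, b, ha, hb, hab, ?_, ?_, h4⟩
  · have e : Even (b * u.natAbs) := by
      rw [← h3]
      exact (Int.natAbs_even.2 hw).mul_left _
    rcases Nat.even_mul.1 e with h | h
    · exact h
    · rw [Int.natAbs_even] at h
      exact absurd hu (Int.not_odd_iff_even.2 h)
  · have : b ≤ w.natAbs := Nat.le_of_dvd (Int.natAbs_pos.2 hw0) h2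
    have : (b : ℤ) ≤ |w| := by rw [Int.abs_eq_natAbs]; exact_mod_cast this
    rw [← sq_abs w]
    exact pow_le_pow_left₀ (by positivity) this 2

set_option maxHeartbeats 1000000 in
/-- If `b` is odd and `S ≠ ±P`, then one of `S ± P` has even denominator and not-too-large height. -/
lemma odd40 {a b : ℕ} (ha : 0 < a) (hb : 0 < b) (hab : Nat.Coprime a b) (hodd : Odd b)
    {S P : (EC 0 40).Point} {Y : ℚ} (hP : IsPt P 9 33) (h : IsPt S (((a : ℚ) / b) ^ 2) Y)
    (hne : a ≠ 3 * b) :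
    ∃ (a' b' : ℕ) (S' : (EC 0 40).Point) (Y' : ℚ), 0 < a' ∧ 0 < b' ∧ Nat.Coprime a' b' ∧
      Even b' ∧ IsPt S' (((a' : ℚ) / b') ^ 2) Y' ∧ (S = S' - P ∨ S = S' + P) ∧
      b' ^ 2 ≤ 40 * (max a b) ^ 2 := by
  obtain ⟨y, hy, hY⟩ := y40 ha hb h
  have hao := d40_odd hab hy
  have hyo : Odd y := by
    by_contra hyo
    rw [Nat.not_odd_iff_even] at hyo
    obtain ⟨s, hs⟩ := pow4_odd hao
    obtain ⟨k, rfl⟩ := hyo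
    have : (k + k) ^ 2 = 4 * k ^ 2 := by ring
    omega
  obtain ⟨M, hM⟩ : ∃ M, M = max a b := ⟨_, rfl⟩
  have haM : a ≤ M := by rw [hM]; exact le_max_left _ _
  have hbM : b ≤ M := by rw [hM]; exact le_max_right _ _
  rw [← hM]
  have hyM : y ≤ 7 * M ^ 2 := by
    have : y ^ 2 ≤ (7 * M ^ 2) ^ 2 := by
      have h1 : a ^ 4 ≤ M ^ 4 := Nat.pow_le_pow_left haM 4
      have h2 : b ^ 4 ≤ M ^ 4 := Nat.pow_le_pow_left hbM 4
      nlinarith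
    exact (Nat.pow_le_pow_iff_left (by norm_num)).1 this
  have ha' : (a : ℚ) ≠ 0 := by exact_mod_cast ha.ne'
  have hb' : (b : ℚ) ≠ 0 := by exact_mod_cast hb.ne'
  obtain ⟨z, hz, hYz⟩ : ∃ z : ℤ, (z = y ∨ z = -y) ∧ Y = (a : ℚ) / b * (z / b ^ 2) := by
    rcases sq_eq_sq_iff_eq_or_eq_neg.1 hY with h | h
    · exact ⟨y, Or.inl rfl, by rw [h]; push_cast; field_simp⟩
    · exact ⟨-y, Or.inr rfl, by rw [h]; push_cast; field_simp⟩
  have hz2 : z ^ 2 = a ^ 4 + 40 * b ^ 4 := by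
    have : (y : ℤ) ^ 2 = a ^ 4 + 40 * b ^ 4 := by exact_mod_cast hy
    rcases hz with rfl | rfl <;> rw [← this] ; ring
  have hzo : Odd z := by
    have : Odd (y : ℤ) := by exact_mod_cast hyo
    rcases hz with rfl | rfl
    · exact this
    · exact this.neg
  have hzM : |z| ≤ 7 * M ^ 2 := by
    have : |z| = y := by rcases hz with rfl | rfl <;> simp
    rw [this]; exact_mod_cast hyM
  have hw : ((z : ℚ) / b ^ 2) ^ 2 = ((a : ℚ) / b) ^ 4 + 40 := by
    have : (z : ℚ) ^ 2 = a ^ 4 + 40 * b ^ 4 := by exact_mod_cast hz2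
    field_simp
    linear_combination this
  have hW : (a : ℤ) ^ 2 - 9 * b ^ 2 ≠ 0 := by
    intro h0
    have : ((a : ℤ) - 3 * b) * (a + 3 * b) = 0 := by linear_combination h0
    rcases mul_eq_zero.1 this with h | h <;> omega
  have hWq : (a : ℚ) ^ 2 - 9 * b ^ 2 ≠ 0 := by exact_mod_cast hW
  have hξ : ((a : ℚ) / b) ^ 2 - 9 ≠ 0 := by
    intro h0
    apply hWq
    field_simp at h0
    linarith
  have hao' : Odd (a : ℤ) := by exact_mod_cast hao
  have hbo' : Odd (b : ℤ) := by exact_mod_cast hodd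
  have hZo : Odd (9 * (a : ℤ) ^ 2 - 40 * b ^ 2) := by
    apply Odd.sub_even
    · exact Odd.mul (by decide) hao'.pow
    · exact Even.mul_right (by decide) _
  have hUV : (11 * (a : ℤ) * b - 3 * z) * (11 * a * b + 3 * z) =
      -((9 * (a : ℤ) ^ 2 - 40 * b ^ 2) * ((a : ℤ) ^ 2 - 9 * b ^ 2)) := by
    linear_combination -9 * hz2
  have hZ0 : 9 * (a : ℤ) ^ 2 - 40 * b ^ 2 ≠ 0 := by
    intro h0; rw [h0] at hZo; simp at hZo
  have hU0 : 11 * (a : ℤ) * b - 3 * z ≠ 0 := by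
    intro h0
    rw [h0, zero_mul] at hUV
    exact mul_ne_zero hZ0 hW (by linarith)
  have hab1 : Odd (11 * (a : ℤ) * b) := ((show Odd (11 : ℤ) by decide).mul hao').mul hbo'
  have hz3 : Odd (3 * z) := (show Odd (3 : ℤ) by decide).mul hzo
  have hUe : Even (11 * (a : ℤ) * b - 3 * z) := hab1.sub_odd hz3
  have hVe : Even (11 * (a : ℤ) * b + 3 * z) := hab1.add_odd hz3
  obtain ⟨g, u, w, k, e1, e2, e3, e4⟩ := four_split hU0 hUV hW
  have hukO : Odd (u * k) := by
    rw [e4] at hZo; simpa using hZo.neg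
  obtain ⟨huO, hkO⟩ := Int.odd_mul.1 hukO
  have hwE : Even w := by
    rw [e3] at hVe
    rcases Int.even_mul.1 hVe with h | h
    · exact h
    · exact absurd hkO (Int.not_odd_iff_even.2 h)
  have hgE : Even g := by
    rw [e1] at hUe
    rcases Int.even_mul.1 hUe with h | h
    · exact h
    · exact absurd huO (Int.not_odd_iff_even.2 h)
  have hg0 : g ≠ 0 := by rintro rfl; simp at e2; exact hW e2
  have hw0 : w ≠ 0 := by rintro rfl; simp at e2; exact hW e2
  have haM' : (a : ℤ) ≤ M := by exact_mod_cast haM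
  have hbM' : (b : ℤ) ≤ M := by exact_mod_cast hbM
  have ha0 : (0 : ℤ) < a := by exact_mod_cast ha
  have hb0 : (0 : ℤ) < b := by exact_mod_cast hb
  have q1 : (a : ℤ) ^ 2 ≤ M ^ 2 := pow_le_pow_left₀ ha0.le haM' 2
  have q2 : (b : ℤ) ^ 2 ≤ M ^ 2 := pow_le_pow_left₀ hb0.le hbM' 2
  have q3 : (a : ℤ) * b ≤ M ^ 2 := by nlinarith
  have q4 : 0 < (a : ℤ) * b := by positivity
  have q5 := abs_le.1 hzM
  have B1 : |g * u| ≤ 40 * (M : ℤ) ^ 2 := by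
    rw [← e1, abs_le]; constructor <;> linarith [sq_nonneg (a : ℤ), sq_nonneg (b : ℤ)]
  have B2 : |g * w| ≤ 40 * (M : ℤ) ^ 2 := by
    rw [← e2, abs_le]; constructor <;> linarith [sq_nonneg (a : ℤ), sq_nonneg (b : ℤ)]
  have B3 : |w * k| ≤ 40 * (M : ℤ) ^ 2 := by
    rw [← e3, abs_le]; constructor <;> linarith [sq_nonneg (a : ℤ), sq_nonneg (b : ℤ)]
  have B4 : |u * k| ≤ 40 * (M : ℤ) ^ 2 := by
    rw [show u * k = -(9 * (a : ℤ) ^ 2 - 40 * b ^ 2) by rw [e4]; ring, abs_le]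
    constructor <;> linarith [sq_nonneg (a : ℤ), sq_nonneg (b : ℤ)]
  have hgq : (g : ℚ) ≠ 0 := by exact_mod_cast hg0
  have hwq : (w : ℚ) ≠ 0 := by exact_mod_cast hw0
  have e1q : 11 * (a : ℚ) * b - 3 * z = g * u := by exact_mod_cast e1
  have e2q : (a : ℚ) ^ 2 - 9 * b ^ 2 = g * w := by exact_mod_cast e2
  have e3q : 11 * (a : ℚ) * b + 3 * z = w * k := by exact_mod_cast e3
  rw [hYz] at h
  have hxi : ((a : ℚ) / b) ^ 2 - 9 = g * w / b ^ 2 := by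
    rw [← e2q]; field_simp
  rcases max_split B1 B2 B3 B4 with ⟨-, hm⟩ | ⟨hm, -⟩
  · obtain ⟨Y', hY'⟩ := plus40 (η := 11) (by norm_num; exact hP) (by norm_num) h hw hξ
    have hx : (11 * ((a : ℚ) / b) - 3 * (z / b ^ 2)) / (((a : ℚ) / b) ^ 2 - 9) = u / w := by
      have : 11 * ((a : ℚ) / b) - 3 * (z / b ^ 2) = g * u / b ^ 2 := by
        rw [← e1q]; field_simp
      rw [this, hxi]; field_simp
    rw [hx] at hY'
    obtain ⟨a', b', p1, p2, p3, p4, p5, p6⟩ := even_reduce huO hwE hw0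
    rw [p6] at hY'
    refine ⟨a', b', _, Y', p1, p2, p3, p4, hY', Or.inl (by simp), ?_⟩
    exact_mod_cast p5.trans hm
  · obtain ⟨Y', hY'⟩ := plus40 (η := -11) (by norm_num; exact hP.neg) (by norm_num) h hw hξ
    have hx : (-11 * ((a : ℚ) / b) - 3 * (z / b ^ 2)) / (((a : ℚ) / b) ^ 2 - 9) = -(k / g) := by
      have : -11 * ((a : ℚ) / b) - 3 * (z / b ^ 2) = -(w * k / b ^ 2) := by
        rw [← e3q]; field_simp; ring
      rw [this, hxi]; field_simp
    rw [hx, neg_sq] at hY'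
    obtain ⟨a', b', p1, p2, p3, p4, p5, p6⟩ := even_reduce hkO hgE hg0
    rw [p6] at hY'
    refine ⟨a', b', _, Y', p1, p2, p3, p4, hY', Or.inr (by simp), ?_⟩
    exact_mod_cast p5.trans hm

theorem mw40 {P : (EC 0 40).Point} (hP : IsPt P 9 33) : ∀ (M : ℕ) (a b : ℕ)
    (S : (EC 0 40).Point) (Y : ℚ), 0 < a → 0 < b → Nat.Coprime a b →
    IsPt S (((a : ℚ) / b) ^ 2) Y → max a b = M → ∃ N : ℤ, S = N • P := by
  intro M
  induction M using Nat.strong_induction_on with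
  | _ M ih =>
  intro a b S Y ha hb hab h hM
  have half : ∀ (a b : ℕ) (S : (EC 0 40).Point) (Y : ℚ), 0 < a → 0 < b → Nat.Coprime a b →
    IsPt S (((a : ℚ) / b) ^ 2) Y → Even b → b ^ 2 ≤ 40 * M ^ 2 → ∃ N : ℤ, S = N • P := by
    intro a' b' S' Y' ha' hb' hab' h' hev hle
    obtain ⟨k, l, m, S'', Y'', hk, hl, hkl, hS, e1, e2, e3⟩ := half40 ha' hb' hab' hev h'
    have : max k l < M := by
      by_contra hcon
      rw [not_lt] at hcon
      obtain ⟨K, hK⟩ : ∃ K, K = max k l := ⟨_, rfl⟩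
      rw [← hK] at hcon
      have hm1 : k ^ 2 ≤ m := (Nat.pow_le_pow_iff_left (n := 2) (by norm_num)).1 (by rw [e2]; nlinarith [pow_pos hl 4])
      have hm2 : l ^ 2 ≤ m := (Nat.pow_le_pow_iff_left (n := 2) (by norm_num)).1 (by rw [e2]; nlinarith [pow_pos hk 4, pow_pos hl 4])
      have hb3 : 2 * K ^ 3 ≤ b' := by
        rw [e1]
        rcases max_cases k l with ⟨q, -⟩ | ⟨q, -⟩
        · rw [hK, q]
          calc 2 * k ^ 3 = 2 * k * 1 * k ^ 2 := by ring
            _ ≤ 2 * k * l * m := by gcongr; omega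
        · rw [hK, q]
          calc 2 * l ^ 3 = 2 * 1 * l * l ^ 2 := by ring
            _ ≤ 2 * k * l * m := by gcongr; omega
      have hMK : M ^ 2 ≤ K ^ 2 := Nat.pow_le_pow_left hcon 2
      have h6 : (2 * K ^ 3) ^ 2 ≤ b' ^ 2 := Nat.pow_le_pow_left hb3 2
      have hK0 : 0 < K := by rw [hK]; exact lt_max_of_lt_left hk
      have hK4 : K ^ 4 ≤ 10 := by
        have : K ^ 2 * K ^ 4 ≤ K ^ 2 * 10 := by nlinarith
        exact Nat.le_of_mul_le_mul_left this (by positivity)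
      have hK1 : K = 1 := by
        by_contra hh
        have : 2 ≤ K := by omega
        have : 2 ^ 4 ≤ K ^ 4 := Nat.pow_le_pow_left this 4
        omega
      have hk1 : k = 1 := by have := le_max_left k l; omega
      have hl1 : l = 1 := by have := le_max_right k l; omega
      subst hk1; subst hl1
      have : m ≤ 6 := by nlinarith
      interval_cases m <;> omega
    obtain ⟨N, hN⟩ := ih _ this k l S'' Y'' hk hl hkl hS rfl
    rcases e3 with e3 | e3
    · exact ⟨N + N, by rw [e3, hN, add_zsmul]⟩
    · exact ⟨-(N + N), by rw [e3, hN, neg_zsmul, add_zsmul]⟩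
  rcases Nat.even_or_odd b with hev | hodd
  · refine half a b S Y ha hb hab h hev ?_
    have : b ≤ M := by rw [← hM]; exact le_max_right _ _
    have := Nat.pow_le_pow_left this 2
    omega
  · by_cases hne : a = 3 * b
    · have hx : ((a : ℚ) / b) ^ 2 = 9 := by
        have hb' : (b : ℚ) ≠ 0 := by exact_mod_cast hb.ne'
        rw [hne]; push_cast; field_simp; norm_num
      rw [hx] at h
      rcases h.eq_or_neg hP with q | q
      · exact ⟨1, by simpa using q⟩
      · exact ⟨-1, by simpa using q⟩
    · obtain ⟨a', b', S', Y', p1, p2, p3, p4, p5, p6, p7⟩ := odd40 ha hb hab hodd hP h hne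
      rw [hM] at p7
      obtain ⟨N, hN⟩ := half a' b' S' Y' p1 p2 p3 p5 p4 p7
      rcases p6 with p6 | p6
      · exact ⟨N - 1, by rw [p6, hN, sub_zsmul, one_zsmul, sub_eq_add_neg]⟩
      · exact ⟨N + 1, by rw [p6, hN, add_zsmul, one_zsmul]⟩

theorem mw40' {P : (EC 0 40).Point} (hP : IsPt P 9 33) {S : (EC 0 40).Point} {ξ Y : ℚ}
    (h : IsPt S (ξ ^ 2) Y) (hξ : ξ ≠ 0) : ∃ N : ℤ, S = N • P := by
  obtain ⟨a, b, ha, hb, hab, -, -, -, e⟩ := reduce_frac (Rat.num_ne_zero.2 hξ)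
    (show (ξ.den : ℤ) ≠ 0 by exact_mod_cast ξ.den_nz)
  have : ξ = (ξ.num : ℚ) / ((ξ.den : ℤ) : ℚ) := by
    push_cast; exact (Rat.num_div_den ξ).symm
  rw [← this] at e
  rw [e] at h
  exact mw40 hP _ a b S Y ha hb hab h rfl
end P4

open Polynomial
namespace P4

lemma prime_of_jac (D : ℕ) (hD : D % 4 = 1) {a : ℤ} (ha : Odd a) (h : jacobiSym a D = -1) :
    ∃ p : ℕ, p.Prime ∧ (p : ℤ) ∣ a ∧ ¬ IsSquare (((D : ℤ)) : ZMod p) := by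
  have hDo : Odd D := Nat.odd_iff.2 (Nat.odd_of_mod_four_eq_one hD)
  have h1 : jacobiSym (a.natAbs : ℤ) D = -1 := by
    rcases Int.natAbs_eq a with e | e
    · rw [← e]; exact h
    · have : ((a.natAbs : ℤ)) = -a := by omega
      rw [this, jacobiSym.neg _ hDo, h, ZMod.χ₄_nat_one_mod_four hD]; rfl
  have h2 : jacobiSym (D : ℤ) a.natAbs = -1 := by
    rw [jacobiSym.quadratic_reciprocity_one_mod_four hD (Int.natAbs_odd.2 ha)]; exact h1
  obtain ⟨p, hp, hpa, hJ⟩ := jacobiSym.eq_neg_one_at_prime_divisor_of_eq_neg_one h2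
  exact ⟨p, hp, Int.natCast_dvd.2 hpa, ZMod.nonsquare_of_jacobiSym_eq_neg_one hJ⟩

lemma v_dvd {p : ℕ} [Fact p.Prime] {n : ℤ} (h : (p : ℤ) ∣ n) :
    Rat.padicValuation p (n : ℚ) < 1 := by
  rw [Rat.padicValuation_cast, Int.padicValuation_lt_one_iff]; exact h

lemma v_not_dvd {p : ℕ} [Fact p.Prime] {n : ℤ} (h : ¬ (p : ℤ) ∣ n) :
    Rat.padicValuation p (n : ℚ) = 1 := by
  refine le_antisymm (v_int n) ?_
  rw [← not_lt, Rat.padicValuation_cast, Int.padicValuation_lt_one_iff]; exact h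

lemma v_sq_le {p : ℕ} [Fact p.Prime] {r : ℚ} {q : ℚ} (h : r ^ 2 = q)
    (hq : Rat.padicValuation p q ≤ 1) : Rat.padicValuation p r ≤ 1 := by
  rw [← h, map_pow] at hq
  by_contra hcon
  exact absurd hq (not_le.2 (one_lt_pow' (not_le.1 hcon) two_ne_zero))

lemma v_eq_one_of_near {p : ℕ} [Fact p.Prime] {a b : ℚ} (h : Rat.padicValuation p (a - b) < 1)
    (hb : Rat.padicValuation p b = 1) : Rat.padicValuation p a = 1 := by
  have : a = (a - b) + b := by ring
  rw [this, Valuation.map_add_eq_of_lt_right _ (by rw [hb]; exact h), hb]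

/-- doubling on `y² = x³ + 40 x` -/
lemma dbl40 {a b y : ℤ} (ha : a ≠ 0) (hb : b ≠ 0) (hy0 : y ≠ 0) (hy : y ^ 2 = a ^ 4 + 40 * b ^ 4)
    {S : (EC 0 40).Point} {Y : ℚ} (h : IsPt S (((a : ℚ) / b) ^ 2) Y) :
    ∃ Y', IsPt (S + S) ((((a ^ 4 - 40 * b ^ 4 : ℤ) : ℚ) / (2 * a * b * y : ℤ)) ^ 2) Y' := by
  have e := h.eqn
  have ha' : (a : ℚ) ≠ 0 := by exact_mod_cast ha
  have hb' : (b : ℚ) ≠ 0 := by exact_mod_cast hb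
  have hyy : (y : ℚ) ≠ 0 := by exact_mod_cast hy0
  have hyq : (y : ℚ) ^ 2 = a ^ 4 + 40 * b ^ 4 := by exact_mod_cast hy
  have hY2 : Y ^ 2 = a ^ 2 * y ^ 2 / b ^ 6 := by
    rw [e, hyq]; field_simp; ring
  have hY : Y ≠ 0 := by
    intro h0
    rw [h0] at hY2
    have : (a : ℚ) ^ 2 * y ^ 2 / b ^ 6 ≠ 0 := by positivity
    exact this (by rw [← hY2]; ring)
  obtain ⟨Y', h'⟩ := h.dblX hY
  refine ⟨Y', ?_⟩
  convert h' using 1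
  rw [hY2]
  push_cast
  field_simp
  ring

structure Good40 (a b y : ℤ) : Prop where
  odd : Odd a
  five : ¬ (5 : ℤ) ∣ a
  cop : IsCoprime a b
  hb : b ≠ 0
  hy : y ≠ 0
  eq : y ^ 2 = a ^ 4 + 40 * b ^ 4

lemma Good40.ne {a b y : ℤ} (h : Good40 a b y) : a ≠ 0 := by
  rintro rfl; exact h.five (dvd_zero _)

lemma Good40.step {a b y : ℤ} (h : Good40 a b y) :
    Good40 (a ^ 4 - 40 * b ^ 4) (2 * a * b * y) (a ^ 8 + 240 * a ^ 4 * b ^ 4 + 1600 * b ^ 8) := by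
  have hodd : Odd (a ^ 4 - 40 * b ^ 4) := by
    apply Odd.sub_even h.odd.pow
    exact Even.mul_right (by decide) _
  have h5 : ¬ (5 : ℤ) ∣ a ^ 4 - 40 * b ^ 4 := by
    intro hd
    have : (5 : ℤ) ∣ a ^ 4 := by
      have e : a ^ 4 = (a ^ 4 - 40 * b ^ 4) + 5 * (8 * b ^ 4) := by ring
      rw [e]; exact dvd_add hd ⟨_, rfl⟩
    exact h.five (Int.Prime.dvd_pow' (by norm_num) this)
  refine ⟨hodd, h5, ?_, ?_, ?_, by linear_combination 40 * 16 * a ^ 4 * b ^ 4 * (-(y ^ 2) - (a ^ 4 + 40 * b ^ 4)) * h.eq⟩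
  · rw [Int.isCoprime_iff_gcd_eq_one]
    by_contra hg
    obtain ⟨p, hp, hpg⟩ := Nat.exists_prime_and_dvd hg
    have hpZ : Prime (p : ℤ) := Nat.prime_iff_prime_int.1 hp
    have d1 : (p : ℤ) ∣ a ^ 4 - 40 * b ^ 4 := (Int.natCast_dvd_natCast.2 hpg).trans (Int.gcd_dvd_left _ _)
    have d2 : (p : ℤ) ∣ 2 * a * b * y := (Int.natCast_dvd_natCast.2 hpg).trans (Int.gcd_dvd_right _ _)
    have nab : ∀ _ : (p : ℤ) ∣ a, ∀ _ : (p : ℤ) ∣ b, False := fun h1 h2 =>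
      hpZ.not_isUnit (h.cop.isUnit_of_dvd' h1 h2)
    have n2 : ¬ (p : ℤ) ∣ 2 := by
      intro h2
      have : p ∣ 2 := by exact_mod_cast h2
      have : p = 2 := (Nat.prime_dvd_prime_iff_eq hp Nat.prime_two).1 this
      subst this
      exact (Int.not_even_iff_odd.2 hodd) (even_iff_two_dvd.2 d1)
    have n5 : ¬ (p : ℤ) ∣ 5 := by
      intro h2
      have : p ∣ 5 := by exact_mod_cast h2
      have : p = 5 := (Nat.prime_dvd_prime_iff_eq hp (by norm_num)).1 this
      subst this
      exact h5 d1
    have na : ¬ (p : ℤ) ∣ a := by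
      intro h1
      have : (p : ℤ) ∣ 2 ^ 3 * 5 * b ^ 4 := by
        have e : 2 ^ 3 * 5 * b ^ 4 = a * a ^ 3 - (a ^ 4 - 40 * b ^ 4) := by ring
        rw [e]; exact dvd_sub (h1.mul_right _) d1
      rcases hpZ.dvd_or_dvd this with h2 | h2
      · rcases hpZ.dvd_or_dvd h2 with h2 | h2
        · exact n2 (hpZ.dvd_of_dvd_pow h2)
        · exact n5 h2
      · exact nab h1 (hpZ.dvd_of_dvd_pow h2)
    rcases hpZ.dvd_or_dvd d2 with h1 | h1
    · rcases hpZ.dvd_or_dvd h1 with h1 | h1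
      · rcases hpZ.dvd_or_dvd h1 with h1 | h1
        · exact n2 h1
        · exact na h1
      · apply na
        have : (p : ℤ) ∣ a ^ 4 := by
          have e : a ^ 4 = (a ^ 4 - 40 * b ^ 4) + b * (40 * b ^ 3) := by ring
          rw [e]; exact dvd_add d1 (h1.mul_right _)
        exact hpZ.dvd_of_dvd_pow this
    · have : (p : ℤ) ∣ 2 * a ^ 4 := by
        have e : 2 * a ^ 4 = (a ^ 4 - 40 * b ^ 4) + y * y := by linear_combination -h.eq
        rw [e]; exact dvd_add d1 (h1.mul_right _)
      rcases hpZ.dvd_or_dvd this with h2 | h2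
      · exact n2 h2
      · exact na (hpZ.dvd_of_dvd_pow h2)
  · have := h.ne; have := h.hb; have := h.hy
    positivity
  · have := h.ne; have := h.hb
    positivity

/-- states of the doubling sequence modulo `745` -/
def step745 (t : ℕ × ℕ × ℕ) : ℕ × ℕ × ℕ :=
  ((t.1 ^ 4 + 705 * t.2.1 ^ 4) % 745, (2 * t.1 * t.2.1 * t.2.2) % 745,
    (t.1 ^ 8 + 240 * t.1 ^ 4 * t.2.1 ^ 4 + 1600 * t.2.1 ^ 8) % 745)

def seq745 (t : ℕ × ℕ × ℕ) : ℕ → ℕ × ℕ × ℕ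
  | 0 => t
  | n + 1 => step745 (seq745 t n)

lemma seq40 {a b y : ℤ} (hg : Good40 a b y) {S : (EC 0 40).Point} {Y : ℚ}
    (h : IsPt S (((a : ℚ) / b) ^ 2) Y) (t : ℕ × ℕ × ℕ) (h1 : (a : ZMod 745) = (t.1 : ℕ))
    (h2 : (b : ZMod 745) = (t.2.1 : ℕ)) (h3 : (y : ZMod 745) = (t.2.2 : ℕ)) (k : ℕ) :
    ∃ a b y : ℤ, Good40 a b y ∧ (∃ Y, IsPt ((2 ^ k : ℤ) • S) (((a : ℚ) / b) ^ 2) Y) ∧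
      (a : ZMod 745) = ((seq745 t k).1 : ℕ) ∧ (b : ZMod 745) = ((seq745 t k).2.1 : ℕ) ∧
      (y : ZMod 745) = ((seq745 t k).2.2 : ℕ) := by
  induction k with
  | zero => exact ⟨a, b, y, hg, ⟨Y, by simpa using h⟩, h1, h2, h3⟩
  | succ k ih =>
    obtain ⟨a, b, y, hg, ⟨Y, hY⟩, q1, q2, q3⟩ := ih
    obtain ⟨Y', hY'⟩ := dbl40 hg.ne hg.hb hg.hy hg.eq hY
    refine ⟨_, _, _, hg.step, ⟨Y', ?_⟩, ?_, ?_, ?_⟩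
    · rw [pow_succ, mul_zsmul, two_zsmul, zsmul_add]; exact hY'
    · simp only [seq745, step745]
      push_cast [ZMod.natCast_mod]
      rw [← q1, ← q2]
      have : (705 : ZMod 745) = -40 := by decide
      rw [this]; ring
    · simp only [seq745, step745]
      push_cast [ZMod.natCast_mod]
      rw [← q1, ← q2, ← q3]
    · simp only [seq745, step745]
      push_cast [ZMod.natCast_mod]
      rw [← q1, ← q2]

lemma seq745_per (t : ℕ × ℕ × ℕ) (m : ℕ) (hp : seq745 t (m + 1) = seq745 t 1) (k : ℕ) :
    ∀ n, seq745 t (n * m + k + 1) = seq745 t (k + 1) := by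
  have h1 : ∀ k, seq745 t (m + k + 1) = seq745 t (k + 1) := by
    intro k
    induction k with
    | zero => exact hp
    | succ k ih =>
      rw [show m + (k + 1) + 1 = (m + k + 1) + 1 by ring]
      simp only [seq745] at ih ⊢
      rw [ih]
  intro n
  induction n with
  | zero => simp
  | succ n ih => rw [show (n + 1) * m + k + 1 = m + (n * m + k) + 1 by ring, h1, ih]

lemma z149a : (148 : ZMod 149) = -1 := by decide
lemma z149b : ¬ (0 : ZMod 149) ^ (149 / 2) = -1 := by decide
lemma z149c : ¬ ((1 : ℤ) : ZMod 149) = -1 := by decide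

lemma jac745 {a : ℤ} {n : ℕ} (h : (a : ZMod 745) = (n : ℕ)) (h5 : n % 5 = 1)
    (h149 : n ^ 74 % 149 = 148) : jacobiSym a 745 = -1 := by
  have hm : a % (745 : ℕ) = (n : ℤ) % (745 : ℕ) := by
    have : (a : ZMod 745) = ((n : ℤ) : ZMod 745) := by rw [h]; push_cast; rfl
    exact (ZMod.intCast_eq_intCast_iff' _ _ _).1 this
  rw [jacobiSym.mod_left' hm]
  have e : jacobiSym (n : ℤ) 745 = jacobiSym (n : ℤ) 5 * jacobiSym (n : ℤ) 149 :=
    jacobiSym.mul_right _ 5 149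
  have e5 : jacobiSym (n : ℤ) 5 = 1 := by
    rw [jacobiSym.mod_left, show (n : ℤ) % (5 : ℕ) = 1 by omega, jacobiSym.one_left]
  have : Fact (Nat.Prime 149) := ⟨by norm_num⟩
  have e149 : jacobiSym (n : ℤ) 149 = -1 := by
    rw [← jacobiSym.legendreSym.to_jacobiSym]
    have q := legendreSym.eq_pow 149 (n : ℤ)
    have q2 : (((n : ℤ) : ZMod 149)) ^ (149 / 2) = -1 := by
      have : ((n ^ 74 : ℕ) : ZMod 149) = ((148 : ℕ) : ZMod 149) := by
        rw [← h149, ZMod.natCast_mod]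
      push_cast at this ⊢
      rw [this]; exact z149a
    rw [q2] at q
    have hn0 : (((n : ℤ)) : ZMod 149) ≠ 0 := by
      intro h0; rw [h0] at q2; exact z149b q2
    rcases legendreSym.eq_one_or_neg_one 149 hn0 with h | h
    · rw [h] at q; exact (z149c q).elim
    · exact h
  rw [e, e5, e149]; rfl

lemma pat1 : ∀ j < 72, (j % 8 = 0 ∨ j % 8 = 1 ∨ j % 8 = 2 ∨ j % 8 = 4 ∨ j % 8 = 6) →
    (seq745 (3, 1, 11) (j + 1)).1 % 5 = 1 ∧ (seq745 (3, 1, 11) (j + 1)).1 ^ 74 % 149 = 148 := by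
  decide +kernel
lemma pat3 : ∀ j < 72, (j % 8 = 7 ∨ j % 8 = 3 ∨ j % 8 = 5) →
    (seq745 (142, 273, 666) (j + 1)).1 % 5 = 1 ∧
      (seq745 (142, 273, 666) (j + 1)).1 ^ 74 % 149 = 148 := by
  decide +kernel
lemma per1 : seq745 (3, 1, 11) (72 + 1) = seq745 (3, 1, 11) 1 := by decide +kernel
lemma per3 : seq745 (142, 273, 666) (72 + 1) = seq745 (142, 273, 666) 1 := by decide +kernel

end P4

open Polynomial
namespace P4

/-- congruence of `p`-integral rationals modulo `p` -/
def Cg (p : ℕ) [Fact p.Prime] (a b : ℚ) : Prop :=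
  Rat.padicValuation p a ≤ 1 ∧ Rat.padicValuation p b ≤ 1 ∧ Rat.padicValuation p (a - b) < 1

section
variable {p : ℕ} [Fact p.Prime] {a b a' b' : ℚ}

lemma Cg.refl (h : Rat.padicValuation p a ≤ 1) : Cg p a a := ⟨h, h, by simp⟩
lemma Cg.int (n : ℤ) : Cg p n n := .refl (v_int n)

lemma Cg.of_near (hb : Rat.padicValuation p b ≤ 1) (h : Rat.padicValuation p (a - b) < 1) :
    Cg p a b := by
  refine ⟨?_, hb, h⟩
  rw [show a = (a - b) + b by ring]
  exact Valuation.map_add_le _ h.le hb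

lemma Cg.add (h : Cg p a b) (h' : Cg p a' b') : Cg p (a + a') (b + b') := by
  refine ⟨Valuation.map_add_le _ h.1 h'.1, Valuation.map_add_le _ h.2.1 h'.2.1, ?_⟩
  rw [show a + a' - (b + b') = (a - b) + (a' - b') by ring]
  exact Valuation.map_add_lt _ h.2.2 h'.2.2

lemma Cg.neg (h : Cg p a b) : Cg p (-a) (-b) := by
  refine ⟨by rw [Valuation.map_neg]; exact h.1, by rw [Valuation.map_neg]; exact h.2.1, ?_⟩
  rw [show -a - -b = -(a - b) by ring, Valuation.map_neg]
  exact h.2.2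

lemma Cg.sub (h : Cg p a b) (h' : Cg p a' b') : Cg p (a - a') (b - b') := by
  rw [sub_eq_add_neg, sub_eq_add_neg]; exact h.add h'.neg

lemma Cg.mul (h : Cg p a b) (h' : Cg p a' b') : Cg p (a * a') (b * b') := by
  refine ⟨v_mul_le h.1 h'.1, v_mul_le h.2.1 h'.2.1, ?_⟩
  rw [show a * a' - b * b' = a * (a' - b') + (a - b) * b' by ring]
  exact Valuation.map_add_lt _ (v_mul_lt' h.1 h'.2.2) (v_mul_lt h.2.2 h'.2.1)

lemma Cg.pow (h : Cg p a b) (n : ℕ) : Cg p (a ^ n) (b ^ n) := by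
  induction n with
  | zero => simpa using Cg.int (p := p) 1
  | succ n ih => rw [pow_succ, pow_succ]; exact ih.mul h

lemma Cg.div (h : Cg p a b) (h' : Cg p a' b') (hb : Rat.padicValuation p b' = 1) :
    Cg p (a / a') (b / b') := by
  have ha := v_eq_one_of_near h'.2.2 hb
  have n1 := v_unit_ne ha
  have n2 := v_unit_ne hb
  refine ⟨by rw [map_div₀, ha, div_one]; exact h.1, by rw [map_div₀, hb, div_one]; exact h.2.1, ?_⟩
  rw [show a / a' - b / b' = (a * b' - b * a') / (a' * b') by field_simp]
  refine v_div_lt ?_ (by rw [map_mul, ha, hb, one_mul])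
  have := (h.mul (Cg.refl h'.2.1)).sub ((Cg.refl h.2.1).mul h')
  simpa using this.2.2

end

lemma v_prod_unit {p : ℕ} [Fact p.Prime] {n : ℤ} (h : ¬ (p : ℤ) ∣ n) :
    Rat.padicValuation p (n : ℚ) = 1 := v_not_dvd h

/-- congruence for `-h6(s)` -/
lemma red40_gen {p : ℕ} [Fact p.Prime] {x y s r x0 y0 s0 : ℚ} (hx : Cg p x x0) (hy : Cg p y y0)
    (hs : y = 2 * (9 - x) * s + 3 * x + 6) (hs0 : y0 = 2 * (9 - x0) * s0 + 3 * x0 + 6)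
    (hu : Rat.padicValuation p (2 * (9 - x0)) = 1)
    (hr : r ^ 2 = -((1 + 4 * s - s ^ 2) ^ 3 + 108 * s ^ 3)) :
    Cg p (r ^ 2) (-((1 + 4 * s0 - s0 ^ 2) ^ 3 + 108 * s0 ^ 3)) := by
  have hd : Cg p (2 * (9 - x)) (2 * (9 - x0)) := by
    simpa using (Cg.int (p := p) 2).mul ((Cg.int (p := p) 9).sub hx)
  have n1 := v_unit_ne (v_eq_one_of_near hd.2.2 hu)
  have n2 := v_unit_ne hu
  have hss : Cg p s s0 := by
    have e1 : s = (y - (3 * x + 6)) / (2 * (9 - x)) := by rw [eq_div_iff n1, hs]; ring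
    have e2 : s0 = (y0 - (3 * x0 + 6)) / (2 * (9 - x0)) := by rw [eq_div_iff n2, hs0]; ring
    rw [e1, e2]
    refine (hy.sub ?_).div hd hu
    simpa using ((Cg.int (p := p) 3).mul hx).add (Cg.int (p := p) 6)
  rw [hr]
  have q1 : Cg p (1 + 4 * s - s ^ 2) (1 + 4 * s0 - s0 ^ 2) := by
    simpa using ((Cg.int (p := p) 1).add ((Cg.int (p := p) 4).mul hss)).sub (hss.pow 2)
  have q2 : Cg p (108 * s ^ 3) (108 * s0 ^ 3) := by
    simpa using (Cg.int (p := p) 108).mul (hss.pow 3)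
  exact ((q1.pow 3).add q2).neg

lemma isSquare_of_Cg {p : ℕ} [Fact p.Prime] {n : ℤ} {r d q : ℚ} (h : Cg p (r ^ 2) q)
    (hd : Rat.padicValuation p d = 1) (e : n * d ^ 2 = q) : IsSquare (n : ZMod p) := by
  apply isSquare_of_val (r := r / d)
  have hd0 := v_unit_ne hd
  rw [show (r / d) ^ 2 - (n : ℚ) = (r ^ 2 - q) / (d ^ 2) by rw [← e]; field_simp]
  exact v_div_lt h.2.2 (by rw [map_pow, hd, one_pow])

/-- `R ≡ T` mod `p` forces `745` to be a square mod `p` -/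
lemma red40 {p : ℕ} [Fact p.Prime] (h2 : p ≠ 2) (h3 : p ≠ 3) {x y s r : ℚ}
    (hx : Rat.padicValuation p x < 1) (hy : Rat.padicValuation p y < 1)
    (hs : y = 2 * (9 - x) * s + 3 * x + 6)
    (hr : r ^ 2 = -((1 + 4 * s - s ^ 2) ^ 3 + 108 * s ^ 3)) :
    IsSquare (((745 : ℕ) : ℤ) : ZMod p) := by
  have hp : p.Prime := Fact.out
  have v2 : Rat.padicValuation p (2 : ℚ) = 1 := by
    have n2 : ¬ (p : ℤ) ∣ 2 := by
      intro h
      have : p ∣ 2 := by exact_mod_cast h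
      exact h2 ((Nat.prime_dvd_prime_iff_eq hp Nat.prime_two).1 this)
    exact_mod_cast v_not_dvd n2
  have v3 : Rat.padicValuation p (3 : ℚ) = 1 := by
    have n3 : ¬ (p : ℤ) ∣ 3 := by
      intro h
      have : p ∣ 3 := by exact_mod_cast h
      exact h3 ((Nat.prime_dvd_prime_iff_eq hp Nat.prime_three).1 this)
    exact_mod_cast v_not_dvd n3
  have hC := red40_gen (p := p) (x0 := 0) (y0 := 0) (s0 := -1 / 3) (.of_near (by simp) (by simpa using hx))
    (.of_near (by simp) (by simpa using hy)) hs (by norm_num)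
    (by rw [show (2 * (9 - 0) : ℚ) = 2 * 3 * 3 by norm_num, map_mul, map_mul, v2, v3]; rfl) hr
  refine isSquare_of_Cg (d := 2 / (3 * 3 * 3)) hC ?_ (by norm_num)
  rw [map_div₀, map_mul, map_mul, v2, v3]; rfl

lemma odd_zsmul_T {A B : ℚ} {T : (EC A B).Point} (hT : IsPt T 0 0) {m : ℤ} (hm : Odd m) :
    m • T = T := by
  obtain ⟨k, rfl⟩ := hm
  rw [add_zsmul, mul_comm, mul_zsmul, two_zsmul, hT.dbl_zero, zsmul_zero, zero_add, one_zsmul]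

lemma sq3 : IsSquare (((745 : ℕ) : ℤ) : ZMod 3) := ⟨1, by decide⟩

lemma final40 {a b y : ℤ} (hg : Good40 a b y) (hJ : jacobiSym a 745 = -1)
    {S R : (EC 0 40).Point} {Y : ℚ} (hS : IsPt S (((a : ℚ) / b) ^ 2) Y) {m : ℤ} (hm : Odd m)
    (hR : R = m • S) {X Z s r : ℚ} (h : IsPt R X Z) (hs : Z = 2 * (9 - X) * s + 3 * X + 6)
    (hr : r ^ 2 = -((1 + 4 * s - s ^ 2) ^ 3 + 108 * s ^ 3)) : False := by
  obtain ⟨p, hp, hpa, hns⟩ := prime_of_jac 745 (by norm_num) hg.odd hJ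
  have : Fact p.Prime := ⟨hp⟩
  have h2 : p ≠ 2 := by
    rintro rfl
    exact (Int.not_even_iff_odd.2 hg.odd) (even_iff_two_dvd.2 hpa)
  have h3 : p ≠ 3 := by
    rintro rfl
    exact hns sq3
  have h5 : p ≠ 5 := by
    rintro rfl
    exact hg.five hpa
  have hpZ : Prime (p : ℤ) := Nat.prime_iff_prime_int.1 hp
  have n40 : ¬ (p : ℤ) ∣ 40 := by
    intro h
    have h : p ∣ 40 := by exact_mod_cast h
    have h : p ∣ 2 ^ 3 * 5 := h
    rcases (Nat.Prime.dvd_mul hp).1 h with h | h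
    · exact h2 ((Nat.prime_dvd_prime_iff_eq hp Nat.prime_two).1 (hp.dvd_of_dvd_pow h))
    · exact h5 ((Nat.prime_dvd_prime_iff_eq hp (by norm_num)).1 h)
  have nb : ¬ (p : ℤ) ∣ b := fun hb => hpZ.not_isUnit (hg.cop.isUnit_of_dvd' hpa hb)
  obtain ⟨T, hT⟩ := exists_isPt (A := 0) (B := 40) (by norm_num) (x := 0) (y := 0) (by norm_num)
  have v40 : Rat.padicValuation p (40 : ℚ) = 1 := by exact_mod_cast v_not_dvd n40
  have hA : Rat.padicValuation p (0 : ℚ) ≤ 1 := by simp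
  have hx : Rat.padicValuation p (((a : ℚ) / b) ^ 2) < 1 :=
    v_pow_lt (v_div_lt (v_dvd hpa) (v_not_dvd nb)) two_ne_zero
  have hK := (InK.of_T hS hT hx v40).zsmul hA v40.le m
  obtain ⟨x3, y3, q1, -, -, q2, q3⟩ := hK.add_red hA v40.le hT (by simp)
  have hTT : (m • (S + T)) + T = R := by
    rw [zsmul_add, odd_zsmul_T hT hm, hR, add_assoc, hT.dbl_zero, add_zero]
  rw [hTT] at q1
  obtain ⟨rfl, rfl⟩ := h.inj q1
  exact hns (red40 h2 h3 (by simpa using q2) (by simpa using q3) hs hr)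


lemma three40 {P : (EC 0 40).Point} (hP : IsPt P 9 33) :
    ∃ Y, IsPt ((3 : ℤ) • P) (((53037 : ℤ) / (37523 : ℤ) : ℚ) ^ 2) Y := by
  have h2 : IsPt (P + P) (1681/4356) (1131641/287496) :=
    hP.dbl_eq (by norm_num) (283 / 66) _ _ (by norm_num) (by norm_num) (by norm_num)
  have h3 := h2.add_eq hP (by norm_num) (8355727/2476518) (((53037 : ℤ) / (37523 : ℤ) : ℚ) ^ 2) _
    (by norm_num) (by norm_num) rfl
  rw [show (3 : ℤ) • P = P + P + P by
    rw [show (3 : ℤ) = 1 + 1 + 1 by norm_num, add_zsmul, add_zsmul, one_zsmul]]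
  exact ⟨_, h3⟩

lemma ns71a : ¬ IsSquare ((115253561485867780 : ℤ) : ZMod 71) := by decide
lemma ns71b : ¬ IsSquare ((745 : ℤ) : ZMod 71) := by decide

/-- multiples with `N` even and not divisible by 3 are impossible -/
lemma mod71 {P R : (EC 0 40).Point} (hP : IsPt P 9 33) {j : ℤ} {X Z s r : ℚ} (h : IsPt R X Z)
    (hs : Z = 2 * (9 - X) * s + 3 * X + 6)
    (hr : r ^ 2 = -((1 + 4 * s - s ^ 2) ^ 3 + 108 * s ^ 3)) :
    ¬ (R = (6 * j + 2) • P) ∧ ¬ (R = (6 * j + 4) • P) := by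
  have : Fact (Nat.Prime 71) := ⟨by norm_num⟩
  obtain ⟨Y3, h3⟩ := three40 hP
  obtain ⟨T, hT⟩ := exists_isPt (A := 0) (B := 40) (by norm_num) (x := 0) (y := 0) (by norm_num)
  have v40 : Rat.padicValuation 71 (40 : ℚ) = 1 := by
    exact_mod_cast v_not_dvd (p := 71) (n := 40) (by norm_num)
  have v3 : Rat.padicValuation 71 (3 : ℚ) = 1 := by
    exact_mod_cast v_not_dvd (p := 71) (n := 3) (by norm_num)
  have v41 : Rat.padicValuation 71 (41 : ℚ) = 1 := by
    exact_mod_cast v_not_dvd (p := 71) (n := 41) (by norm_num)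
  have v2 : Rat.padicValuation 71 (2 : ℚ) = 1 := by
    exact_mod_cast v_not_dvd (p := 71) (n := 2) (by norm_num)
  have hA : Rat.padicValuation 71 (0 : ℚ) ≤ 1 := by simp
  have hx : Rat.padicValuation 71 ((((53037 : ℤ) : ℚ) / (37523 : ℤ)) ^ 2) < 1 :=
    v_pow_lt (v_div_lt (v_dvd (by norm_num)) (v_not_dvd (by norm_num))) two_ne_zero
  have hK := (InK.of_T h3 hT hx v40).zsmul hA v40.le (2 * j + 1)
  have hu : Rat.padicValuation 71 (2 * (9 - 40 / 9) : ℚ) = 1 := by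
    rw [show (2 * (9 - 40 / 9) : ℚ) = 2 * 41 / (3 * 3) by norm_num, map_div₀, map_mul, map_mul,
      v2, v41, v3]; rfl
  have hx0 : Rat.padicValuation 71 (40 / 9 : ℚ) ≤ 1 := by
    rw [show (40 / 9 : ℚ) = 40 / (3 * 3) by norm_num, map_div₀, map_mul, v40, v3, mul_one, div_one]
  have hy0 : Rat.padicValuation 71 (440 / 27 : ℚ) ≤ 1 := by
    rw [show (440 / 27 : ℚ) = ((440 : ℤ) : ℚ) / (3 * 3 * 3) by norm_num, map_div₀, map_mul, map_mul,
      v3, mul_one, mul_one, div_one]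
    exact v_int _
  have hO : (2 * j + 1) • T = T := odd_zsmul_T hT ⟨j, rfl⟩
  constructor
  · intro hR
    have hQ : IsPt (-P + T) (40 / 9) (440 / 27) := by
      convert hP.neg.addT hT (by norm_num) using 1; norm_num
    obtain ⟨x3, y3, q1, -, -, q2, q3⟩ := hK.add_red hA v40.le hQ hx0
    have hTT : (2 * j + 1) • ((3 : ℤ) • P + T) + (-P + T) = R := by
      rw [zsmul_add, hO, smul_smul, hR,
        show (2 * j + 1) * (3 : ℤ) = 6 * j + 2 + 1 by ring]
      rw [add_zsmul P (6 * j + 2) 1, one_zsmul]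
      have := hT.dbl_zero
      rw [show (6 * j + 2) • P + P + T + (-P + T) = (6 * j + 2) • P + (T + T) by abel, this, add_zero]
    rw [hTT] at q1
    obtain ⟨rfl, rfl⟩ := h.inj q1
    have := red40_gen (p := 71) (s0 := -1 / 3) (.of_near hx0 q2) (.of_near hy0 q3) hs (by norm_num) hu hr
    refine ns71b (isSquare_of_Cg (d := 2 / (3 * 3 * 3)) this ?_ (by norm_num))
    rw [map_div₀, map_mul, map_mul, v2, v3]; rfl
  · intro hR
    have hQ : IsPt (P + T) (40 / 9) (-(440 / 27)) := by
      convert hP.addT hT (by norm_num) using 1; norm_num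
    obtain ⟨x3, y3, q1, -, -, q2, q3⟩ := hK.add_red hA v40.le hQ hx0
    have hTT : (2 * j + 1) • ((3 : ℤ) • P + T) + (P + T) = R := by
      rw [zsmul_add, hO, smul_smul, hR,
        show (2 * j + 1) * (3 : ℤ) = 6 * j + 4 - 1 by ring]
      rw [sub_zsmul P (6 * j + 4) 1, one_zsmul]
      have := hT.dbl_zero
      rw [show (6 * j + 4) • P + -P + T + (P + T) = (6 * j + 4) • P + (T + T) by abel, this, add_zero]
    rw [hTT] at q1
    obtain ⟨rfl, rfl⟩ := h.inj q1
    have := red40_gen (p := 71) (s0 := -481 / 123) (.of_near hx0 q2)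
      (.of_near (by rw [Valuation.map_neg]; exact hy0) q3) hs (by norm_num) hu hr
    refine ns71a (isSquare_of_Cg (d := 1 / (3 * 41) ^ 3) this ?_ (by norm_num))
    rw [map_div₀, map_pow, map_mul, v41, v3]; simp

/-- no admissible even multiple -/
lemma even40 {P R : (EC 0 40).Point} (hP : IsPt P 9 33) {N : ℤ} {X Z s r : ℚ} (h : IsPt R X Z)
    (hs : Z = 2 * (9 - X) * s + 3 * X + 6)
    (hr : r ^ 2 = -((1 + 4 * s - s ^ 2) ^ 3 + 108 * s ^ 3)) (hR : R = N • P) (hN : Even N) :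
    False := by
  have hN0 : N ≠ 0 := by
    rintro rfl
    rw [zero_zsmul] at hR
    exact h.ne_zero hR
  have h3 : (3 : ℤ) ∣ N := by
    have hj := mod71 hP (j := N / 6) h hs hr
    obtain ⟨t, ht⟩ := hN
    have : N % 6 ≠ 2 := fun q => hj.1 (by rw [hR]; congr 1; omega)
    have : N % 6 ≠ 4 := fun q => hj.2 (by rw [hR]; congr 1; omega)
    omega
  obtain ⟨k, m, hm, hkm⟩ : ∃ (k : ℕ) (m : ℤ), Odd m ∧ N = 2 ^ k * m := by
    obtain ⟨m, e, hm⟩ := (FiniteMultiplicity.of_prime_left Int.prime_two hN0).exists_eq_pow_mul_and_not_dvd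
    exact ⟨_, m, Int.not_even_iff_odd.1 (fun q => hm (even_iff_two_dvd.1 q)), e⟩
  have hk : k ≠ 0 := by
    rintro rfl
    rw [hkm] at hN
    simp at hN
    exact (Int.not_even_iff_odd.2 hm) hN
  obtain ⟨k, rfl⟩ := Nat.exists_eq_succ_of_ne_zero hk
  rw [Nat.succ_eq_add_one] at hkm
  have hk72 : (k / 72) * 72 + k % 72 + 1 = k + 1 := by omega
  by_cases hc : k % 8 = 0 ∨ k % 8 = 1 ∨ k % 8 = 2 ∨ k % 8 = 4 ∨ k % 8 = 6
  · have hP' : IsPt P (((3 : ℤ) / (1 : ℤ) : ℚ) ^ 2) 33 := by convert hP using 1; norm_num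
    obtain ⟨a, b, y, hg, ⟨Y, hY⟩, q1, -, -⟩ := seq40 (a := 3) (b := 1) (y := 11)
      ⟨by decide, by norm_num, isCoprime_one_right, by norm_num, by norm_num, by norm_num⟩ hP'
      (3, 1, 11) (by norm_num) (by norm_num) (by norm_num) (k + 1)
    rw [← hk72, seq745_per _ _ per1] at q1
    obtain ⟨r1, r2⟩ := pat1 (k % 72) (Nat.mod_lt _ (by norm_num)) (by omega)
    exact final40 hg (jac745 q1 r1 r2) hY hm (by rw [hR, hkm, mul_comm, mul_zsmul]) h hs hr
  · obtain ⟨Y3, hP'⟩ := three40 hP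
    obtain ⟨a, b, y, hg, ⟨Y, hY⟩, q1, -, -⟩ := seq40 (a := 53037) (b := 37523) (y := 9338540651)
      ⟨by decide, by norm_num, by rw [Int.isCoprime_iff_gcd_eq_one]; norm_num,
        by norm_num, by norm_num, by norm_num⟩ hP'
      (142, 273, 666) (by push_cast; decide) (by push_cast; decide) (by push_cast; decide) (k + 1)
    rw [← hk72, seq745_per _ _ per3] at q1
    obtain ⟨r1, r2⟩ := pat3 (k % 72) (Nat.mod_lt _ (by norm_num)) (by omega)
    have h3m : (3 : ℤ) ∣ m := by
      rw [hkm] at h3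
      rcases Int.prime_three.dvd_or_dvd h3 with q | q
      · have := Int.prime_three.dvd_of_dvd_pow q
        norm_num at this
      · exact q
    obtain ⟨m', rfl⟩ := h3m
    refine final40 hg (jac745 q1 r1 r2) hY (m := m') (Int.odd_mul.1 hm).2 ?_ h hs hr
    rw [hR, hkm, smul_smul, smul_smul]
    congr 1
    ring

theorem c111 {p q r s : ℚ} (hp : p ^ 2 = s ^ 2 + 1) (hq : q ^ 2 = s ^ 2 - 6 * s - 1)
    (hr : r ^ 2 = -((1 + 4 * s - s ^ 2) ^ 3 + 108 * s ^ 3)) : False := by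
  obtain ⟨P, hP⟩ := exists_isPt (A := 0) (B := 40) (by norm_num) (x := 9) (y := 33) (by norm_num)
  have ne0 : ∀ q : ℚ, q ^ 2 = s ^ 2 - 6 * s - 1 → p + q ≠ 0 := by
    intro q hq h0
    have h1 : p ^ 2 - q ^ 2 = 0 := by linear_combination (p - q) * h0
    have hs : s = -1 / 3 := by linarith
    rw [hs] at hq
    have : IsSquare (10 : ℚ) := ⟨3 * q, by linear_combination -9 * hq⟩
    rw [show (10 : ℚ) = ((10 : ℕ) : ℚ) by norm_num, Rat.isSquare_natCast_iff] at this
    revert this; decide +kernel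
  have pt : ∀ q : ℚ, q ^ 2 = s ^ 2 - 6 * s - 1 → ∃ R : (EC 0 40).Point,
      IsPt R ((p + q) ^ 2) (2 * (9 - (p + q) ^ 2) * s + 3 * (p + q) ^ 2 + 6) := by
    intro q hq
    refine exists_isPt (by norm_num) ?_
    have e : (p + q) ^ 2 = 2 * (p * q + s ^ 2 - 3 * s) := by linear_combination hp + hq
    rw [e]
    have e2 : (p * q) ^ 2 = (s ^ 2 + 1) * (s ^ 2 - 6 * s - 1) := by rw [mul_pow, hp, hq]
    linear_combination (-8 * (p * q) - 8 * s ^ 2 + 24 * s + 36) * e2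
  obtain ⟨R, hR⟩ := pt q hq
  obtain ⟨R', hR'⟩ := pt (-q) (by rw [neg_sq, hq])
  by_cases h9 : (p + q) ^ 2 = 9
  · have e1 : 2 * p * (p + q) = 11 + 6 * s := by linear_combination h9 + hp - hq
    have e2 : 36 * (s ^ 2 + 1) = (11 + 6 * s) ^ 2 := by
      rw [← e1, mul_pow, h9]; linear_combination -36 * hp
    have e3 : s = -85 / 132 := by linarith
    rw [e3] at hr
    have : IsSquare ((194259855027241 : ℕ) : ℚ) := ⟨2299968 * r, by
      linear_combination -5289852801024 * hr⟩
    rw [Rat.isSquare_natCast_iff] at this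
    revert this; decide +kernel
  · obtain ⟨N, hN⟩ := mw40' hP hR (ne0 q hq)
    have hsum : R' = (-1 - N) • P := by
      have h3 := hR.add_eq hP h9 (3 - 2 * s) ((p + -q) ^ 2)
        (-(2 * (9 - (p + -q) ^ 2) * s + 3 * (p + -q) ^ 2 + 6)) (by ring)
        (by linear_combination 2 * hp + 2 * hq) (by ring)
      have := h3.neg
      rw [neg_neg] at this
      rw [hR'.ext this, hN, sub_zsmul, neg_zsmul, one_zsmul]; abel
    rcases Int.even_or_odd N with hev | hod
    · exact even40 hP hR rfl hr hN hev
    · exact even40 hP hR' rfl hr hsum (by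
        obtain ⟨t, rfl⟩ := hod; exact ⟨-1 - t, by ring⟩)
end P4

open Polynomial
namespace P4

lemma sqf_decomp {N : ℤ} (hN : 0 < N) : ∃ (α a : ℕ), N = (α : ℤ) * (a : ℤ) ^ 2 ∧ 0 < α ∧ 0 < a ∧
    Squarefree α := by
  obtain ⟨α, a, h, hs⟩ := Nat.sq_mul_squarefree N.natAbs
  have h1 : N = (α : ℤ) * (a : ℤ) ^ 2 := by
    have : ((a ^ 2 * α : ℕ) : ℤ) = N := by rw [h]; omega
    rw [← this]; push_cast; ring
  refine ⟨α, a, h1, ?_, ?_, hs⟩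
  · rcases Nat.eq_zero_or_pos α with rfl | h'
    · simp at h1; omega
    · exact h'
  · rcases Nat.eq_zero_or_pos a with rfl | h'
    · simp at h1; omega
    · exact h'

lemma sqf_prime {N M y : ℤ} {α a p : ℕ} (h : N = (α : ℤ) * (a : ℤ) ^ 2) (ha : 0 < a)
    (hs : Squarefree α) (hy : N * M = y ^ 2) (hp : p.Prime) (hpα : p ∣ α) : (p : ℤ) ∣ M := by
  have hpZ : Prime (p : ℤ) := Nat.prime_iff_prime_int.1 hp
  have h1 : (a : ℤ) ^ 2 ∣ y ^ 2 := ⟨α * M, by rw [← hy, h]; ring⟩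
  rw [Int.pow_dvd_pow_iff two_ne_zero] at h1
  obtain ⟨z, rfl⟩ := h1
  have ha' : (a : ℤ) ^ 2 ≠ 0 := by positivity
  have h2 : (α : ℤ) * M = z ^ 2 := by
    apply mul_left_cancel₀ ha'
    rw [h] at hy; linarith
  obtain ⟨β, rfl⟩ := hpα
  have hz : (p : ℤ) ∣ z := by
    apply hpZ.dvd_of_dvd_pow (n := 2)
    rw [← h2]; push_cast; exact ⟨β * M, by ring⟩
  obtain ⟨w, rfl⟩ := hz
  have h3 : (β : ℤ) * M = p * w ^ 2 := by
    apply mul_left_cancel₀ hpZ.ne_zero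
    push_cast at h2; linarith
  have h4 : (p : ℤ) ∣ β * M := ⟨_, h3⟩
  rcases hpZ.dvd_or_dvd h4 with h5 | h5
  · exfalso
    have : p * p ∣ p * β := Nat.mul_dvd_mul_left p (by exact_mod_cast h5)
    exact hp.not_isUnit (hs p this)
  · exact h5

lemma sqf_dvd {α D : ℕ} (hs : Squarefree α) (hD : D ≠ 0) (h : ∀ p : ℕ, p.Prime → p ∣ α → p ∣ D) :
    α ∣ D := by
  rw [← Nat.prod_primeFactors_of_squarefree hs]
  refine dvd_trans (Finset.prod_dvd_prod_of_subset _ D.primeFactors _ ?_) (Nat.prod_primeFactors_dvd D)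
  intro p hp
  rw [Nat.mem_primeFactors] at hp ⊢
  exact ⟨hp.1, h p hp.1 hp.2.1, hD⟩

def fA {R : Type*} [CommRing R] (m n : R) : R := m ^ 2 + n ^ 2
def fB {R : Type*} [CommRing R] (m n : R) : R := m ^ 2 - 6 * m * n - n ^ 2
def fC {R : Type*} [CommRing R] (m n : R) : R := (n ^ 2 + 4 * m * n - m ^ 2) ^ 3 + 108 * (m * n) ^ 3

def Loc (q e : ℕ) (α β γ : ℤ) : Prop := ∀ m n : ZMod q, ((e : ZMod q) * m ≠ 0 ∨ (e : ZMod q) * n ≠ 0) →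
  ∀ a : ZMod q, fA m n = α * a ^ 2 → ∀ b : ZMod q, fB m n = β * b ^ 2 →
  ∀ c : ZMod q, - (γ : ZMod q) * fC m n = c ^ 2 → False

instance (q e : ℕ) [NeZero q] (α β γ : ℤ) : Decidable (Loc q e α β γ) := by
  unfold Loc; infer_instance

lemma loc_7 : ∀ t ∈ [(5, 1, 5), (5, 2, 10), (5, 5, 1), (5, 10, 2), (10, 1, 10), (10, 2, 5),
    (10, 5, 2), (10, 10, 1), (17, 1, 17), (17, 2, 34), (17, 5, 85), (17, 10, 170), (34, 1, 34),
    (34, 2, 17), (34, 5, 170), (34, 10, 85)], Loc 7 1 t.1 t.2.1 t.2.2 := by decide +kernel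
lemma loc_11 : ∀ t ∈ [(2, 1, 2), (2, 2, 1), (2, 5, 10), (2, 10, 5), (85, 1, 85), (85, 2, 170),
    (85, 5, 17), (85, 10, 34)], Loc 11 1 t.1 t.2.1 t.2.2 := by decide +kernel
lemma loc_8 : ∀ t ∈ [(1, 2, 2), (1, 5, 5), (1, 10, 10)], Loc 8 4 t.1 t.2.1 t.2.2 := by
  decide +kernel
lemma loc_25 : ∀ t ∈ [(170, 1, 170), (170, 2, 85), (170, 5, 34), (170, 10, 17)],
    Loc 25 5 t.1 t.2.1 t.2.2 := by
  decide +kernel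

def l7 : List (ℤ × ℤ × ℤ) := [(5, 1, 5), (5, 2, 10), (5, 5, 1), (5, 10, 2), (10, 1, 10), (10, 2, 5),
    (10, 5, 2), (10, 10, 1), (17, 1, 17), (17, 2, 34), (17, 5, 85), (17, 10, 170), (34, 1, 34),
    (34, 2, 17), (34, 5, 170), (34, 10, 85)]
def l11 : List (ℤ × ℤ × ℤ) := [(2, 1, 2), (2, 2, 1), (2, 5, 10), (2, 10, 5), (85, 1, 85), (85, 2, 170),
    (85, 5, 17), (85, 10, 34)]
def l8 : List (ℤ × ℤ × ℤ) := [(1, 2, 2), (1, 5, 5), (1, 10, 10)]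
def l25 : List (ℤ × ℤ × ℤ) := [(170, 1, 170), (170, 2, 85), (170, 5, 34), (170, 10, 17)]

def InL (l : List (ℤ × ℤ × ℤ)) (α β : ℕ) : Prop :=
  ∃ t ∈ l, t.1 = (α : ℤ) ∧ t.2.1 = (β : ℤ) ∧ ∃ g : Fin 200, g ≠ 0 ∧ t.1 * t.2.1 = t.2.2 * ((g : ℕ) : ℤ) ^ 2

instance (l : List (ℤ × ℤ × ℤ)) (α β : ℕ) : Decidable (InL l α β) := by
  unfold InL; infer_instance

lemma cover : ∀ α ∈ Nat.divisors 170, ∀ β ∈ Nat.divisors 10, (α = 1 ∧ β = 1) ∨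
    InL l7 α β ∨ InL l11 α β ∨ InL l8 α β ∨ InL l25 α β := by decide +kernel

lemma use_loc {l : List (ℤ × ℤ × ℤ)} {q e : ℕ} (hl : ∀ t ∈ l, Loc q e t.1 t.2.1 t.2.2)
    (hqe : ¬ q ∣ e) {α β : ℕ} (h : InL l α β) {m n a b z : ℤ} (hmn : IsCoprime m n)
    (hA : fA m n = α * a ^ 2) (hB : fB m n = β * b ^ 2) (hC : - ((α : ℤ) * β * fC m n) = z ^ 2) :
    False := by
  obtain ⟨t, ht, h1, h2, g, hg, hg'⟩ := h
  have hg0 : ((g : ℕ) : ℤ) ≠ 0 := by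
    intro h; exact hg (by exact_mod_cast h)
  rw [← h1, ← h2, hg'] at hC
  have hgz : ((g : ℕ) : ℤ) ^ 2 ∣ z ^ 2 := ⟨- (t.2.2 * fC m n), by rw [← hC]; ring⟩
  rw [Int.pow_dvd_pow_iff two_ne_zero] at hgz
  obtain ⟨w, rfl⟩ := hgz
  have hw : - t.2.2 * fC m n = w ^ 2 := by
    apply mul_left_cancel₀ (pow_ne_zero 2 hg0); linarith
  refine hl t ht (m : ZMod q) (n : ZMod q) ?_ (a : ZMod q) ?_ (b : ZMod q) ?_ (w : ZMod q) ?_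
  · by_contra hcon
    push Not at hcon
    obtain ⟨c1, c2⟩ := hcon
    have c1' : (q : ℤ) ∣ e * m := by
      rw [← ZMod.intCast_zmod_eq_zero_iff_dvd]; push_cast; exact c1
    have c2' : (q : ℤ) ∣ e * n := by
      rw [← ZMod.intCast_zmod_eq_zero_iff_dvd]; push_cast; exact c2
    obtain ⟨i, j, hij⟩ := hmn
    apply hqe
    have : (q : ℤ) ∣ e := by
      have : (e : ℤ) = i * (e * m) + j * (e * n) := by linear_combination (-(e:ℤ)) * hij
      rw [this]; exact dvd_add (c1'.mul_left _) (c2'.mul_left _)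
    exact_mod_cast this
  · have := congrArg (Int.cast : ℤ → ZMod q) hA
    rw [h1]; simpa [fA] using this
  · have := congrArg (Int.cast : ℤ → ZMod q) hB
    rw [h2]; simpa [fB] using this
  · have := congrArg (Int.cast : ℤ → ZMod q) hw
    simpa [fC] using this

lemma not_both {p m n : ℤ} (hp : Prime p) (hmn : IsCoprime m n) (h1 : p ∣ m) (h2 : p ∣ n) : False :=
  hp.not_isUnit (hmn.isUnit_of_dvd' h1 h2)

lemma gAB {p m n : ℤ} (hp : Prime p) (hmn : IsCoprime m n) (hA : p ∣ fA m n) (hB : p ∣ fB m n) :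
    p ∣ 10 := by
  have hm : ¬ p ∣ m := fun h => not_both hp hmn h (hp.dvd_of_dvd_pow (n := 2) (by
    have : n ^ 2 = fA m n - m * m := by simp only [fA]; ring
    rw [this]; exact dvd_sub hA (h.mul_left _)))
  have hn : ¬ p ∣ n := fun h => not_both hp hmn (hp.dvd_of_dvd_pow (n := 2) (by
    have : m ^ 2 = fA m n - n * n := by simp only [fA]; ring
    rw [this]; exact dvd_sub hA (h.mul_left _))) h
  have h1 : p ∣ 2 * n * (n + 3 * m) := by
    have : 2 * n * (n + 3 * m) = fA m n - fB m n := by simp only [fA, fB]; ring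
    rw [this]; exact dvd_sub hA hB
  rcases hp.dvd_or_dvd h1 with h1 | h1
  · rcases hp.dvd_or_dvd h1 with h1 | h1
    · exact h1.trans (by norm_num)
    · exact absurd h1 hn
  · have h2 : p ∣ 10 * m ^ 2 := by
      have : 10 * m ^ 2 = fA m n - (n - 3 * m) * (n + 3 * m) := by simp only [fA]; ring
      rw [this]; exact dvd_sub hA (h1.mul_left _)
    rcases hp.dvd_or_dvd h2 with h2 | h2
    · exact h2
    · exact absurd (hp.dvd_of_dvd_pow h2) hm

lemma gAC {p m n : ℤ} (hp : Prime p) (hmn : IsCoprime m n) (hA : p ∣ fA m n) (hC : p ∣ fC m n) :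
    p ∣ 170 := by
  have hm : ¬ p ∣ m := fun h => not_both hp hmn h (hp.dvd_of_dvd_pow (n := 2) (by
    have : n ^ 2 = fA m n - m * m := by simp only [fA]; ring
    rw [this]; exact dvd_sub hA (h.mul_left _)))
  have hn : ¬ p ∣ n := fun h => not_both hp hmn (hp.dvd_of_dvd_pow (n := 2) (by
    have : m ^ 2 = fA m n - n * n := by simp only [fA]; ring
    rw [this]; exact dvd_sub hA (h.mul_left _))) h
  have h1 : p ∣ 4 * m ^ 3 * n ^ 2 * (31 * n - 22 * m) := by
    obtain ⟨k, hk⟩ : fA m n ∣ fC m n - 4 * m ^ 3 * n ^ 2 * (31 * n - 22 * m) :=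
      ⟨n^4 + 12*m*n^3 + 44*m^2*n^2 + 12*m^3*n - m^4, by simp only [fA, fC]; ring⟩
    have : 4 * m ^ 3 * n ^ 2 * (31 * n - 22 * m) = fC m n - fA m n * k := by rw [← hk]; ring
    rw [this]; exact dvd_sub hC (hA.mul_right _)
  have p2 : p ∣ 4 → p ∣ 170 := fun h => by
    have : p ∣ 2 ^ 2 := by simpa using h
    exact (hp.dvd_of_dvd_pow this).trans (by norm_num)
  rcases hp.dvd_or_dvd h1 with h1 | h1
  · rcases hp.dvd_or_dvd h1 with h1 | h1
    · rcases hp.dvd_or_dvd h1 with h1 | h1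
      · exact p2 h1
      · exact absurd (hp.dvd_of_dvd_pow h1) hm
    · exact absurd (hp.dvd_of_dvd_pow h1) hn
  · have h2 : p ∣ 5 * 17 ^ 2 * m ^ 2 := by
      have : 5 * 17 ^ 2 * m ^ 2 = 31 ^ 2 * fA m n - (31 * n + 22 * m) * (31 * n - 22 * m) := by
        simp only [fA]; ring
      rw [this]; exact dvd_sub (hA.mul_left _) (h1.mul_left _)
    rcases hp.dvd_or_dvd h2 with h2 | h2
    · rcases hp.dvd_or_dvd h2 with h2 | h2
      · exact h2.trans (by norm_num)
      · exact (hp.dvd_of_dvd_pow h2).trans (by norm_num)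
    · exact absurd (hp.dvd_of_dvd_pow h2) hm

lemma gBC {p m n : ℤ} (hp : Prime p) (hmn : IsCoprime m n) (hB : p ∣ fB m n) (hC : p ∣ fC m n) :
    p ∣ 10 := by
  have hm : ¬ p ∣ m := fun h => not_both hp hmn h (hp.dvd_of_dvd_pow (n := 2) (by
    have : n ^ 2 = (m - 6 * n) * m - fB m n := by simp only [fB]; ring
    rw [this]; exact dvd_sub (h.mul_left _) hB))
  have hn : ¬ p ∣ n := fun h => not_both hp hmn (hp.dvd_of_dvd_pow (n := 2) (by
    have : m ^ 2 = fB m n + (6 * m + n) * n := by simp only [fB]; ring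
    rw [this]; exact dvd_add hB (h.mul_left _))) h
  have h1 : p ∣ 10 ^ 2 * (m * n) ^ 3 := by
    have : 10 ^ 2 * (m * n) ^ 3 = fC m n + fB m n * (fB m n ^ 2 + 6 * (m * n) * fB m n + 12 * (m * n) ^ 2) := by
      simp only [fB, fC]; ring
    rw [this]; exact dvd_add hC (hB.mul_right _)
  rcases hp.dvd_or_dvd h1 with h1 | h1
  · exact hp.dvd_of_dvd_pow h1
  · rcases hp.dvd_or_dvd (hp.dvd_of_dvd_pow h1) with h1 | h1
    · exact absurd h1 hm
    · exact absurd h1 hn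

lemma c_pos {m n y : ℤ} (hmn : IsCoprime m n) (hn : n ≠ 0) (hB : 0 < fB m n)
    (h : - (fA m n * fB m n * fC m n) = y ^ 2) : False := by
  have hA : 0 < fA m n := by
    have := sq_pos_of_ne_zero hn (R := ℤ)
    simp only [fA]; nlinarith [sq_nonneg m]
  obtain ⟨α, a, hα, hα0, ha0, hαs⟩ := sqf_decomp hA
  obtain ⟨β, b, hβ, hβ0, hb0, hβs⟩ := sqf_decomp hB
  have hα' : α ∣ 170 := sqf_dvd hαs (by norm_num) fun p hp hpα => by
    have hpZ := Nat.prime_iff_prime_int.1 hp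
    have h1 : (p : ℤ) ∣ - (fB m n * fC m n) := sqf_prime hα ha0 hαs (by rw [← h]; ring) hp hpα
    have h0 : (p : ℤ) ∣ fA m n := by
      rw [hα]; exact (Int.natCast_dvd_natCast.2 hpα).mul_right _
    rw [dvd_neg] at h1
    have : (p : ℤ) ∣ 170 := by
      rcases hpZ.dvd_or_dvd h1 with h1 | h1
      · exact (gAB hpZ hmn h0 h1).trans (by norm_num)
      · exact gAC hpZ hmn h0 h1
    exact_mod_cast this
  have hβ' : β ∣ 10 := sqf_dvd hβs (by norm_num) fun p hp hpα => by
    have hpZ := Nat.prime_iff_prime_int.1 hp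
    have h1 : (p : ℤ) ∣ - (fA m n * fC m n) := sqf_prime hβ hb0 hβs (by rw [← h]; ring) hp hpα
    have h0 : (p : ℤ) ∣ fB m n := by
      rw [hβ]; exact (Int.natCast_dvd_natCast.2 hpα).mul_right _
    rw [dvd_neg] at h1
    have : (p : ℤ) ∣ 10 := by
      rcases hpZ.dvd_or_dvd h1 with h1 | h1
      · exact gAB hpZ hmn h1 h0
      · exact gBC hpZ hmn h0 h1
    exact_mod_cast this
  have hab0 : ((a : ℤ) * b) ≠ 0 := by positivity
  have hd : ((a : ℤ) * b) ^ 2 ∣ y ^ 2 := ⟨- (α * β * fC m n), by rw [← h, hα, hβ]; ring⟩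
  rw [Int.pow_dvd_pow_iff two_ne_zero] at hd
  obtain ⟨z, rfl⟩ := hd
  have hC : - ((α : ℤ) * β * fC m n) = z ^ 2 := by
    apply mul_left_cancel₀ (pow_ne_zero 2 hab0)
    rw [hα, hβ] at h; linarith
  rcases cover α (Nat.mem_divisors.2 ⟨hα', by norm_num⟩) β (Nat.mem_divisors.2 ⟨hβ', by norm_num⟩)
    with ⟨rfl, rfl⟩ | hl | hl | hl | hl
  · have hnq : (n : ℚ) ≠ 0 := by exact_mod_cast hn
    have e1 := congrArg (Int.cast : ℤ → ℚ) hα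
    have e2 := congrArg (Int.cast : ℤ → ℚ) hβ
    have e3 := congrArg (Int.cast : ℤ → ℚ) hC
    simp only [fA, fB, fC] at e1 e2 e3
    push_cast at e1 e2 e3
    refine c111 (s := m / n) (p := a / n) (q := b / n) (r := z / n ^ 3) ?_ ?_ ?_
    · field_simp; linarith
    · field_simp; linarith
    · field_simp; linarith
  · exact use_loc loc_7 (by decide) hl hmn hα hβ hC
  · exact use_loc loc_11 (by decide) hl hmn hα hβ hC
  · exact use_loc loc_8 (by decide) hl hmn hα hβ hC
  · exact use_loc loc_25 (by decide) hl hmn hα hβ hC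

lemma int_of_sq {q : ℚ} {k : ℤ} (h : q ^ 2 = k) : ∃ z : ℤ, k = z ^ 2 := by
  have : IsSquare (k : ℚ) := ⟨q, by rw [← h]; ring⟩
  rw [Rat.isSquare_intCast_iff] at this
  obtain ⟨z, hz⟩ := this
  exact ⟨z, by rw [hz]; ring⟩

lemma rat_frac (s : ℚ) : ∃ m n : ℤ, IsCoprime m n ∧ 0 < n ∧ s = m / n := by
  refine ⟨s.num, s.den, ?_, ?_, ?_⟩
  · rw [Int.isCoprime_iff_gcd_eq_one]; simpa [Int.gcd] using s.reduced
  · exact_mod_cast s.den_pos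
  · exact_mod_cast (Rat.num_div_den s).symm

theorem lem_c {s y : ℚ} (hs : s ≠ 0)
    (h : y ^ 2 = - (((1 + 4 * s - s ^ 2) ^ 3 + 108 * s ^ 3) * (s ^ 2 + 1) * (s ^ 2 - 6 * s - 1))) :
    False := by
  obtain ⟨m, n, hcop, hn0, rfl⟩ := rat_frac s
  have hn : (n : ℚ) ≠ 0 := by exact_mod_cast hn0.ne'
  have hm0 : m ≠ 0 := by rintro rfl; simp at hs
  have h1 : (y * n ^ 5) ^ 2 = ((- (fA m n * fB m n * fC m n) : ℤ) : ℚ) := by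
    rw [mul_pow, h]; simp only [fA, fB, fC]; push_cast; field_simp
  obtain ⟨z, hz⟩ := int_of_sq h1
  rcases lt_trichotomy (fB m n) 0 with hB | hB | hB
  · refine c_pos (m := -n) (n := m) (y := z) ?_ hm0 ?_ ?_
    · exact (IsCoprime.neg_left hcop.symm)
    · have : fB (-n) m = - fB m n := by simp only [fB]; ring
      rw [this]; linarith
    · rw [← hz]; simp only [fA, fB, fC]; ring
  · have h2 : ((m - 3 * n : ℚ) / n) ^ 2 = ((10 : ℤ) : ℚ) := by
      have := congrArg (Int.cast : ℤ → ℚ) hB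
      simp only [fB] at this
      push_cast at this ⊢
      field_simp; linarith
    obtain ⟨w, hw⟩ := int_of_sq h2
    have : w ≤ 3 := by nlinarith
    have : -3 ≤ w := by nlinarith
    interval_cases w <;> omega
  · exact c_pos hcop hn0.ne' hB hz

end P4

open Polynomial
namespace P4

abbrev Eis := QuadraticAlgebra ℤ (-1) (-1)

lemma eis_norm (z : Eis) : z.norm = z.re ^ 2 - z.re * z.im + z.im ^ 2 := by
  rw [QuadraticAlgebra.norm_def]; ring

lemma eis_norm_nonneg (z : Eis) : 0 ≤ z.norm := by
  rw [eis_norm]; nlinarith [sq_nonneg (z.re - z.im), sq_nonneg z.re, sq_nonneg z.im]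

lemma eis_norm_zero {z : Eis} (h : z.norm = 0) : z = 0 := by
  rw [eis_norm] at h
  have h1 : z.re = 0 := by
    apply pow_eq_zero_iff (two_ne_zero) |>.1
    nlinarith [sq_nonneg (z.re - z.im), sq_nonneg z.re, sq_nonneg z.im]
  have h2 : z.im = 0 := by
    apply pow_eq_zero_iff (two_ne_zero) |>.1
    nlinarith [sq_nonneg (z.re - z.im), sq_nonneg z.re, sq_nonneg z.im]
  ext <;> simp [h1, h2]

lemma near (u N : ℤ) (hN : 0 < N) : ∃ k : ℤ, |2 * (u - N * k)| ≤ N := by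
  refine ⟨(2 * u + N) / (2 * N), ?_⟩
  have h1 := Int.emod_add_mul_ediv (2 * u + N) (2 * N)
  have h2 := Int.emod_nonneg (2 * u + N) (show (2 * N) ≠ 0 by omega)
  have h3 := Int.emod_lt_of_pos (2 * u + N) (show 0 < 2 * N by omega)
  rw [abs_le]; constructor <;> linarith

lemma eis_div (x y : Eis) (hy : y ≠ 0) : ∃ q : Eis, (x - y * q).norm < y.norm := by
  have hN : 0 < y.norm := lt_of_le_of_ne (eis_norm_nonneg y) (fun h => hy (eis_norm_zero h.symm))
  obtain ⟨k, hk⟩ := near (x * star y).re y.norm hN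
  obtain ⟨l, hl⟩ := near (x * star y).im y.norm hN
  refine ⟨⟨k, l⟩, ?_⟩
  set N := y.norm with hNdef
  set q : Eis := ⟨k, l⟩
  have h1 : (x - y * q).norm * N = ((x * star y) - N * q).norm := by
    have h2 : (x - y * q) * star y = (x * star y) - N * q := by
      have : (N : Eis) = y * star y := by
        rw [← QuadraticAlgebra.algebraMap_norm_eq_mul_star]; rfl
      rw [this]; ring
    rw [← h2, map_mul, QuadraticAlgebra.norm_star]
  set e := (x * star y) - N * q with he
  have e1 : e.re = (x * star y).re - N * k := by
    simp [he, q]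
  have e2 : e.im = (x * star y).im - N * l := by
    simp [he, q]
  rw [← e1] at hk
  rw [← e2] at hl
  rw [abs_le] at hk hl
  have h4 : e.norm < N * N := by
    rw [eis_norm]
    have a1 : (2 * e.re) ^ 2 ≤ N ^ 2 := by nlinarith
    have a2 : (2 * e.im) ^ 2 ≤ N ^ 2 := by nlinarith
    have a3 : - N ^ 2 ≤ (2 * e.re) * (2 * e.im) := by nlinarith
    nlinarith
  rw [← h1] at h4
  exact lt_of_mul_lt_mul_right h4 hN.le

noncomputable instance : EuclideanDomain Eis :=
  { (inferInstance : CommRing Eis), (inferInstance : Nontrivial Eis) with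
    quotient := fun x y => open Classical in if h : y = 0 then 0 else (eis_div x y h).choose
    remainder := fun x y => open Classical in
      x - y * (if h : y = 0 then 0 else (eis_div x y h).choose)
    quotient_zero := fun x => by simp
    quotient_mul_add_remainder_eq := fun x y => by ring
    r := fun x y => x.norm.natAbs < y.norm.natAbs
    r_wellFounded := (measure (fun x : Eis => x.norm.natAbs)).wf
    remainder_lt := fun x y hy => by
      have := (eis_div x y hy).choose_spec
      have h0 := eis_norm_nonneg (x - y * (eis_div x y hy).choose)
      simp only [hy, dite_false]
      omega
    mul_left_not_lt := fun a b hb => by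
      rw [map_mul, Int.natAbs_mul]
      have : b.norm.natAbs ≠ 0 := by
        intro h; exact hb (eis_norm_zero (Int.natAbs_eq_zero.1 h))
      rw [not_lt]
      exact Nat.le_mul_of_pos_right _ (Nat.pos_of_ne_zero this) }

lemma eis_unit {u : Eis} (h : u.norm = 1) : u = 1 ∨ u = -1 ∨ u = ⟨0, 1⟩ ∨ u = -⟨0, 1⟩ ∨ u = ⟨1, 1⟩ ∨
    u = -⟨1, 1⟩ := by
  rw [eis_norm] at h
  obtain ⟨x, y⟩ := u
  simp only at h
  have h1 : x ≤ 1 := by nlinarith [sq_nonneg (x - 2 * y)]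
  have h2 : -1 ≤ x := by nlinarith [sq_nonneg (x - 2 * y)]
  have h3 : y ≤ 1 := by nlinarith [sq_nonneg (y - 2 * x)]
  have h4 : -1 ≤ y := by nlinarith [sq_nonneg (y - 2 * x)]
  interval_cases x <;> interval_cases y <;> first | omega | simp [QuadraticAlgebra.ext_iff, QuadraticAlgebra.re_one, QuadraticAlgebra.im_one]

lemma eic (n : ℤ) : (n : Eis) = ⟨n, 0⟩ := rfl

lemma eis_even (d : Eis) : ∃ k l : ℤ, d ^ 3 = (⟨k + l, 2 * l⟩ : Eis) ^ 3 := by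
  obtain ⟨x, y⟩ := d
  have hω : (⟨0, 1⟩ : Eis) ^ 3 = 1 := by
    rw [pow_succ, pow_two]; ext <;> simp [QuadraticAlgebra.re_one, QuadraticAlgebra.im_one]
  rcases Int.even_or_odd y with ⟨l, hl⟩ | hy
  · exact ⟨x - l, l, by congr 2; ring; omega⟩
  · rcases Int.even_or_odd x with ⟨l, hl⟩ | hx
    · refine ⟨y - x + l, - l, ?_⟩
      have : (⟨y - x + l + -l, 2 * -l⟩ : Eis) = ⟨0, 1⟩ ^ 2 * ⟨x, y⟩ := by
        rw [pow_two]; ext <;> simp <;> omega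
      rw [this, mul_pow, ← pow_mul, mul_comm 2 3, pow_mul, hω]; simp
    · obtain ⟨l, hl⟩ := hx.sub_odd hy
      refine ⟨- y - l, l, ?_⟩
      have : (⟨- y - l + l, 2 * l⟩ : Eis) = ⟨0, 1⟩ * ⟨x, y⟩ := by
        ext <;> simp <;> omega
      rw [this, mul_pow, hω]; simp

lemma eis_cubeval (k l : ℤ) : (⟨k + l, 2 * l⟩ : Eis) ^ 3 =
    ⟨k ^ 3 - 9 * k * l ^ 2 + (3 * k ^ 2 * l - 3 * l ^ 3), 2 * (3 * k ^ 2 * l - 3 * l ^ 3)⟩ := by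
  rw [pow_succ, pow_two]; ext
  · simp; ring
  · simp; ring

lemma eis_cube {q p f : ℤ} (hc : IsCoprime (2 * q) f) (h : q ^ 2 + 3 * p ^ 2 = f ^ 3)
    (hodd : Odd f) :
    ∃ k l : ℤ, q = k ^ 3 - 9 * k * l ^ 2 ∧ p = 3 * k ^ 2 * l - 3 * l ^ 3 := by
  set α : Eis := ⟨q + p, 2 * p⟩ with hα
  set β : Eis := ⟨q - p, - (2 * p)⟩ with hβ
  have hab : α * β = ((f : ℤ) : Eis) ^ 3 := by
    have : ((f : ℤ) : Eis) ^ 3 = ((f ^ 3 : ℤ) : Eis) := by push_cast; rfl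
    rw [this, ← h, eic]
    ext
    · simp [hα, hβ]; ring
    · simp [hα, hβ]; ring
  have hcop : IsCoprime α β := by
    have h3 : IsCoprime (2 * q) (f ^ 3) := hc.pow_right
    obtain ⟨s, t, hst⟩ := h3
    refine ⟨s, s + t * α, ?_⟩
    have : (t : Eis) * α * β = ((t * f ^ 3 : ℤ) : Eis) := by rw [mul_assoc, hab]; push_cast; rfl
    have h5 : α + β = ((2 * q : ℤ) : Eis) := by
      rw [eic]
      ext
      · simp [hα, hβ]; ring
      · simp [hα, hβ]
    have h6 : (s : Eis) * α + (s + t * α) * β = s * (α + β) + t * α * β := by ring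
    rw [h6, this, h5]
    have := congrArg (Int.cast : ℤ → Eis) hst
    push_cast at this ⊢
    linear_combination this
  obtain ⟨d, hd⟩ := exists_associated_pow_of_associated_pow_mul (c := (f : Eis)) (k := 3) hcop
    (by rw [hab])
  obtain ⟨u, hu⟩ := hd
  obtain ⟨k, l, hkl⟩ := eis_even d
  rw [hkl, eis_cubeval] at hu
  have hqp : Odd (q + p) := by
    have : Odd (q ^ 2 + 3 * p ^ 2) := by rw [h]; exact hodd.pow
    rcases Int.even_or_odd (q + p) with h' | h'
    · exfalso
      have h2 : q ^ 2 + 3 * p ^ 2 = (q + p) * (q - p) + 2 * (2 * p ^ 2) := by ring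
      rw [h2] at this
      rw [← Int.not_even_iff_odd] at this
      exact this ((h'.mul_right _).add (even_two_mul _))
    · exact h'
  obtain ⟨j, hj⟩ := hqp
  have hun : (u : Eis).norm = 1 := by
    have := (QuadraticAlgebra.isUnit_iff_norm_isUnit (x := (u : Eis))).1 u.isUnit
    rcases Int.isUnit_iff.1 this with h' | h'
    · exact h'
    · have := eis_norm_nonneg (u : Eis); omega
  generalize hK : k ^ 3 - 9 * k * l ^ 2 = K at hu
  generalize hL : 3 * k ^ 2 * l - 3 * l ^ 3 = L at hu
  rcases eis_unit hun with h1 | h1 | h1 | h1 | h1 | h1 <;> rw [h1] at hu <;>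
    simp only [hα, QuadraticAlgebra.ext_iff, QuadraticAlgebra.re_mul, QuadraticAlgebra.im_mul,
      QuadraticAlgebra.re_one, QuadraticAlgebra.im_one, QuadraticAlgebra.re_neg,
      QuadraticAlgebra.im_neg] at hu
  · refine ⟨k, l, ?_, ?_⟩ <;> omega
  · refine ⟨-k, -l, ?_, ?_⟩
    · have : (-k) ^ 3 - 9 * (-k) * (-l) ^ 2 = - K := by rw [← hK]; ring
      omega
    · have : 3 * (-k) ^ 2 * (-l) - 3 * (-l) ^ 3 = - L := by rw [← hL]; ring
      omega
  all_goals exfalso; omega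
end P4

open Polynomial
namespace P4

lemma a_mod8 : ∀ p q c : ZMod 8, p * (p ^ 2 + 3 * q ^ 2) = 2 * c ^ 3 → 4 * p = 0 := by decide +kernel
lemma a_mod9 : ∀ p q c : ZMod 9, p * (p ^ 2 + 3 * q ^ 2) = 2 * c ^ 3 → 3 * p = 0 := by decide +kernel

lemma natAbs_lt_of_mul {a b c : ℤ} (h : c = a * b) (hc : c ≠ 0) (ha : 2 ≤ a.natAbs) :
    b.natAbs < c.natAbs := by
  subst h
  have : b.natAbs ≠ 0 := by
    intro h; apply hc; rw [Int.natAbs_eq_zero] at h; rw [h]; ring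
  rw [Int.natAbs_mul]
  nlinarith [Nat.pos_of_ne_zero this]

lemma a_int : ∀ N : ℕ, ∀ p q c : ℤ, c.natAbs ≤ N → c ≠ 0 → p * (p ^ 2 + 3 * q ^ 2) = 2 * c ^ 3 →
    False := by
  intro N
  induction N with
  | zero => intro p q c h1 h2 _; omega
  | succ N ih =>
    intro p q c hN hc h
    by_cases hpq : IsCoprime p q
    swap
    · have : Int.gcd p q ≠ 1 := fun h => hpq (Int.isCoprime_iff_gcd_eq_one.2 h)
      obtain ⟨l, hl, hlg⟩ := Nat.exists_prime_and_dvd this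
      have hlZ := Nat.prime_iff_prime_int.1 hl
      have hlp : (l : ℤ) ∣ p := (Int.natCast_dvd_natCast.2 hlg).trans (Int.gcd_dvd_left _ _)
      have hlq : (l : ℤ) ∣ q := (Int.natCast_dvd_natCast.2 hlg).trans (Int.gcd_dvd_right _ _)
      obtain ⟨p', rfl⟩ := hlp
      obtain ⟨q', rfl⟩ := hlq
      have h3 : (l : ℤ) ^ 3 * (p' * (p' ^ 2 + 3 * q' ^ 2)) = 2 * c ^ 3 := by rw [← h]; ring
      have hlc : (l : ℤ) ∣ c := by
        by_cases h2 : l = 2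
        · subst h2
          have : (2 : ℤ) ∣ c ^ 3 := ⟨2 * (p' * (p' ^ 2 + 3 * q' ^ 2)), by push_cast at h3; linarith⟩
          exact_mod_cast hlZ.dvd_of_dvd_pow (by exact_mod_cast this)
        · have : (l : ℤ) ∣ 2 * c ^ 3 := ⟨(l : ℤ) ^ 2 * (p' * (p' ^ 2 + 3 * q' ^ 2)), by
            rw [← h3]; ring⟩
          rcases hlZ.dvd_or_dvd this with h' | h'
          · exfalso; apply h2
            have : l ∣ 2 := by exact_mod_cast h'
            exact (Nat.prime_dvd_prime_iff_eq hl Nat.prime_two).1 this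
          · exact hlZ.dvd_of_dvd_pow h'
      obtain ⟨c', hc'⟩ := hlc
      have hlt := natAbs_lt_of_mul hc' hc (by simpa using hl.two_le)
      refine ih p' q' c' (by omega) ?_ ?_
      · rintro rfl; simp at hc'; exact hc hc'
      · apply mul_left_cancel₀ (pow_ne_zero 3 hlZ.ne_zero)
        rw [h3, hc']; ring
    · have h8 : (2 : ℤ) ∣ p := by
        have := a_mod8 p q c (by exact_mod_cast congrArg (Int.cast : ℤ → ZMod 8) h)
        have h' : ((4 * p : ℤ) : ZMod 8) = 0 := by push_cast; exact this
        rw [ZMod.intCast_zmod_eq_zero_iff_dvd] at h'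
        omega
      have h9 : (3 : ℤ) ∣ p := by
        have := a_mod9 p q c (by exact_mod_cast congrArg (Int.cast : ℤ → ZMod 9) h)
        have h' : ((3 * p : ℤ) : ZMod 9) = 0 := by push_cast; exact this
        rw [ZMod.intCast_zmod_eq_zero_iff_dvd] at h'
        omega
      have p3 : Prime (3 : ℤ) := Int.prime_three
      have hq2 : ¬ (2 : ℤ) ∣ q := fun h' => not_both Int.prime_two hpq h8 h'
      have hq3 : ¬ (3 : ℤ) ∣ q := fun h' => not_both p3 hpq h9 h'
      obtain ⟨P, hP⟩ : (6 : ℤ) ∣ p := by omega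
      have hc3 : (3 : ℤ) ∣ c := p3.dvd_of_dvd_pow (n := 3) ⟨3 * P * (12 * P ^ 2 + q ^ 2), by
        rw [hP] at h; linarith⟩
      obtain ⟨C, hC⟩ := hc3
      have e1 : P * (12 * P ^ 2 + q ^ 2) = 3 * C ^ 3 := by rw [hP, hC] at h; linarith
      have hP3 : (3 : ℤ) ∣ P := by
        have : (3 : ℤ) ∣ P * (12 * P ^ 2 + q ^ 2) := ⟨_, e1⟩
        rcases p3.dvd_or_dvd this with h' | h'
        · exact h'
        · exfalso; apply hq3; apply p3.dvd_of_dvd_pow (n := 2)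
          have : q ^ 2 = (12 * P ^ 2 + q ^ 2) - 3 * (4 * P ^ 2) := by ring
          rw [this]; exact dvd_sub h' (dvd_mul_right _ _)
      obtain ⟨R, hR⟩ := hP3
      have e2 : R * (q ^ 2 + 108 * R ^ 2) = C ^ 3 := by rw [hR] at e1; linarith
      have hqR : IsCoprime q (18 * R) := by
        have : p = 18 * R := by rw [hP, hR]; ring
        rw [← this]; exact hpq.symm
      have hqR' : IsCoprime q R := hqR.of_isCoprime_of_dvd_right (dvd_mul_left _ _)
      have c1 : IsCoprime R (q ^ 2 + 108 * R ^ 2) := by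
        have : IsCoprime R (q ^ 2 + R * (108 * R)) := (hqR'.symm.pow_right (n := 2)).add_mul_left_right _
        convert this using 1; ring
      obtain ⟨⟨m, hm⟩, ⟨f, hf⟩⟩ := Int.eq_pow_of_mul_eq_pow_odd c1 (by decide) e2
      have hqo : Odd q := by rw [← Int.not_even_iff_odd, even_iff_two_dvd]; exact hq2
      have hfo : Odd f := by
        have : Odd (f ^ 3) := by
          rw [← hf]; exact (hqo.pow).add_even ⟨54 * R ^ 2, by ring⟩
        exact (Int.odd_pow' (by norm_num)).1 this
      have c2 : IsCoprime (2 * q) f := by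
        refine IsCoprime.mul_left ?_ ?_
        · exact (Int.isCoprime_two_right.2 hfo).symm
        · have : IsCoprime q (f ^ 3) := by
            rw [← hf]
            have : IsCoprime q (108 * R ^ 2 + q * q) := by
              refine IsCoprime.add_mul_left_right ?_ q
              exact (hqR.pow_right (n := 2)).of_isCoprime_of_dvd_right ⟨3, by ring⟩
            convert this using 1; ring
          exact (IsCoprime.pow_right_iff (by norm_num)).1 this
      obtain ⟨k, l, hk, hl⟩ := eis_cube (q := q) (p := 6 * R) (f := f) c2 (by rw [← hf]; ring) hfo
      have ckl : IsCoprime k l := by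
        have h1 : IsCoprime q l := hqR.of_isCoprime_of_dvd_right (by
          have : l ∣ 6 * R := ⟨3 * k ^ 2 - 3 * l ^ 2, by rw [hl]; ring⟩
          exact this.trans ⟨3, by ring⟩)
        exact h1.of_isCoprime_of_dvd_left ⟨k ^ 2 - 9 * l ^ 2, by rw [hk]; ring⟩
      have hko : Odd k := by
        have : Odd (k * (k ^ 2 - 9 * l ^ 2)) := by
          have : k * (k ^ 2 - 9 * l ^ 2) = q := by rw [hk]; ring
          rw [this]; exact hqo
        exact (Int.odd_mul.1 this).1
      have hle : Even l := by
        have : Odd (k * (k ^ 2 - 9 * l ^ 2)) := by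
          have : k * (k ^ 2 - 9 * l ^ 2) = q := by rw [hk]; ring
          rw [this]; exact hqo
        have := (Int.odd_mul.1 this).2
        by_contra hlo
        rw [Int.not_even_iff_odd] at hlo
        have h1 : Even (k ^ 2 - 9 * l ^ 2) := hko.pow.sub_odd ((by decide : Odd (9 : ℤ)).mul hlo.pow)
        exact Int.not_even_iff_odd.2 this h1
      obtain ⟨l', hl'⟩ := hle
      have e3 : l' * ((k + l) * (k - l)) = m ^ 3 := by
        have : 6 * m ^ 3 = 3 * k ^ 2 * l - 3 * l ^ 3 := by rw [← hl, hm]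
        rw [hl'] at this ⊢; linarith
      have ckl' : IsCoprime k l' := ckl.of_isCoprime_of_dvd_right ⟨2, by rw [hl']; ring⟩
      have c3 : IsCoprime l' (k + l) := by
        have : IsCoprime l' (k + l' * 2) := ckl'.symm.add_mul_left_right 2
        convert this using 1; rw [hl']; ring
      have c4 : IsCoprime l' (k - l) := by
        have : IsCoprime l' (k + l' * (-2)) := ckl'.symm.add_mul_left_right (-2)
        convert this using 1; rw [hl']; ring
      have c5 : IsCoprime (k + l) (k - l) := by
        have h1 : IsCoprime (k + l) 2 := Int.isCoprime_two_right.2 (hko.add_even ⟨l', hl'⟩)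
        have h2 : IsCoprime (k + l) l := by
          have : IsCoprime (k + l * 1) l := IsCoprime.add_mul_left_left ckl 1
          convert this using 1; ring
        have h3 : IsCoprime (k + l) (-(2 * l)) := (h1.mul_right h2).neg_right
        have : IsCoprime (k + l) (-(2 * l) + (k + l) * 1) := h3.add_mul_left_right 1
        convert this using 1; ring
      obtain ⟨⟨A, hA⟩, ⟨E, hE⟩⟩ := Int.eq_pow_of_mul_eq_pow_odd (c3.mul_right c4) (by decide) e3
      obtain ⟨⟨B, hB⟩, ⟨D, hD⟩⟩ := Int.eq_pow_of_mul_eq_pow_odd c5 (by decide) hE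
      have hBo : Odd B := by
        have : Odd (B ^ 3) := by rw [← hB]; exact hko.add_even ⟨l', hl'⟩
        exact (Int.odd_pow' (by norm_num)).1 this
      have hDo : Odd D := by
        have : Odd (D ^ 3) := by rw [← hD]; exact hko.sub_even ⟨l', hl'⟩
        exact (Int.odd_pow' (by norm_num)).1 this
      obtain ⟨P', hP'⟩ := hBo.sub_odd hDo
      obtain ⟨Q', hQ'⟩ := hBo.add_odd hDo
      have hcm : c = (3 * B * D * f) * A := by
        have h1 : C ^ 3 = (m * f) ^ 3 := by rw [← e2, hf, hm]; ring
        have h2 : m ^ 3 = (A * (B * D)) ^ 3 := by rw [← e3, hA, hB, hD]; ring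
        have o3 : Odd 3 := by decide
        rw [hC, (o3.strictMono_pow (R := ℤ)).injective h1, (o3.strictMono_pow (R := ℤ)).injective h2]; ring
      have hA0 : A ≠ 0 := by rintro rfl; simp at hcm; exact hc hcm
      have hlt := natAbs_lt_of_mul hcm hc (by
        have : (3 * B * D * f) ≠ 0 := by intro h; rw [h] at hcm; simp at hcm; exact hc hcm
        have h3 : (3 : ℤ) ∣ 3 * B * D * f := ⟨B * D * f, by ring⟩
        omega)
      refine ih P' Q' A (by omega) hA0 ?_
      have hl2 : B ^ 3 - D ^ 3 = 4 * A ^ 3 := by rw [← hB, ← hD, ← hA, hl']; ring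
      have hB' : B = P' + Q' := by omega
      have hD' : D = Q' - P' := by omega
      rw [hB', hD'] at hl2
      linarith

theorem lem_a {u y : ℚ} (h : y ^ 2 = - (u ^ 3 + 108)) : False := by
  have hu : u ≠ 0 := by rintro rfl; nlinarith [sq_nonneg y]
  obtain ⟨m, n, -, hn0, rfl⟩ := rat_frac u
  obtain ⟨m', n', -, hn0', rfl⟩ := rat_frac y
  have hn : (n : ℚ) ≠ 0 := by exact_mod_cast hn0.ne'
  have hn' : (n' : ℚ) ≠ 0 := by exact_mod_cast hn0'.ne'
  have hm : m ≠ 0 := by rintro rfl; simp at hu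
  refine a_int _ (18 * n * n') (m' * n) (-3 * m * n') le_rfl (by simp [hm, hn0'.ne']) ?_
  have : (m' : ℚ) ^ 2 * n ^ 3 = - (m ^ 3 + 108 * n ^ 3) * n' ^ 2 := by
    field_simp at h; linarith
  have h2 : m' ^ 2 * n ^ 3 = - (m ^ 3 + 108 * n ^ 3) * n' ^ 2 := by exact_mod_cast this
  linear_combination 54 * n' * h2
end P4

open Polynomial
namespace P4

lemma b_mod32 : ∀ a b : ZMod 32, 16 * a ≠ 0 → 16 * b ≠ 0 → ∀ v : ZMod 32,
    2 * (a ^ 4 - 6 * a ^ 2 * b ^ 2 - b ^ 4) ≠ v ^ 2 ∧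
    2 * (-(a ^ 4 + 6 * a ^ 2 * b ^ 2 - b ^ 4)) ≠ v ^ 2 := by decide +kernel
lemma b_mod5 : ∀ a b : ZMod 5, a ^ 4 + b ^ 4 = 0 → a = 0 ∧ b = 0 := by decide +kernel

lemma b_aux {m n y : ℤ} (hmn : IsCoprime m n) (hm : m ≠ 0) (hn : 0 < n)
    (h : m * n * fA m n * fB m n = y ^ 2) : False := by
  have c1 : IsCoprime m (n * fA m n * fB m n) := by
    refine IsCoprime.mul_right (IsCoprime.mul_right hmn ?_) ?_
    · have : IsCoprime m (n ^ 2 + m * m) := (hmn.pow_right (n := 2)).add_mul_left_right m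
      convert this using 1; simp only [fA]; ring
    · have : IsCoprime m (-n ^ 2 + m * (m - 6 * n)) :=
        ((hmn.pow_right (n := 2)).neg_right).add_mul_left_right (m - 6 * n)
      convert this using 1; simp only [fB]; ring
  have c2 : IsCoprime n (m * fA m n * fB m n) := by
    refine IsCoprime.mul_right (IsCoprime.mul_right hmn.symm ?_) ?_
    · have : IsCoprime n (m ^ 2 + n * n) := (hmn.symm.pow_right (n := 2)).add_mul_left_right n
      convert this using 1; simp only [fA]; ring
    · have : IsCoprime n (m ^ 2 + n * (-6 * m - n)) :=
        ((hmn.symm.pow_right (n := 2))).add_mul_left_right (-6 * m - n)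
      convert this using 1; simp only [fB]; ring
  obtain ⟨a, ha⟩ := Int.sq_of_isCoprime c1 (c := y) (by rw [← h]; ring)
  obtain ⟨b, hb⟩ := Int.sq_of_isCoprime c2 (c := y) (by rw [← h]; ring)
  have hb : n = b ^ 2 := by
    rcases hb with hb | hb
    · exact hb
    · nlinarith [sq_nonneg b]
  have hA : 0 < fA m n := by
    simp only [fA]; nlinarith [sq_nonneg m]
  obtain ⟨α, d, hα, hα0, hd0, hαs⟩ := sqf_decomp hA
  obtain ⟨ε, hε, hm'⟩ : ∃ ε : ℤ, (ε = 1 ∨ ε = -1) ∧ m = ε * a ^ 2 := by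
    rcases ha with ha | ha
    · exact ⟨1, Or.inl rfl, by rw [ha]; ring⟩
    · exact ⟨-1, Or.inr rfl, by rw [ha]; ring⟩
  have hε2 : ε ^ 2 = 1 := by rcases hε with rfl | rfl <;> norm_num
  have ha0 : a ≠ 0 := by rintro rfl; simp at hm'; exact hm hm'
  have hb0 : b ≠ 0 := by rintro rfl; simp at hb; omega
  have hab0 : a * b ≠ 0 := mul_ne_zero ha0 hb0
  have hd : (a * b) ^ 2 ∣ y ^ 2 := ⟨ε * fA m n * fB m n, by rw [← h]; nth_rw 1 [hm', hb]; ring⟩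
  rw [Int.pow_dvd_pow_iff two_ne_zero] at hd
  obtain ⟨w, rfl⟩ := hd
  have h2 : fA m n * (ε * fB m n) = w ^ 2 := by
    apply mul_left_cancel₀ (pow_ne_zero 2 hab0)
    rw [← mul_pow, ← h]
    linear_combination (-(fA m n * fB m n * n)) * hm' - (ε * a ^ 2 * fA m n * fB m n) * hb
  have hα' : α ∣ 10 := sqf_dvd hαs (by norm_num) fun p hp hpα => by
    have hpZ := Nat.prime_iff_prime_int.1 hp
    have h1 : (p : ℤ) ∣ ε * fB m n := sqf_prime hα hd0 hαs h2 hp hpα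
    have h0 : (p : ℤ) ∣ fA m n := by
      rw [hα]; exact (Int.natCast_dvd_natCast.2 hpα).mul_right _
    have h1' : (p : ℤ) ∣ fB m n := by
      have : fB m n = ε * (ε * fB m n) := by linear_combination (- fB m n) * hε2
      rw [this]; exact h1.mul_left _
    exact_mod_cast gAB hpZ hmn h0 h1'
  have hd : (d : ℤ) ^ 2 ∣ w ^ 2 := ⟨α * (ε * fB m n), by rw [← h2, hα]; ring⟩
  rw [Int.pow_dvd_pow_iff two_ne_zero] at hd
  obtain ⟨v, rfl⟩ := hd
  have hdZ : (d : ℤ) ≠ 0 := by positivity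
  have h3 : (α : ℤ) * (ε * fB m n) = v ^ 2 := by
    apply mul_left_cancel₀ (pow_ne_zero 2 hdZ)
    rw [← mul_pow, ← h2, hα]; ring
  have h4 : a ^ 4 + b ^ 4 = α * d ^ 2 := by
    rw [← hα, fA, hb, hm']; linear_combination (- a ^ 4) * hε2
  have cab : IsCoprime a b := by
    have : IsCoprime (a ^ 2) (b ^ 2) := by
      rw [← hb]; exact hmn.of_isCoprime_of_dvd_left ⟨ε, by rw [hm']; ring⟩
    exact (IsCoprime.pow_iff (by norm_num) (by norm_num)).1 this
  have case5 : (5 : ℤ) ∣ α → False := by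
    intro h5
    have : (5 : ℤ) ∣ a ^ 4 + b ^ 4 := by rw [h4]; exact h5.mul_right _
    have h6 : ((a ^ 4 + b ^ 4 : ℤ) : ZMod 5) = 0 := by
      rw [ZMod.intCast_zmod_eq_zero_iff_dvd]; exact this
    push_cast at h6
    obtain ⟨h7, h8⟩ := b_mod5 _ _ h6
    rw [ZMod.intCast_zmod_eq_zero_iff_dvd] at h7 h8
    exact not_both (p := 5) (Nat.prime_iff_prime_int.1 (by norm_num)) cab h7 h8
  have hα4 : α = 1 ∨ α = 2 ∨ α = 5 ∨ α = 10 := by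
    have : α ∈ Nat.divisors 10 := Nat.mem_divisors.2 ⟨hα', by norm_num⟩
    have h10 : Nat.divisors 10 = {1, 2, 5, 10} := by decide
    rw [h10] at this; simpa using this
  rcases hα4 with rfl | rfl | rfl | rfl
  · exact not_fermat_42 ha0 hb0 (c := d) (by rw [h4]; push_cast; ring)
  · have hpar : Even (a ^ 4 + b ^ 4) := by rw [h4]; push_cast; exact (even_two.mul_right _)
    have hboth : ¬ (2 : ℤ) ∣ a ∧ ¬ (2 : ℤ) ∣ b := by
      have h5 : Even a ↔ Even b := by
        have := Int.even_add.1 hpar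
        simpa [Int.even_pow] using this
      rw [← even_iff_two_dvd, ← even_iff_two_dvd]
      constructor
      · intro h; exact not_both Int.prime_two cab h.two_dvd (h5.1 h).two_dvd
      · intro h; exact not_both Int.prime_two cab (h5.2 h).two_dvd h.two_dvd
    have n1 : 16 * (a : ZMod 32) ≠ 0 := by
      intro h
      have h' : ((16 * a : ℤ) : ZMod 32) = 0 := by push_cast; exact h
      rw [ZMod.intCast_zmod_eq_zero_iff_dvd] at h'
      omega
    have n2 : 16 * (b : ZMod 32) ≠ 0 := by
      intro h
      have h' : ((16 * b : ℤ) : ZMod 32) = 0 := by push_cast; exact h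
      rw [ZMod.intCast_zmod_eq_zero_iff_dvd] at h'
      omega
    have h5 := congrArg (Int.cast : ℤ → ZMod 32) h3
    rcases hε with rfl | rfl
    · apply (b_mod32 a b n1 n2 v).1
      rw [hb, hm'] at h5; simp only [fB] at h5; push_cast at h5; rw [← h5]; ring
    · apply (b_mod32 a b n1 n2 v).2
      rw [hb, hm'] at h5; simp only [fB] at h5; push_cast at h5; rw [← h5]; ring
  · exact case5 (by norm_num)
  · exact case5 (by norm_num)

theorem lem_b {s y : ℚ} (hs : s ≠ 0) (h : y ^ 2 = s * (s ^ 2 + 1) * (s ^ 2 - 6 * s - 1)) : False := by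
  obtain ⟨m, n, hcop, hn0, rfl⟩ := rat_frac s
  have hn : (n : ℚ) ≠ 0 := by exact_mod_cast hn0.ne'
  have hm0 : m ≠ 0 := by rintro rfl; simp at hs
  have h1 : (y * n ^ 3) ^ 2 = ((m * n * fA m n * fB m n : ℤ) : ℚ) := by
    rw [mul_pow, h]; simp only [fA, fB]; push_cast; field_simp
  obtain ⟨z, hz⟩ := int_of_sq h1
  exact b_aux hcop hm0 hn0 hz
end P4

open Polynomial
namespace P4

lemma odd_sq_mod {r : ℤ} (h : Odd r) : ∃ t, r ^ 2 = 4 * t + 1 := by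
  obtain ⟨k, rfl⟩ := h; exact ⟨k ^ 2 + k, by ring⟩

lemma e20_core {r s A : ℤ} (hrs : IsCoprime r s) (hs : s ≠ 0)
    (h : (r ^ 2 - s ^ 2) ^ 2 + (2 * s ^ 2) ^ 2 = A ^ 2) :
    ∃ k l : ℤ, s ^ 2 = (k * l) ^ 2 ∧ IsCoprime k l ∧ r ^ 2 = k ^ 4 + k ^ 2 * l ^ 2 - l ^ 4 := by
  have hA0 : A ≠ 0 := by
    rintro rfl
    have : 0 < (2 * s ^ 2) ^ 2 := by positivity
    nlinarith [sq_nonneg (r ^ 2 - s ^ 2)]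
  have hs2 : 0 < s ^ 2 := by positivity
  by_cases hpar : Odd (r ^ 2 - s ^ 2)
  · have hp : PythagoreanTriple (r ^ 2 - s ^ 2) (2 * s ^ 2) |A| := by
      unfold PythagoreanTriple; rw [abs_mul_abs_self]; linarith
    have hg : Int.gcd (r ^ 2 - s ^ 2) (2 * s ^ 2) = 1 := by
      rw [← Int.isCoprime_iff_gcd_eq_one]
      refine IsCoprime.mul_right (Int.isCoprime_two_right.2 hpar) ?_
      have : IsCoprime (r ^ 2 + s ^ 2 * (-1)) (s ^ 2) := (hrs.pow (m := 2) (n := 2)).add_mul_left_left _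
      convert this using 1; ring
    obtain ⟨i, j, h1, h2, -, h4, h5, h6⟩ := hp.coprime_classification' hg (Int.odd_iff.1 hpar)
      (abs_pos.2 hA0)
    have h7 : i * j = s ^ 2 := by linarith
    have cij := Int.isCoprime_iff_gcd_eq_one.2 h4
    have hi : 0 < i := lt_of_le_of_ne h6 (fun h => by rw [← h] at h7; simp at h7; omega)
    have hj : 0 < j := by nlinarith
    obtain ⟨k, hk⟩ := Int.sq_of_isCoprime cij h7
    obtain ⟨l, hl⟩ := Int.sq_of_isCoprime cij.symm (by rw [mul_comm]; exact h7)
    have hk : i = k ^ 2 := by rcases hk with hk | hk; exact hk; nlinarith [sq_nonneg k]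
    have hl : j = l ^ 2 := by rcases hl with hl | hl; exact hl; nlinarith [sq_nonneg l]
    rw [hk, hl] at cij h7 h1
    exact ⟨k, l, by rw [← h7]; ring, (IsCoprime.pow_iff (by norm_num) (by norm_num)).1 cij, by
      linarith⟩
  · have hso : Odd s := by
      by_contra hse
      rw [Int.not_odd_iff_even] at hse hpar
      have hre : Even r := by
        have := Int.even_sub.1 hpar
        simp [Int.even_pow] at this
        exact this.2 hse
      exact not_both Int.prime_two hrs hre.two_dvd hse.two_dvd
    obtain ⟨Y, hY⟩ := Int.not_odd_iff_even.1 hpar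
    have hAe : Even A := by
      have : Even (A ^ 2) := by rw [← h, hY]; exact ⟨2 * Y ^ 2 + 2 * s ^ 4, by ring⟩
      exact (Int.even_pow.1 this).1
    obtain ⟨B, hB⟩ := hAe
    have hp : PythagoreanTriple (s ^ 2) Y |B| := by
      unfold PythagoreanTriple; rw [abs_mul_abs_self]
      rw [hB, hY] at h; linarith
    have hg : Int.gcd (s ^ 2) Y = 1 := by
      rw [← Int.isCoprime_iff_gcd_eq_one]
      have h1 : IsCoprime (s ^ 2) (2 * Y) := by
        have : IsCoprime (s ^ 2) (r ^ 2 + s ^ 2 * (-1)) :=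
          (hrs.symm.pow (m := 2) (n := 2)).add_mul_left_right _
        convert this using 1; linarith
      exact h1.of_isCoprime_of_dvd_right (dvd_mul_left _ _)
    obtain ⟨i, j, h1, h2, -, h4, h5, h6⟩ := hp.coprime_classification' hg
      (Int.odd_iff.1 hso.pow) (abs_pos.2 (by rintro rfl; exact hA0 (by rw [hB]; ring)))
    have cij := Int.isCoprime_iff_gcd_eq_one.2 h4
    have c5 : IsCoprime (i - j) (i + j) := by
      have h1 : IsCoprime (i - j) 2 := Int.isCoprime_two_right.2 (by rw [Int.odd_iff]; omega)
      have h2 : IsCoprime (i - j) j := by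
        have : IsCoprime (i + j * (-1)) j := IsCoprime.add_mul_left_left cij (-1)
        convert this using 1; ring
      have : IsCoprime (i - j) (2 * j + (i - j) * 1) := (h1.mul_right h2).add_mul_left_right 1
      convert this using 1; ring
    have h7 : (i - j) * (i + j) = s ^ 2 := by rw [h1]; ring
    have hpos : 0 < i - j ∧ 0 < i + j := by
      rcases pos_and_pos_or_neg_and_neg_of_mul_pos (show 0 < (i - j) * (i + j) by rw [h7]; exact hs2) with h | h
      · exact h
      · omega
    obtain ⟨l, hl⟩ := Int.sq_of_isCoprime c5 h7
    obtain ⟨k, hk⟩ := Int.sq_of_isCoprime c5.symm (by rw [mul_comm]; exact h7)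
    have hk : i + j = k ^ 2 := by rcases hk with hk | hk; exact hk; nlinarith [sq_nonneg k]
    have hl : i - j = l ^ 2 := by rcases hl with hl | hl; exact hl; nlinarith [sq_nonneg l]
    rw [hk, hl] at c5 h7
    refine ⟨k, l, by rw [← h7]; ring, ((IsCoprime.pow_iff (by norm_num) (by norm_num)).1 c5).symm, ?_⟩
    have h8 : 4 * (i * j) = (k ^ 2) ^ 2 - (l ^ 2) ^ 2 := by rw [← hk, ← hl]; ring
    have h9 : r ^ 2 = s ^ 2 + 4 * (i * j) := by rw [h2] at hY; linarith
    rw [h9, h8, ← h7]; ring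

lemma pow4_of {f g e : ℤ} (hf : 0 < f) (hfg : IsCoprime f g) (h : f * g = e ^ 4) : ∃ r, f = r ^ 4 := by
  obtain ⟨d, hd⟩ := exists_associated_pow_of_mul_eq_pow' hfg h
  rcases Int.associated_iff.1 hd with h' | h'
  · exact ⟨d, h'.symm⟩
  · exfalso
    have : 0 ≤ d ^ 4 := by positivity
    linarith

/-- coprime splitting of `f g = 5 e ^ 4`. -/
lemma split5 {f g e : ℤ} (hf : 0 < f) (hg : 0 < g) (hfg : IsCoprime f g) (h : f * g = 5 * e ^ 4) :
    ∃ r s : ℤ, IsCoprime r s ∧ (r * s) ^ 4 = e ^ 4 ∧ f + g = r ^ 4 + 5 * s ^ 4 := by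
  have p5 : Prime (5 : ℤ) := Nat.prime_iff_prime_int.1 (by norm_num)
  have aux : ∀ f g : ℤ, 0 < f → 0 < g → IsCoprime f g → f * g = 5 * e ^ 4 → (5 : ℤ) ∣ g →
      ∃ r s : ℤ, IsCoprime r s ∧ (r * s) ^ 4 = e ^ 4 ∧ f + g = r ^ 4 + 5 * s ^ 4 := by
    intro f g hf hg hfg h h5
    obtain ⟨g0, rfl⟩ := h5
    have h1 : f * g0 = e ^ 4 := by linarith
    have c : IsCoprime f g0 := hfg.of_isCoprime_of_dvd_right (dvd_mul_left _ _)
    obtain ⟨r, hr⟩ := pow4_of hf c h1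
    obtain ⟨s, hs⟩ := pow4_of (by linarith) c.symm (by rw [mul_comm]; exact h1)
    rw [hr, hs] at c
    exact ⟨r, s, (IsCoprime.pow_iff (by norm_num) (by norm_num)).1 c, by
      rw [← h1, hr, hs]; ring, by rw [hr, hs]⟩
  rcases p5.dvd_or_dvd (show (5 : ℤ) ∣ f * g by rw [h]; exact dvd_mul_right _ _) with h5 | h5
  · obtain ⟨r, s, h1, h2, h3⟩ := aux g f hg hf hfg.symm (by rw [mul_comm]; exact h) h5
    exact ⟨r, s, h1, h2, by rw [← h3]; ring⟩
  · exact aux f g hf hg hfg h h5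

lemma cop5 {f g e : ℤ} (h : f * g = 5 * e ^ 4) (hp : ∀ p : ℤ, Prime p → p ∣ f → p ∣ g → p ∣ e → False) :
    IsCoprime f g := by
  by_contra hcop
  have : Int.gcd f g ≠ 1 := fun h => hcop (Int.isCoprime_iff_gcd_eq_one.2 h)
  obtain ⟨l, hl, hlg⟩ := Nat.exists_prime_and_dvd this
  have hlZ := Nat.prime_iff_prime_int.1 hl
  have hlp : (l : ℤ) ∣ f := (Int.natCast_dvd_natCast.2 hlg).trans (Int.gcd_dvd_left _ _)
  have hlq : (l : ℤ) ∣ g := (Int.natCast_dvd_natCast.2 hlg).trans (Int.gcd_dvd_right _ _)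
  refine hp l hlZ hlp hlq ?_
  have h2 : (l : ℤ) * l ∣ 5 * e ^ 4 := by rw [← h]; exact mul_dvd_mul hlp hlq
  by_cases h5 : l = 5
  · subst h5
    obtain ⟨w, hw⟩ := h2
    exact hlZ.dvd_of_dvd_pow (n := 4) ⟨w, by push_cast at hw ⊢; linarith⟩
  · rcases hlZ.dvd_or_dvd ((dvd_mul_left _ _).trans h2) with h' | h'
    · exfalso; apply h5
      have : l ∣ 5 := by exact_mod_cast h'
      exact (Nat.prime_dvd_prime_iff_eq hl (by norm_num)).1 this
    · exact hlZ.dvd_of_dvd_pow h'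

lemma sq_one_of {k b : ℤ} (hk : k ≠ 0) (h : k ^ 4 + k ^ 2 - 1 = b ^ 2) : k ^ 2 = 1 := by
  by_contra hne
  have h1 : 0 < k ^ 2 := by positivity
  have h2 : 1 < k ^ 2 := by omega
  have h3 : (k ^ 2) ^ 2 < |b| ^ 2 := by rw [sq_abs]; nlinarith
  have h4 : |b| ^ 2 < (k ^ 2 + 1) ^ 2 := by rw [sq_abs]; nlinarith
  have h5 := lt_of_pow_lt_pow_left₀ 2 (abs_nonneg b) h3
  have h6 := lt_of_pow_lt_pow_left₀ 2 (by positivity) h4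
  omega

set_option maxHeartbeats 1000000 in
lemma e20 : ∀ N : ℕ, ∀ a e b : ℤ, e.natAbs ≤ N → e ≠ 0 → IsCoprime a e →
    a ^ 4 + a ^ 2 * e ^ 2 - e ^ 4 = b ^ 2 → e ^ 2 = 1 := by
  intro N
  induction N with
  | zero => intro a e b h1 h2; omega
  | succ N ih =>
    intro a e b hN he hae h
    have e2pos : 0 < e ^ 2 := by positivity
    have e4pos : 0 < e ^ 4 := by positivity
    -- finishing step
    have fin : ∀ r s A c : ℤ, 1 ≤ c → e ^ 4 = c * (r * s) ^ 4 → IsCoprime r s →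
        (r ^ 2 - s ^ 2) ^ 2 + (2 * s ^ 2) ^ 2 = A ^ 2 → r ^ 2 = 1 ∧ s ^ 2 = 1 := by
      intro r s A c hc hec hrs hA
      have hs0 : s ≠ 0 := by rintro rfl; simp at hec; exact he hec
      have hr0 : r ≠ 0 := by rintro rfl; simp at hec; exact he hec
      obtain ⟨k, l, h1, h2, h3⟩ := e20_core hrs hs0 hA
      have hk0 : k ≠ 0 := by rintro rfl; simp at h1; exact hs0 h1
      have hl0 : l ≠ 0 := by rintro rfl; simp at h1; exact hs0 h1
      have hl1 : l ^ 2 = 1 := by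
        by_cases hle : l.natAbs < e.natAbs
        · exact ih k l r (by omega) hl0 h2 h3.symm
        · push Not at hle
          have : e ^ 2 ≤ l ^ 2 := by rw [← Int.natAbs_sq e, ← Int.natAbs_sq l]; gcongr
          have h4 : e ^ 4 ≤ l ^ 4 := by nlinarith
          have h5 : (r * s) ^ 4 = (r ^ 4 * k ^ 4) * l ^ 4 := by
            have : s ^ 4 = (k * l) ^ 4 := by
              calc s ^ 4 = (s ^ 2) ^ 2 := by ring
                _ = _ := by rw [h1]; ring
            rw [mul_pow, this]; ring
          have hl4 : 0 < l ^ 4 := by positivity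
          have hr4 : 0 < r ^ 4 := by positivity
          have hk4 : 0 < k ^ 4 := by positivity
          rw [h5] at hec
          have h6 : r ^ 4 * k ^ 4 ≤ 1 := by
            by_contra h7
            push Not at h7
            have q1 : 1 * l ^ 4 < (r ^ 4 * k ^ 4) * l ^ 4 := mul_lt_mul_of_pos_right h7 hl4
            have q2 : 1 * ((r ^ 4 * k ^ 4) * l ^ 4) ≤ c * ((r ^ 4 * k ^ 4) * l ^ 4) :=
              mul_le_mul_of_nonneg_right hc (by positivity)
            linarith
          have h7 : r ^ 4 = 1 := by nlinarith
          have h8 : k ^ 4 = 1 := by nlinarith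
          have hr2 : r ^ 2 = 1 := by nlinarith [sq_nonneg r]
          have hk2 : k ^ 2 = 1 := by nlinarith [sq_nonneg k]
          rw [hr2, h8, hk2] at h3
          have hl2 : 0 < l ^ 2 := by positivity
          nlinarith
      have hl4 : l ^ 4 = 1 := by
        calc l ^ 4 = (l ^ 2) ^ 2 := by ring
          _ = 1 := by rw [hl1]; norm_num
      rw [hl1, hl4] at h3
      have hk1 := sq_one_of hk0 (b := r) (by rw [h3]; ring)
      have hk4 : k ^ 4 = 1 := by
        calc k ^ 4 = (k ^ 2) ^ 2 := by ring
          _ = 1 := by rw [hk1]; norm_num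
      refine ⟨by rw [h3, hk4, hk1]; norm_num, by rw [h1, mul_pow, hk1, hl1]; norm_num⟩
    have key : (2 * a ^ 2 + e ^ 2 - 2 * b) * (2 * a ^ 2 + e ^ 2 + 2 * b) = 5 * e ^ 4 := by
      linear_combination 4 * h
    have hpos : 0 < 2 * a ^ 2 + e ^ 2 - 2 * b ∧ 0 < 2 * a ^ 2 + e ^ 2 + 2 * b := by
      rcases pos_and_pos_or_neg_and_neg_of_mul_pos
        (show 0 < (2 * a ^ 2 + e ^ 2 - 2 * b) * (2 * a ^ 2 + e ^ 2 + 2 * b) by rw [key]; linarith) with h | h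
      · exact h
      · nlinarith [sq_nonneg a]
    rcases Int.even_or_odd e with hev | hod
    · exfalso
      obtain ⟨e', he'⟩ := hev
      have hao : Odd a := by
        by_contra h'
        rw [Int.not_odd_iff_even] at h'
        exact not_both Int.prime_two hae h'.two_dvd ⟨e', by linarith⟩
      have hbo : Odd b := by
        have : Odd (b ^ 2) := by
          rw [← h, he']
          have : Odd (a ^ 4) := hao.pow
          have h2 : a ^ 4 + a ^ 2 * (e' + e') ^ 2 - (e' + e') ^ 4 = a ^ 4 + 2 * (2 * a ^ 2 * e' ^ 2 - 8 * e' ^ 4) := by ring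
          rw [h2]; exact this.add_even (even_two_mul _)
        exact (Int.odd_pow' (by norm_num)).1 this
      obtain ⟨t, ht⟩ := odd_sq_mod hao
      obtain ⟨j, hj⟩ := hbo
      -- 2a² + e² ∓ 2b
      obtain ⟨f, hf⟩ : (4 : ℤ) ∣ 2 * a ^ 2 + e ^ 2 - 2 * b := ⟨2 * t + e' ^ 2 - j, by
        rw [ht, he', hj]; ring⟩
      obtain ⟨g, hg⟩ : (4 : ℤ) ∣ 2 * a ^ 2 + e ^ 2 + 2 * b := ⟨2 * t + e' ^ 2 + j + 1, by
        rw [ht, he', hj]; ring⟩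
      have hsum : f + g = a ^ 2 + 2 * e' ^ 2 := by rw [he'] at hf hg; linarith
      rw [hf, hg] at key hpos
      have key' : f * g = 5 * e' ^ 4 := by rw [he'] at key; linarith
      have hcop : IsCoprime f g := cop5 key' (by
        intro p hp h1 h2 h3
        have : p ∣ a ^ 2 := by
          have : a ^ 2 = f + g - 2 * e' * e' := by rw [hsum]; ring
          rw [this]; exact dvd_sub (dvd_add h1 h2) (h3.mul_left _)
        exact not_both hp hae (hp.dvd_of_dvd_pow this) (h3.trans ⟨2, by linarith⟩))
      obtain ⟨r, s, h1, h2, h3⟩ := split5 (by linarith [hpos.1]) (by linarith [hpos.2]) hcop key'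
      have h4 : e' ^ 2 = (r * s) ^ 2 := by
        have h5 : (e' ^ 2) ^ 2 = ((r * s) ^ 2) ^ 2 := by linear_combination (-1 : ℤ) * h2
        exact (pow_left_inj₀ (by positivity) (by positivity) two_ne_zero).1 h5
      obtain ⟨h5, h6⟩ := fin r s a 16 (by norm_num) (by rw [h2, he']; ring) h1 (by
        rw [h3, h4] at hsum; linear_combination hsum)
      have : a ^ 2 = 4 := by
        rw [h3, h4] at hsum
        have h7 : r ^ 4 = 1 := by
          calc r ^ 4 = (r ^ 2) ^ 2 := by ring
            _ = 1 := by rw [h5]; norm_num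
        have h8 : s ^ 4 = 1 := by
          calc s ^ 4 = (s ^ 2) ^ 2 := by ring
            _ = 1 := by rw [h6]; norm_num
        rw [h7, h8, mul_pow, h5, h6] at hsum; linarith
      omega
    · have hcop : IsCoprime (2 * a ^ 2 + e ^ 2 - 2 * b) (2 * a ^ 2 + e ^ 2 + 2 * b) := cop5 key (by
        intro p hp h1 h2 h3
        have : p ∣ 2 ^ 2 * a ^ 2 := by
          have : 2 ^ 2 * a ^ 2 = (2 * a ^ 2 + e ^ 2 - 2 * b) + (2 * a ^ 2 + e ^ 2 + 2 * b) - 2 * e * e := by ring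
          rw [this]; exact dvd_sub (dvd_add h1 h2) (h3.mul_left _)
        rcases hp.dvd_or_dvd this with h' | h'
        · have h2' := hp.dvd_of_dvd_pow h'
          have c : IsCoprime (2 : ℤ) e := Int.isCoprime_two_left.2 hod
          exact not_both hp c h2' h3
        · exact not_both hp hae (hp.dvd_of_dvd_pow h') h3)
      obtain ⟨r, s, h1, h2, h3⟩ := split5 hpos.1 hpos.2 hcop key
      have h4 : e ^ 2 = (r * s) ^ 2 := by
        have h5 : (e ^ 2) ^ 2 = ((r * s) ^ 2) ^ 2 := by linear_combination (-1 : ℤ) * h2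
        exact (pow_left_inj₀ (by positivity) (by positivity) two_ne_zero).1 h5
      obtain ⟨h5, h6⟩ := fin r s (2 * a) 1 (by norm_num) (by rw [h2]; ring) h1 (by
        have h3' : 4 * a ^ 2 + 2 * e ^ 2 = r ^ 4 + 5 * s ^ 4 := by linarith
        rw [h4] at h3'; linear_combination (-1 : ℤ) * h3')
      rw [h4, mul_pow, h5, h6]; norm_num

theorem e20Q {x y : ℚ} (h : y ^ 2 = x * (x ^ 2 + x - 1)) : x = 0 ∨ x = 1 ∨ x = -1 := by
  by_cases hx : x = 0
  · exact Or.inl hx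
  right
  obtain ⟨m, n, hcop, hn0, rfl⟩ := rat_frac x
  have hn : (n : ℚ) ≠ 0 := by exact_mod_cast hn0.ne'
  have hm0 : m ≠ 0 := by rintro rfl; simp at hx
  have h1 : (y * n ^ 2) ^ 2 = ((m * (n * (m ^ 2 + m * n - n ^ 2)) : ℤ) : ℚ) := by
    rw [mul_pow, h]; push_cast; field_simp
  obtain ⟨z, hz⟩ := int_of_sq h1
  have c1 : IsCoprime m (n * (m ^ 2 + m * n - n ^ 2)) := by
    refine IsCoprime.mul_right hcop ?_
    have : IsCoprime m (-n ^ 2 + m * (m + n)) :=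
      ((hcop.pow_right (n := 2)).neg_right).add_mul_left_right (m + n)
    convert this using 1; ring
  have c2 : IsCoprime n (m * (m ^ 2 + m * n - n ^ 2)) := by
    refine IsCoprime.mul_right hcop.symm ?_
    have : IsCoprime n (m ^ 2 + n * (m - n)) :=
      ((hcop.symm.pow_right (n := 2))).add_mul_left_right (m - n)
    convert this using 1; ring
  obtain ⟨a, ha⟩ := Int.sq_of_isCoprime c1 hz
  obtain ⟨b, hb⟩ := Int.sq_of_isCoprime c2 (c := z) (by rw [← hz]; ring)
  have hb : n = b ^ 2 := by
    rcases hb with hb | hb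
    · exact hb
    · nlinarith [sq_nonneg b]
  have ha0 : a ≠ 0 := by rintro rfl; simp at ha; exact hm0 ha
  have hb0 : b ≠ 0 := by rintro rfl; simp at hb; omega
  have hab : IsCoprime a b := by
    have : IsCoprime (a ^ 2) (b ^ 2) := by
      rw [← hb]
      rcases ha with ha | ha
      · rw [← ha]; exact hcop
      · have : a ^ 2 = - m := by linarith
        rw [this]; exact hcop.neg_left
    exact (IsCoprime.pow_iff (by norm_num) (by norm_num)).1 this
  have hd : (a * b) ^ 2 ∣ z ^ 2 := by
    rw [← hz]
    rcases ha with ha | ha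
    · exact ⟨(m ^ 2 + m * n - n ^ 2), by nth_rw 1 [ha, hb]; ring⟩
    · exact ⟨-(m ^ 2 + m * n - n ^ 2), by nth_rw 1 [ha, hb]; ring⟩
  rw [Int.pow_dvd_pow_iff two_ne_zero] at hd
  obtain ⟨w, rfl⟩ := hd
  have hab0 : a * b ≠ 0 := mul_ne_zero ha0 hb0
  rcases ha with ha | ha
  · left
    have h2 : a ^ 4 + a ^ 2 * b ^ 2 - b ^ 4 = w ^ 2 := by
      apply mul_left_cancel₀ (pow_ne_zero 2 hab0)
      rw [ha, hb] at hz; linear_combination hz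
    have hb1 := e20 _ a b w le_rfl hb0 hab h2
    have hb4 : b ^ 4 = 1 := by
      calc b ^ 4 = (b ^ 2) ^ 2 := by ring
        _ = 1 := by rw [hb1]; norm_num
    rw [hb1, hb4] at h2
    have ha1 := sq_one_of ha0 (b := w) (by linarith)
    rw [ha, hb, ha1, hb1]; norm_num
  · right
    have h2 : b ^ 4 + b ^ 2 * a ^ 2 - a ^ 4 = w ^ 2 := by
      apply mul_left_cancel₀ (pow_ne_zero 2 hab0)
      rw [ha, hb] at hz; linear_combination hz
    have hb1 := e20 _ b a w le_rfl ha0 hab.symm h2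
    have hb4 : a ^ 4 = 1 := by
      calc a ^ 4 = (a ^ 2) ^ 2 := by ring
        _ = 1 := by rw [hb1]; norm_num
    rw [hb1, hb4] at h2
    have ha1 := sq_one_of hb0 (b := w) (by linarith)
    rw [ha, hb, ha1, hb1]; norm_num

/-- Rank zero quartic for the condition on `ψ`. -/
theorem quart_e {φ y : ℚ} (h : y ^ 2 = φ ^ 4 - 2 * φ ^ 2 + 5) : φ ^ 2 = 1 := by
  set t := (y + φ ^ 2 - 1) / 2 with ht
  have h1 : t * ((y - φ ^ 2 + 1) / 2) = 1 := by rw [ht]; linear_combination h / 4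
  have ht0 : t ≠ 0 := left_ne_zero_of_mul_eq_one h1
  have h2 : (t * φ) ^ 2 = t * (t ^ 2 + t - 1) := by
    have : φ ^ 2 = 1 + t - (y - φ ^ 2 + 1) / 2 := by rw [ht]; ring
    have h3 : t * φ ^ 2 = t + t ^ 2 - 1 := by rw [this]; linear_combination -h1
    linear_combination t * h3
  rcases e20Q h2 with h3 | h3 | h3
  · exact absurd h3 ht0
  · rw [h3] at h2; linarith
  · rw [h3] at h2; linarith

/-- Rank zero quartic for the case `d = 1` of the cubic condition. -/
theorem quart_d {z w : ℚ} (hz : z ≠ 0) (h : w ^ 2 = z ^ 4 + 4 * (z + 1) ^ 2) : z = -1 := by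
  by_contra hz1
  have hz1 : z + 1 ≠ 0 := fun h => hz1 (by linarith)
  set t := (w + z ^ 2) / (2 * (z + 1)) with ht
  have h1 : 2 * (z + 1) * t = w + z ^ 2 := by rw [ht]; field_simp
  have h2 : t ^ 2 * (z + 1) = z ^ 2 * t + (z + 1) := by
    apply mul_left_cancel₀ (mul_ne_zero hz1 (show (4 : ℚ) ≠ 0 by norm_num))
    have : w = 2 * (z + 1) * t - z ^ 2 := by linarith
    rw [this] at h; linear_combination h
  have ht1 : t ≠ 1 := by
    intro h'; rw [h'] at h2; apply hz; exact pow_eq_zero_iff two_ne_zero |>.1 (by linarith)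
  have hm : t - 1 ≠ 0 := sub_ne_zero.2 ht1
  have h3 : (2 * t * z - (t ^ 2 - 1)) ^ 2 = (t ^ 2 - 1) * (t ^ 2 + 4 * t - 1) := by
    linear_combination (-4 * t) * h2
  have h4 : ((2 * t * z - (t ^ 2 - 1)) / (t - 1) ^ 2) ^ 2 =
      ((t + 1) / (t - 1)) * (((t + 1) / (t - 1)) ^ 2 + (t + 1) / (t - 1) - 1) := by
    rw [div_pow, h3]; field_simp; ring
  rcases e20Q h4 with h5 | h5 | h5
  · have : t = -1 := by
      rw [div_eq_zero_iff] at h5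
      rcases h5 with h5 | h5
      · linarith
      · exact absurd h5 hm
    rw [this] at h2; apply hz; exact pow_eq_zero_iff two_ne_zero |>.1 (by linarith)
  · rw [div_eq_iff hm] at h5; linarith
  · rw [div_eq_iff hm] at h5
    have : t = 0 := by linarith
    rw [this] at h2; apply hz1; linarith
end P4

open Polynomial
namespace P4

theorem lem_e {s ψ : ℚ} (hs : s ≠ 0)
    (h : (ψ - 1) ^ 2 + s * (ψ ^ 2 - 1) ^ 2 - s ^ 2 * (ψ + 1) ^ 2 = 0) : False := by
  have hψ : ψ ^ 2 = 1 := by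
    by_contra hne
    have h1 : ψ ^ 2 - 1 ≠ 0 := sub_ne_zero.2 hne
    apply hne
    apply quart_e (y := (2 * s * (ψ + 1) ^ 2 - (ψ ^ 2 - 1) ^ 2) / (ψ ^ 2 - 1))
    rw [div_pow, div_eq_iff (pow_ne_zero 2 h1)]
    linear_combination (-4 * (ψ + 1) ^ 2) * h
  rcases sq_eq_one_iff.1 hψ with h1 | h1
  · rw [h1] at h; apply hs; exact pow_eq_zero_iff two_ne_zero |>.1 (by linarith)
  · rw [h1] at h; norm_num at h
end P4

open Polynomial
namespace P4

lemma p17 : Prime (17 : ℤ) := Nat.prime_iff_prime_int.1 (by norm_num)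

lemma seventeen_form {X Y : ℤ} (h : (17 : ℤ) ∣ X ^ 2 - 5 * Y ^ 2) : (17 : ℤ) ∣ X ∧ (17 : ℤ) ∣ Y := by
  have key : ∀ x y : ZMod 17, x ^ 2 - 5 * y ^ 2 = 0 → x = 0 ∧ y = 0 := by decide
  have h1 := (ZMod.intCast_zmod_eq_zero_iff_dvd (X ^ 2 - 5 * Y ^ 2) 17).2 h
  push_cast at h1
  obtain ⟨h2, h3⟩ := key _ _ h1
  exact ⟨(ZMod.intCast_zmod_eq_zero_iff_dvd X 17).1 h2, (ZMod.intCast_zmod_eq_zero_iff_dvd Y 17).1 h3⟩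

lemma dvd17 {p : ℕ} (hp : p.Prime) {k : ℕ} (h : (p : ℤ) ∣ 17 ^ k) : p = 17 := by
  have hpZ : Prime (p : ℤ) := Nat.prime_iff_prime_int.1 hp
  have h' := hpZ.dvd_of_dvd_pow h
  have : p ∣ 17 := by exact_mod_cast h'
  exact (Nat.prime_dvd_prime_iff_eq hp (by norm_num)).1 this

lemma sq_or_17 {A B y : ℤ} (hA : 0 < A) (h : A * B = y ^ 2)
    (hp : ∀ p : ℕ, p.Prime → (p : ℤ) ∣ A → (p : ℤ) ∣ B → p = 17) :
    (∃ a : ℤ, 0 < a ∧ A = a ^ 2) ∨ ∃ a : ℤ, 0 < a ∧ A = 17 * a ^ 2 := by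
  obtain ⟨α, a, hα, hα0, ha0, hαs⟩ := sqf_decomp hA
  have hα' : α ∣ 17 := sqf_dvd hαs (by norm_num) fun p hpp hpα => by
    have := hp p hpp (by rw [hα]; exact (Int.natCast_dvd_natCast.2 hpα).mul_right _)
      (sqf_prime hα ha0 hαs h hpp hpα)
    rw [this]
  have ha : (0 : ℤ) < a := by exact_mod_cast ha0
  rcases (Nat.dvd_prime (by norm_num : Nat.Prime 17)).1 hα' with rfl | rfl
  · left; exact ⟨a, ha, by rw [hα]; push_cast; ring⟩
  · right; exact ⟨a, ha, by rw [hα]; push_cast; ring⟩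

/-- points with positive abscissa have square abscissa -/
lemma class17 {x y : ℚ} (h : y ^ 2 = x ^ 3 + 17 * x ^ 2 + (-289) * x) (hx : 0 < x) :
    ∃ ξ : ℚ, ξ ≠ 0 ∧ x = ξ ^ 2 := by
  obtain ⟨m, n, hcop, hn0, rfl⟩ := rat_frac x
  have hn : (0 : ℚ) < n := by exact_mod_cast hn0
  have hm0 : 0 < m := by
    have : (0 : ℚ) < m := by
      rcases div_pos_iff.1 hx with h | h
      · exact h.1
      · linarith [h.2]
    exact_mod_cast this
  have h1 : (y * n ^ 2) ^ 2 = ((m * (n * (m ^ 2 + 17 * m * n - 289 * n ^ 2)) : ℤ) : ℚ) := by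
    rw [mul_pow, h]; push_cast; field_simp; ring
  obtain ⟨z, hz⟩ := int_of_sq h1
  have c2 : IsCoprime n (m * (m ^ 2 + 17 * m * n - 289 * n ^ 2)) := by
    refine IsCoprime.mul_right hcop.symm ?_
    have : IsCoprime n (m ^ 2 + n * (17 * m - 289 * n)) :=
      ((hcop.symm.pow_right (n := 2))).add_mul_left_right _
    convert this using 1; ring
  obtain ⟨b, hb⟩ := Int.sq_of_isCoprime c2 (c := z) (by rw [← hz]; ring)
  have hb : n = b ^ 2 := by
    rcases hb with hb | hb
    · exact hb
    · nlinarith [sq_nonneg b]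
  have hb0 : b ≠ 0 := by rintro rfl; simp at hb; omega
  have hbq : (b : ℚ) ≠ 0 := by exact_mod_cast hb0
  rcases sq_or_17 hm0 hz (by
    intro p hp h1 h2
    have hpZ : Prime (p : ℤ) := Nat.prime_iff_prime_int.1 hp
    have hpn : ¬ (p : ℤ) ∣ n := fun h => not_both hpZ hcop h1 h
    rcases hpZ.dvd_or_dvd h2 with h3 | h3
    · exact absurd h3 hpn
    · have : (p : ℤ) ∣ 17 ^ 2 * n ^ 2 := by
        have e : 17 ^ 2 * n ^ 2 = m * (m + 17 * n) - (m ^ 2 + 17 * m * n - 289 * n ^ 2) := by ring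
        rw [e]; exact dvd_sub (h1.mul_right _) h3
      rcases hpZ.dvd_or_dvd this with h4 | h4
      · exact dvd17 hp h4
      · exact absurd (hpZ.dvd_of_dvd_pow h4) hpn) with ⟨a, ha, e⟩ | ⟨a, ha, e⟩
  · have haq : (a : ℚ) ≠ 0 := by exact_mod_cast ha.ne'
    exact ⟨a / b, div_ne_zero haq hbq, by rw [e, hb]; push_cast; field_simp⟩
  · exfalso
    have hzz : z ^ 2 = (17 * a * b) ^ 2 * (17 * (a ^ 4 + a ^ 2 * b ^ 2 - (b ^ 2) ^ 2)) := by
      rw [← hz, e, hb]; ring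
    have hdv : (17 * a * b) ^ 2 ∣ z ^ 2 := ⟨_, hzz⟩
    rw [Int.pow_dvd_pow_iff two_ne_zero] at hdv
    obtain ⟨t, rfl⟩ := hdv
    have h0 : (17 * a * b) ^ 2 ≠ 0 := pow_ne_zero 2 (mul_ne_zero (by positivity) hb0)
    have ht2 : t ^ 2 = 17 * (a ^ 4 + a ^ 2 * b ^ 2 - (b ^ 2) ^ 2) := by
      apply mul_left_cancel₀ h0
      rw [← hzz]; ring
    obtain ⟨t', rfl⟩ := p17.dvd_of_dvd_pow (Dvd.intro _ ht2.symm)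
    have h17 : (17 : ℤ) ∣ (2 * a ^ 2 + b ^ 2) ^ 2 - 5 * (b ^ 2) ^ 2 := ⟨4 * t' ^ 2, by linarith⟩
    have := (seventeen_form h17).2
    exact not_both p17 hcop (by rw [e]; exact Dvd.intro _ rfl) (by rw [hb]; exact this)
end P4

open Polynomial
namespace P4

lemma frac_pos {ξ : ℚ} (h : ξ ≠ 0) : ∃ a b : ℤ, 0 < a ∧ 0 < b ∧ IsCoprime a b ∧ ξ ^ 2 = ((a : ℚ) / b) ^ 2 := by
  obtain ⟨m, n, hmn, hn, rfl⟩ := rat_frac ξ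
  have hm : m ≠ 0 := by rintro rfl; simp at h
  refine ⟨|m|, n, abs_pos.2 hm, hn, hmn.abs_left, ?_⟩
  rw [div_pow, div_pow]; push_cast; rw [sq_abs]

lemma cop5' {f g e : ℤ} (h : f * g = 5 * e ^ 2) (hp : ∀ p : ℤ, Prime p → p ∣ f → p ∣ g → p ∣ e → False) :
    IsCoprime f g := by
  by_contra hcop
  have : Int.gcd f g ≠ 1 := fun h => hcop (Int.isCoprime_iff_gcd_eq_one.2 h)
  obtain ⟨l, hl, hlg⟩ := Nat.exists_prime_and_dvd this
  have hlZ := Nat.prime_iff_prime_int.1 hl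
  have hlp : (l : ℤ) ∣ f := (Int.natCast_dvd_natCast.2 hlg).trans (Int.gcd_dvd_left _ _)
  have hlq : (l : ℤ) ∣ g := (Int.natCast_dvd_natCast.2 hlg).trans (Int.gcd_dvd_right _ _)
  refine hp l hlZ hlp hlq ?_
  have h1 : (l : ℤ) * l ∣ 5 * e ^ 2 := by rw [← h]; exact mul_dvd_mul hlp hlq
  rcases hlZ.dvd_or_dvd ((Dvd.intro _ rfl).trans h1) with h5 | h5
  · have : l = 5 := by
      have : l ∣ 5 := by exact_mod_cast h5
      exact (Nat.prime_dvd_prime_iff_eq hl (by norm_num)).1 this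
    subst this
    have : (5 : ℤ) ∣ e ^ 2 := by
      push_cast at h1
      exact (mul_dvd_mul_iff_left (by norm_num)).1 h1
    exact hlZ.dvd_of_dvd_pow (by exact_mod_cast this)
  · exact hlZ.dvd_of_dvd_pow h5

lemma split5' {f g e : ℤ} (hf : 0 < f) (hg : 0 < g) (h : f * g = 5 * e ^ 2)
    (hp : ∀ p : ℤ, Prime p → p ∣ f → p ∣ g → p ∣ e → False) :
    (∃ d, f = d ^ 2) ∨ ∃ d, g = d ^ 2 := by
  have hco := cop5' h hp
  have p5 : Prime (5 : ℤ) := Nat.prime_iff_prime_int.1 (by norm_num)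
  have aux : ∀ f g : ℤ, 0 < f → IsCoprime f g → f * g = 5 * e ^ 2 → (5 : ℤ) ∣ g → ∃ d, f = d ^ 2 := by
    intro f g hf hfg h h5
    obtain ⟨g0, rfl⟩ := h5
    obtain ⟨d, hd⟩ := Int.sq_of_isCoprime (hfg.of_isCoprime_of_dvd_right (Dvd.intro_left 5 rfl) : IsCoprime f g0)
      (c := e) (by linarith)
    rcases hd with hd | hd
    · exact ⟨d, hd⟩
    · nlinarith [sq_nonneg d]
  rcases p5.dvd_or_dvd (Dvd.intro _ h.symm) with h5 | h5
  · right; exact aux g f hg hco.symm (by linarith) h5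
  · left; exact aux f g hf hco h h5

lemma y17 {a b : ℤ} (ha : 0 < a) (hb : 0 < b) {S : (EC 17 (-289)).Point} {Y : ℚ}
    (h : IsPt S (((a : ℚ) / b) ^ 2) Y) :
    ∃ z : ℤ, z ^ 2 = a ^ 4 + 17 * a ^ 2 * b ^ 2 - 289 * b ^ 4 ∧ Y = (a : ℚ) / b * (z / b ^ 2) := by
  have e := h.eqn
  have ha' : (a : ℚ) ≠ 0 := by exact_mod_cast ha.ne'
  have hb' : (b : ℚ) ≠ 0 := by exact_mod_cast hb.ne'
  have e2 : (Y * b ^ 3 / a) ^ 2 = ((a ^ 4 + 17 * a ^ 2 * b ^ 2 - 289 * b ^ 4 : ℤ) : ℚ) := by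
    rw [div_pow, mul_pow, e]; push_cast; field_simp; ring
  obtain ⟨z, hz⟩ := int_of_sq e2
  rw [hz] at e2; push_cast at e2
  rcases sq_eq_sq_iff_eq_or_eq_neg.1 e2 with h | h
  · refine ⟨z, hz.symm, ?_⟩
    rw [← h]; field_simp
  · refine ⟨-z, by rw [hz]; ring, ?_⟩
    push_cast; rw [← h]; field_simp

/-- one of the two factors is a square -/
lemma half17_sq {a b z : ℤ} (ha : 0 < a) (hb : 0 < b) (hab : IsCoprime a b) (h17 : ¬ (17 : ℤ) ∣ a)
    (hz : z ^ 2 = a ^ 4 + 17 * a ^ 2 * b ^ 2 - 289 * b ^ 4) :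
    ∃ w d : ℤ, w ^ 2 = z ^ 2 ∧ 2 * a ^ 2 + 17 * b ^ 2 + 2 * w = d ^ 2 := by
  have hpos : ∀ w : ℤ, w ^ 2 = z ^ 2 → 0 < 2 * a ^ 2 + 17 * b ^ 2 + 2 * w := by
    intro w hw
    have : |2 * w| < |2 * a ^ 2 + 17 * b ^ 2| := by
      refine sq_lt_sq.1 ?_
      have : 0 < b ^ 4 := by positivity
      nlinarith
    rw [abs_of_pos (show 0 < 2 * a ^ 2 + 17 * b ^ 2 by positivity)] at this
    linarith [(abs_lt.1 this).1]
  have hf := hpos z rfl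
  have hg := hpos (-z) (by ring)
  have pr : ∀ p : ℤ, Prime p → p ∣ 17 * b ^ 2 → p ∣ a → False := by
    intro p hp h1 h2
    rcases hp.dvd_or_dvd h1 with h | h
    · have : Associated p 17 := (hp.dvd_prime_iff_associated p17).1 h
      exact h17 (this.symm.dvd.trans h2)
    · exact not_both hp hab h2 (hp.dvd_of_dvd_pow h)
  rcases Int.even_or_odd b with hev | hodd
  · obtain ⟨c, rfl⟩ := hev
    have hao : Odd a := by
      by_contra h
      rw [Int.not_odd_iff_even] at h
      exact not_both Int.prime_two hab h.two_dvd ⟨c, by ring⟩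
    have hzo : Odd z := by
      have : Odd (z ^ 2) := by
        rw [hz]
        have e : a ^ 4 + 17 * a ^ 2 * (c + c) ^ 2 - 289 * (c + c) ^ 4 =
          a ^ 4 + 2 * (34 * a ^ 2 * c ^ 2 - 8 * 289 * c ^ 4) := by ring
        rw [e]
        exact hao.pow.add_even (even_two_mul _)
      exact (Int.odd_pow' two_ne_zero).1 this
    obtain ⟨k, hk⟩ := (hao.pow (n := 2)).sub_odd hzo
    have hk' : a ^ 2 = z + 2 * k := by linarith
    have hgoal : (17 * c ^ 2 + k + z) * (17 * c ^ 2 + k) = 5 * (17 * c ^ 2) ^ 2 := by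
      have e4 : a ^ 4 = (z + 2 * k) ^ 2 := by rw [← hk']; ring
      rw [e4, hk'] at hz
      nlinarith
    have f1 : 0 < 17 * c ^ 2 + k + z := by nlinarith
    have f2 : 0 < 17 * c ^ 2 + k := by nlinarith
    rcases split5' f1 f2 hgoal (by
      intro p hp h1 h2 h3
      refine pr p hp (h3.trans ⟨4, by ring⟩) ?_
      have : p ∣ a ^ 2 := by
        have e : a ^ 2 = (17 * c ^ 2 + k + z) + (17 * c ^ 2 + k) - 2 * (17 * c ^ 2) := by rw [hk']; ring
        rw [e]; exact dvd_sub (dvd_add h1 h2) (h3.mul_left _)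
      exact hp.dvd_of_dvd_pow this) with ⟨d, hd⟩ | ⟨d, hd⟩
    · exact ⟨z, 2 * d, rfl, by linear_combination 2 * hk' + 4 * hd⟩
    · exact ⟨-z, 2 * d, by ring, by linear_combination 2 * hk' + 4 * hd⟩
  · have hgoal : (2 * a ^ 2 + 17 * b ^ 2 + 2 * z) * (2 * a ^ 2 + 17 * b ^ 2 + 2 * (-z)) =
      5 * (17 * b ^ 2) ^ 2 := by linear_combination -4 * hz
    rcases split5' hf hg hgoal (by
      intro p hp h1 h2 h3
      refine pr p hp h3 ?_
      have h4 : p ∣ 2 ^ 2 * a ^ 2 := by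
        have e : 2 ^ 2 * a ^ 2 = (2 * a ^ 2 + 17 * b ^ 2 + 2 * z) + (2 * a ^ 2 + 17 * b ^ 2 + 2 * (-z)) - 2 * (17 * b ^ 2) := by ring
        rw [e]; exact dvd_sub (dvd_add h1 h2) (h3.mul_left _)
      rcases hp.dvd_or_dvd h4 with h | h
      · exfalso
        have h2' : (2 : ℤ) ∣ 17 * b ^ 2 :=
          ((hp.dvd_prime_iff_associated Int.prime_two).1 (hp.dvd_of_dvd_pow h)).symm.dvd.trans h3
        have : Odd (17 * b ^ 2) := (show Odd (17 : ℤ) by decide).mul hodd.pow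
        exact Int.not_even_iff_odd.2 this (even_iff_two_dvd.2 h2')
      · exact hp.dvd_of_dvd_pow h) with ⟨d, hd⟩ | ⟨d, hd⟩
    · exact ⟨z, d, rfl, hd⟩
    · exact ⟨-z, d, by ring, hd⟩

def Ht (h : ℕ) (a b : ℤ) : Prop :=
  (¬ (17 : ℤ) ∣ a ∧ a ^ 2 ≤ h ∧ 17 * b ^ 2 ≤ h) ∨ ∃ α, a = 17 * α ∧ 17 * α ^ 2 ≤ h ∧ b ^ 2 ≤ h

end P4

open Polynomial
namespace P4

/-- `E ∣ 2 a z`, gcd(E,z) ∣ 5 -/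
lemma dvd_bound {E z a : ℤ} (h : E ∣ 2 * a * z) (hg : ((Int.gcd E z : ℕ) : ℤ) ∣ 5) (hE : 0 < E) (ha : 0 < a) :
    E ≤ 10 * a := by
  obtain ⟨g, e, w, hg0, hc, h1, h2⟩ := Int.exists_gcd_one' (m := E) (n := z)
    (Int.gcd_pos_of_ne_zero_left _ hE.ne')
  have hgz : (g : ℤ) ≠ 0 := by exact_mod_cast hg0.ne'
  have hgg : (g : ℤ) ∣ 5 := by
    refine (Int.dvd_coe_gcd ?_ ?_).trans hg
    · exact ⟨e, by rw [h1]; ring⟩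
    · exact ⟨w, by rw [h2]; ring⟩
  have he : e ∣ 2 * a := by
    have : e * g ∣ (2 * a * w) * g := by rw [← h1]; convert h using 1; rw [h2]; ring
    have := (mul_dvd_mul_iff_right hgz).1 this
    exact (Int.isCoprime_iff_gcd_eq_one.2 hc).dvd_of_dvd_mul_right this
  have : E ∣ 2 * a * 5 := by rw [h1]; exact mul_dvd_mul he hgg
  have := Int.le_of_dvd (by positivity) this
  linarith

lemma bound_a {a b a' b' z : ℤ} (ha : 0 < a) (hb : 0 < b) (ha' : 0 < a') (hb' : 0 < b')
    (hab : IsCoprime a b) (hab' : IsCoprime a' b') (h17 : ¬ (17 : ℤ) ∣ a')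
    (hz : z ^ 2 = a' ^ 4 + 17 * a' ^ 2 * b' ^ 2 - 289 * b' ^ 4)
    (h : a * (2 * a' * b' * z) = b * (a' ^ 4 + 289 * b' ^ 4)) : a' ^ 4 + 289 * b' ^ 4 ≤ 10 * a := by
  have c17 : IsCoprime a' 17 := ((Prime.coprime_iff_not_dvd p17).2 h17).symm
  have ca : IsCoprime (a' ^ 4 + 289 * b' ^ 4) a' := by
    have h1 : IsCoprime (17 ^ 2 * b' ^ 4) a' := (c17.pow_right.mul_right hab'.pow_right).symm
    have := h1.add_mul_right_left (a' ^ 3)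
    exact (by ring_nf at this ⊢; exact this)
  have cb : IsCoprime (a' ^ 4 + 289 * b' ^ 4) b' := by
    have := (hab'.pow_left (m := 4)).add_mul_right_left (289 * b' ^ 3)
    exact (by ring_nf at this ⊢; exact this)
  have c7 : IsCoprime (a' ^ 4 + 289 * b' ^ 4) 17 := by
    have := (c17.pow_left (m := 4)).add_mul_right_left (17 * b' ^ 4)
    exact (by ring_nf at this ⊢; exact this)
  refine dvd_bound (z := z) ?_ ?_ (by positivity) ha
  · have : a' ^ 4 + 289 * b' ^ 4 ∣ (2 * a * z) * (a' * b') := ⟨b, by linarith⟩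
    exact (ca.mul_right cb).dvd_of_dvd_mul_right this
  · have hE := Int.gcd_dvd_left (a' ^ 4 + 289 * b' ^ 4) z
    have hZ := Int.gcd_dvd_right (a' ^ 4 + 289 * b' ^ 4) z
    generalize ((Int.gcd (a' ^ 4 + 289 * b' ^ 4) z : ℕ) : ℤ) = d at *
    have d7 := c7.of_isCoprime_of_dvd_left hE
    have db := cb.of_isCoprime_of_dvd_left hE
    have h1 : d ∣ (a' ^ 2 - 34 * b' ^ 2) * (17 * b' ^ 2) := by
      have e : (a' ^ 2 - 34 * b' ^ 2) * (17 * b' ^ 2) = z * z - (a' ^ 4 + 289 * b' ^ 4) := by linear_combination -hz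
      rw [e]; exact dvd_sub (hZ.mul_right _) hE
    have h2 := (d7.mul_right db.pow_right).dvd_of_dvd_mul_right h1
    have h3 : d ∣ 5 * (17 ^ 2 * b' ^ 4) := by
      have e : 5 * (17 ^ 2 * b' ^ 4) = (a' ^ 4 + 289 * b' ^ 4) - (a' ^ 2 - 34 * b' ^ 2) * (a' ^ 2 + 34 * b' ^ 2) := by ring
      rw [e]; exact dvd_sub hE (h2.mul_right _)
    exact (d7.pow_right.mul_right db.pow_right).dvd_of_dvd_mul_right h3

lemma bound_b {a b α b' z : ℤ} (ha : 0 < a) (hb : 0 < b) (ha' : 0 < α) (hb' : 0 < b')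
    (hab : IsCoprime a b) (hab' : IsCoprime (17 * α) b')
    (hz : z ^ 2 = (17 * α) ^ 4 + 17 * (17 * α) ^ 2 * b' ^ 2 - 289 * b' ^ 4)
    (h : a * (2 * (17 * α) * b' * z) = b * ((17 * α) ^ 4 + 289 * b' ^ 4)) : 289 * α ^ 4 + b' ^ 4 ≤ 10 * a := by
  have hz' : z ^ 2 = 17 * (17 * (289 * α ^ 4 + 17 * α ^ 2 * b' ^ 2 - b' ^ 4)) := by rw [hz]; ring
  obtain ⟨z1, rfl⟩ := p17.dvd_of_dvd_pow (Dvd.intro _ hz'.symm)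
  have hz1 : z1 ^ 2 = 289 * α ^ 4 + 17 * α ^ 2 * b' ^ 2 - b' ^ 4 := by linarith
  have h1 : a * (2 * α * b' * z1) = b * (289 * α ^ 4 + b' ^ 4) := by linarith
  have cα : IsCoprime α b' := hab'.of_isCoprime_of_dvd_left (Dvd.intro_left _ rfl)
  have c7 : IsCoprime 17 b' := hab'.of_isCoprime_of_dvd_left (Dvd.intro _ rfl)
  have ca : IsCoprime (289 * α ^ 4 + b' ^ 4) α := by
    have := (cα.symm.pow_left (m := 4)).add_mul_right_left (289 * α ^ 3)
    exact (by ring_nf at this ⊢; exact this)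
  have cb : IsCoprime (289 * α ^ 4 + b' ^ 4) b' := by
    have h1 : IsCoprime (17 ^ 2 * α ^ 4) b' := c7.pow_left.mul_left cα.pow_left
    have := h1.add_mul_right_left (b' ^ 3)
    exact (by ring_nf at this ⊢; exact this)
  refine dvd_bound (z := z1) ?_ ?_ (by positivity) ha
  · have : 289 * α ^ 4 + b' ^ 4 ∣ (2 * a * z1) * (α * b') := ⟨b, by linarith⟩
    exact (ca.mul_right cb).dvd_of_dvd_mul_right this
  · have hE := Int.gcd_dvd_left (289 * α ^ 4 + b' ^ 4) z1
    have hZ := Int.gcd_dvd_right (289 * α ^ 4 + b' ^ 4) z1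
    generalize ((Int.gcd (289 * α ^ 4 + b' ^ 4) z1 : ℕ) : ℤ) = d at *
    have db := cb.of_isCoprime_of_dvd_left hE
    have h1 : d ∣ (17 * α ^ 2 - 2 * b' ^ 2) * b' ^ 2 := by
      have e : (17 * α ^ 2 - 2 * b' ^ 2) * b' ^ 2 = z1 * z1 - (289 * α ^ 4 + b' ^ 4) := by linear_combination -hz1
      rw [e]; exact dvd_sub (hZ.mul_right _) hE
    have h2 := db.pow_right.dvd_of_dvd_mul_right h1
    have h3 : d ∣ 5 * b' ^ 4 := by
      have e : 5 * b' ^ 4 = (289 * α ^ 4 + b' ^ 4) - (17 * α ^ 2 - 2 * b' ^ 2) * (17 * α ^ 2 + 2 * b' ^ 2) := by ring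
      rw [e]; exact dvd_sub hE (h2.mul_right _)
    exact db.pow_right.dvd_of_dvd_mul_right h3

lemma exists_nat_sq {x y E : ℤ} (hx : 0 ≤ x) (hy : 0 ≤ y) (h1 : x ^ 2 ≤ E) (h2 : y ^ 2 ≤ E) :
    ∃ h : ℕ, x ≤ h ∧ y ≤ h ∧ (h : ℤ) ^ 2 ≤ E := by
  rcases le_total x y with h | h
  · obtain ⟨n, rfl⟩ := Int.eq_ofNat_of_zero_le hy
    exact ⟨n, h, le_refl _, h2⟩
  · obtain ⟨n, rfl⟩ := Int.eq_ofNat_of_zero_le hx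
    exact ⟨n, le_refl _, h, h1⟩

lemma half17 {a b : ℤ} (ha : 0 < a) (hb : 0 < b) (hab : IsCoprime a b) (h17 : ¬ (17 : ℤ) ∣ a)
    {S : (EC 17 (-289)).Point} {Y : ℚ} (h : IsPt S (((a : ℚ) / b) ^ 2) Y) :
    ∃ (a' b' : ℤ) (S' : (EC 17 (-289)).Point) (Y' : ℚ) (h' : ℕ), 0 < a' ∧ 0 < b' ∧ IsCoprime a' b' ∧
      IsPt S' (((a' : ℚ) / b') ^ 2) Y' ∧ Ht h' a' b' ∧ (h' : ℤ) ^ 2 ≤ 10 * a ∧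
      (S = S' + S' ∨ S = -(S' + S')) := by
  obtain ⟨z, hz, -⟩ := y17 ha hb h
  obtain ⟨w, d, hw, hd⟩ := half17_sq ha hb hab h17 hz
  have haq : (a : ℚ) ≠ 0 := by exact_mod_cast ha.ne'
  have hbq : (b : ℚ) ≠ 0 := by exact_mod_cast hb.ne'
  have hwq : (w : ℚ) ^ 2 = a ^ 4 + 17 * a ^ 2 * b ^ 2 - 289 * b ^ 4 := by
    have := hw.trans hz
    exact_mod_cast this
  have hdq : 2 * (a : ℚ) ^ 2 + 17 * b ^ 2 + 2 * w = d ^ 2 := by exact_mod_cast hd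
  -- choose the sign of d
  obtain ⟨x', hx', hxe⟩ : ∃ x' : ℚ, 0 < x' ∧ x' ^ 2 = 2 * ((a ^ 2 + w) / b ^ 2) * x' + 289 := by
    have e : ((a : ℚ) ^ 2 + w + a * d) * (a ^ 2 + w - a * d) = -289 * b ^ 4 := by
      linear_combination hwq + (a : ℚ) ^ 2 * hdq
    by_cases hp : (0 : ℚ) < (a ^ 2 + w + a * d)
    · refine ⟨(a ^ 2 + w + a * d) / b ^ 2, by positivity, ?_⟩
      field_simp
      linear_combination -e
    · have h0 : (0 : ℚ) < (a ^ 2 + w - a * d) := by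
        have hb4 : (0 : ℚ) < 289 * b ^ 4 := by positivity
        by_contra hcon
        nlinarith [mul_nonneg_of_nonpos_of_nonpos (not_lt.1 hp) (not_lt.1 hcon)]
      refine ⟨(a ^ 2 + w - a * d) / b ^ 2, by positivity, ?_⟩
      field_simp
      linear_combination -e
  have hcurve : ((x' ^ 2 + 289) / (2 * ((a : ℚ) / b))) ^ 2 = x' ^ 3 + 17 * x' ^ 2 + (-289) * x' := by
    obtain ⟨t, ht⟩ : ∃ t : ℚ, t = (a ^ 2 + w) / b ^ 2 := ⟨_, rfl⟩
    obtain ⟨ξ, hξ⟩ : ∃ ξ : ℚ, ξ = a / b := ⟨_, rfl⟩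
    have hξ0 : ξ ≠ 0 := by rw [hξ]; exact div_ne_zero haq hbq
    have key : t ^ 2 + 289 = ξ ^ 2 * (2 * t + 17) := by
      rw [ht, hξ]; field_simp; linear_combination hwq
    rw [← ht] at hxe
    rw [← hξ]
    field_simp
    have h1 : (x' ^ 2 + 289) ^ 2 = 4 * (t ^ 2 + 289) * x' ^ 2 := by
      linear_combination (x' ^ 2 + 2 * t * x' - 289) * hxe
    rw [h1, key]
    linear_combination -4 * ξ ^ 2 * x' * hxe
  obtain ⟨S', hS'⟩ := exists_isPt (A := 17) (B := -289) (by norm_num) hcurve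
  obtain ⟨ξ, hξ0, rfl⟩ := class17 hcurve hx'
  obtain ⟨a', b', ha', hb', hab', e⟩ := frac_pos hξ0
  have hy0 : (((ξ ^ 2) ^ 2 + 289) / (2 * ((a : ℚ) / b))) ≠ 0 :=
    div_ne_zero (by positivity) (mul_ne_zero two_ne_zero (div_ne_zero haq hbq))
  obtain ⟨Y2, hd2⟩ := hS'.dblX hy0
  have hx2 : ((ξ ^ 2) ^ 2 - (-289)) ^ 2 / (4 * (((ξ ^ 2) ^ 2 + 289) / (2 * ((a : ℚ) / b))) ^ 2) = ((a : ℚ) / b) ^ 2 := by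
    have : (ξ ^ 2) ^ 2 + 289 ≠ 0 := by positivity
    rw [sub_neg_eq_add]
    generalize (ξ ^ 2) ^ 2 + 289 = q at *
    field_simp
    norm_num
  rw [hx2] at hd2
  have hS2 := hS'
  rw [e] at hS'
  obtain ⟨z0, hz0, hY0⟩ := y17 ha' hb' hS'
  have haq' : (0 : ℚ) < a' := by exact_mod_cast ha'
  have hbq' : (0 : ℚ) < b' := by exact_mod_cast hb'
  have haq1 : (0 : ℚ) < a := by exact_mod_cast ha
  have hbq1 : (0 : ℚ) < b := by exact_mod_cast hb
  have hrel : a * (2 * a' * b' * z0) = b * (a' ^ 4 + 289 * b' ^ 4) := by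
    have : (a : ℚ) * (2 * a' * b' * z0) = b * (a' ^ 4 + 289 * b' ^ 4) := by
      field_simp at hY0
      linarith
    exact_mod_cast this
  by_cases h7 : (17 : ℤ) ∣ a'
  · obtain ⟨α, rfl⟩ := h7
    have hα : 0 < α := by omega
    have hB := bound_b ha hb hα hb' hab hab' hz0 hrel
    have p1 : 0 < α ^ 4 := by positivity
    have p2 : 0 < b' ^ 4 := by positivity
    obtain ⟨n, n1, n2, n3⟩ := exists_nat_sq (x := 17 * α ^ 2) (y := b' ^ 2) (E := 289 * α ^ 4 + b' ^ 4)
      (by positivity) (by positivity) (by nlinarith) (by nlinarith)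
    exact ⟨17 * α, b', S', _, n, ha', hb', hab', hS', Or.inr ⟨α, rfl, n1, n2⟩, n3.trans hB, h.eq_or_neg hd2⟩
  · have hB := bound_a ha hb ha' hb' hab hab' h7 hz0 hrel
    have p1 : 0 < a' ^ 4 := by positivity
    have p2 : 0 < b' ^ 4 := by positivity
    obtain ⟨n, n1, n2, n3⟩ := exists_nat_sq (x := a' ^ 2) (y := 17 * b' ^ 2) (E := a' ^ 4 + 289 * b' ^ 4)
      (by positivity) (by positivity) (by nlinarith) (by nlinarith)
    exact ⟨a', b', S', _, n, ha', hb', hab', hS', Or.inl ⟨h7, n1, n2⟩, n3.trans hB, h.eq_or_neg hd2⟩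

end P4

open Polynomial
namespace P4

lemma plus17 {S P : (EC 17 (-289)).Point} {ξ w η : ℚ} (hP : IsPt P (289 / 9) (17 / 3 * η)) (hη : η ^ 2 = (323 / 9) ^ 2)
    (h : IsPt S (ξ ^ 2) (ξ * w)) (hw : w ^ 2 = ξ ^ 4 + 17 * ξ ^ 2 - 289) (hξ : ξ ^ 2 - 289 / 9 ≠ 0) :
    ∃ Y, IsPt (S + P) (((η * ξ - 17 / 3 * w) / (ξ ^ 2 - 289 / 9)) ^ 2) Y := by
  refine ⟨_, h.add_eq hP (sub_ne_zero.1 hξ) ((ξ * w - 17 / 3 * η) / (ξ ^ 2 - 289 / 9)) _ _ ?_ ?_ rfl⟩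
  · exact div_mul_cancel₀ _ hξ
  · generalize hD : ξ ^ 2 - 289 / 9 = D at *
    have hξ2 : ξ ^ 2 = D + 289 / 9 := by linarith
    rw [div_pow, div_pow]
    rw [eq_sub_iff_add_eq, eq_sub_iff_add_eq, eq_sub_iff_add_eq, ← sub_eq_zero]
    field_simp
    have hw2 : w ^ 2 = (D + 289 / 9) ^ 2 + 17 * (D + 289 / 9) - 289 := by rw [hw, ← hξ2]; ring
    have e1 : (ξ * w) ^ 2 = (D + 289 / 9) * ((D + 289 / 9) ^ 2 + 17 * (D + 289 / 9) - 289) := by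
      rw [mul_pow, hξ2, hw2]
    have e2 : (η * ξ) ^ 2 = (323 / 9) ^ 2 * (D + 289 / 9) := by rw [mul_pow, hη, hξ2]
    ring_nf at *
    nlinarith [hw2, e1, e2, hη, hξ2]

lemma reduce17 {u w : ℤ} {h : ℕ} (hu : ¬ (17 : ℤ) ∣ u) (hw0 : w ≠ 0) (hb : u ^ 2 ≤ 26 * h) :
    ∃ a b : ℤ, 0 < a ∧ 0 < b ∧ IsCoprime a b ∧ ¬ (17 : ℤ) ∣ a ∧ a ^ 2 ≤ 26 * h ∧
    ((u : ℚ) / w) ^ 2 = ((a : ℚ) / b) ^ 2 := by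
  have hu0 : u ≠ 0 := by rintro rfl; simp at hu
  obtain ⟨a, b, ha, hb', hab, h1, h2, h3, h4⟩ := reduce_frac hu0 hw0
  have had : (a : ℤ) ∣ u := Int.natCast_dvd.2 h1
  refine ⟨a, b, by exact_mod_cast ha, by exact_mod_cast hb', Nat.isCoprime_iff_coprime.2 hab,
    fun h => hu (h.trans had), ?_, by rw [h4]; push_cast; rfl⟩
  have : (a : ℤ) ≤ |u| := by
    rw [Int.abs_eq_natAbs]; exact_mod_cast Nat.le_of_dvd (Int.natAbs_pos.2 hu0) h1
  calc (a : ℤ) ^ 2 ≤ |u| ^ 2 := pow_le_pow_left₀ (by positivity) this 2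
    _ ≤ _ := by rw [sq_abs]; exact hb

set_option maxHeartbeats 1000000 in
lemma step17 {α b : ℤ} {h : ℕ} (hα : 0 < α) (hb : 0 < b) (hab : IsCoprime (17 * α) b)
    {S P : (EC 17 (-289)).Point} {Y : ℚ} (hP : IsPt P (289 / 9) (5491 / 27))
    (hS : IsPt S ((((17 * α : ℤ) : ℚ) / b) ^ 2) Y) (hne : b ≠ 3 * α)
    (q1 : 17 * α ^ 2 ≤ h) (q2 : b ^ 2 ≤ h) :
    ∃ (a' b' : ℤ) (S' : (EC 17 (-289)).Point) (Y' : ℚ), 0 < a' ∧ 0 < b' ∧ IsCoprime a' b' ∧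
      ¬ (17 : ℤ) ∣ a' ∧ IsPt S' (((a' : ℚ) / b') ^ 2) Y' ∧ (S = S' - P ∨ S = S' + P) ∧
      a' ^ 2 ≤ 26 * h := by
  obtain ⟨z, hz, hY⟩ := y17 (by positivity) hb hS
  have hz' : z ^ 2 = 17 * (17 * (289 * α ^ 4 + 17 * α ^ 2 * b ^ 2 - b ^ 4)) := by rw [hz]; ring
  obtain ⟨z, rfl⟩ := p17.dvd_of_dvd_pow (Dvd.intro _ hz'.symm)
  have hz1 : z ^ 2 = 289 * α ^ 4 + 17 * α ^ 2 * b ^ 2 - b ^ 4 := by linarith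
  have hbq : (b : ℚ) ≠ 0 := by exact_mod_cast hb.ne'
  have hαq : (α : ℚ) ≠ 0 := by exact_mod_cast hα.ne'
  have hz1q : (z : ℚ) ^ 2 = 289 * α ^ 4 + 17 * α ^ 2 * b ^ 2 - b ^ 4 := by exact_mod_cast hz1
  have h17b : ¬ (17 : ℤ) ∣ b := fun hh => not_both p17 hab (Dvd.intro _ rfl) hh
  have hW : b ^ 2 - 9 * α ^ 2 ≠ 0 := by
    intro h0
    have : (b - 3 * α) * (b + 3 * α) = 0 := by linear_combination h0
    rcases mul_eq_zero.1 this with h | h <;> omega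
  have hWq : (b : ℚ) ^ 2 - 9 * α ^ 2 ≠ 0 := by exact_mod_cast hW
  have hUV : (3 * z - 19 * α * b) * (3 * z + 19 * α * b) =
      -((289 * α ^ 2 + 9 * b ^ 2) * (b ^ 2 - 9 * α ^ 2)) := by linear_combination 9 * hz1
  have hZ0 : 289 * α ^ 2 + 9 * b ^ 2 ≠ 0 := by positivity
  have hU0 : 3 * z - 19 * α * b ≠ 0 := by
    intro h0
    rw [h0, zero_mul] at hUV
    exact mul_ne_zero hZ0 hW (by linarith)
  obtain ⟨g, u, w, k, e1, e2, e3, e4⟩ := four_split hU0 hUV hW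
  have huk : ¬ (17 : ℤ) ∣ u * k := by
    intro hd
    have : (17 : ℤ) ∣ 9 * b ^ 2 := by
      have e : 9 * b ^ 2 = -(u * k) - 17 * (17 * α ^ 2) := by rw [← e4]; ring
      rw [e]; exact dvd_sub (hd.neg_right) (Dvd.intro _ rfl)
    rcases p17.dvd_or_dvd this with h | h
    · norm_num at h
    · exact h17b (p17.dvd_of_dvd_pow h)
  have hu : ¬ (17 : ℤ) ∣ u := fun h => huk (h.mul_right _)
  have hk : ¬ (17 : ℤ) ∣ k := fun h => huk (h.mul_left _)
  have hg0 : g ≠ 0 := by rintro rfl; simp at e2; exact hW e2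
  have hw0 : w ≠ 0 := by rintro rfl; simp at e2; exact hW e2
  have h0 : (0 : ℤ) ≤ h := by positivity
  have q3 : 4 * (α * b) ≤ h := by nlinarith [sq_nonneg (4 * α - b)]
  have q4 : 0 < α * b := by positivity
  have q5 : |z| ≤ 2 * h := by
    apply abs_le_of_sq_le_sq _ (by positivity)
    have p1 : (17 * α ^ 2) ^ 2 ≤ (h : ℤ) ^ 2 := pow_le_pow_left₀ (by positivity) q1 2
    have p2 : (17 * α ^ 2) * b ^ 2 ≤ (h : ℤ) * h := mul_le_mul q1 q2 (by positivity) h0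
    have p3 : 0 < b ^ 4 := by positivity
    nlinarith
  have q6 := abs_le.1 q5
  have p1 : 0 < α ^ 2 := by positivity
  have p2 : 0 < b ^ 2 := by positivity
  have B1 : |g * u| ≤ 26 * (h : ℤ) := by
    rw [← e1, abs_le]; constructor <;> linarith
  have B2 : |g * w| ≤ 26 * (h : ℤ) := by
    rw [← e2, abs_le]; constructor <;> linarith
  have B3 : |w * k| ≤ 26 * (h : ℤ) := by
    rw [← e3, abs_le]; constructor <;> linarith
  have B4 : |u * k| ≤ 26 * (h : ℤ) := by
    rw [show u * k = -(289 * α ^ 2 + 9 * b ^ 2) by rw [e4]; ring, abs_le]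
    constructor <;> linarith
  have hgq : (g : ℚ) ≠ 0 := by exact_mod_cast hg0
  have hwq : (w : ℚ) ≠ 0 := by exact_mod_cast hw0
  have e1q : 3 * (z : ℚ) - 19 * α * b = g * u := by exact_mod_cast e1
  have e2q : (b : ℚ) ^ 2 - 9 * α ^ 2 = g * w := by exact_mod_cast e2
  have e3q : 3 * (z : ℚ) + 19 * α * b = w * k := by exact_mod_cast e3
  rw [hY] at hS
  push_cast at hS
  have hxi : (17 * (α : ℚ) / b) ^ 2 - 289 / 9 = -(289 * (g * w) / (9 * b ^ 2)) := by
    rw [← e2q]; field_simp; ring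
  have hξ : (17 * (α : ℚ) / b) ^ 2 - 289 / 9 ≠ 0 := by
    rw [hxi]; exact neg_ne_zero.2 (div_ne_zero (by positivity) (by positivity))
  have hw : (17 * (z : ℚ) / b ^ 2) ^ 2 = (17 * (α : ℚ) / b) ^ 4 + 17 * (17 * (α : ℚ) / b) ^ 2 - 289 := by
    field_simp
    linear_combination 289 * hz1q
  rcases max_split B1 B2 B3 B4 with ⟨hm, -⟩ | ⟨-, hm⟩
  · obtain ⟨Y', hY'⟩ := plus17 (η := 323 / 9) (by norm_num; exact hP) (by norm_num) hS hw hξ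
    have hx : (323 / 9 * (17 * (α : ℚ) / b) - 17 / 3 * (17 * z / b ^ 2)) / ((17 * (α : ℚ) / b) ^ 2 - 289 / 9) = u / w := by
      have : 323 / 9 * (17 * (α : ℚ) / b) - 17 / 3 * (17 * z / b ^ 2) = -(289 * (g * u) / (9 * b ^ 2)) := by
        rw [← e1q]; field_simp; ring
      rw [this, hxi]; field_simp
    rw [hx] at hY'
    obtain ⟨a', b', p1, p2, p3, p4, p5, p6⟩ := reduce17 hu hw0 hm
    rw [p6] at hY'
    exact ⟨a', b', _, Y', p1, p2, p3, p4, hY', Or.inl (by simp), p5⟩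
  · obtain ⟨Y', hY'⟩ := plus17 (η := -(323 / 9)) (by norm_num; exact hP.neg) (by norm_num) hS hw hξ
    have hx : (-(323 / 9) * (17 * (α : ℚ) / b) - 17 / 3 * (17 * z / b ^ 2)) / ((17 * (α : ℚ) / b) ^ 2 - 289 / 9) = k / g := by
      have : -(323 / 9) * (17 * (α : ℚ) / b) - 17 / 3 * (17 * z / b ^ 2) = -(289 * (w * k) / (9 * b ^ 2)) := by
        rw [← e3q]; field_simp; ring
      rw [this, hxi]; field_simp
    rw [hx] at hY'
    obtain ⟨a', b', p1, p2, p3, p4, p5, p6⟩ := reduce17 hk hg0 hm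
    rw [p6] at hY'
    exact ⟨a', b', _, Y', p1, p2, p3, p4, hY', Or.inr (by simp), p5⟩

theorem mw17 {P : (EC 17 (-289)).Point} (hP : IsPt P (289 / 9) (5491 / 27)) : ∀ (h : ℕ) (a b : ℤ)
    (S : (EC 17 (-289)).Point) (Y : ℚ), 0 < a → 0 < b → IsCoprime a b →
    IsPt S (((a : ℚ) / b) ^ 2) Y → Ht h a b → (∃ N : ℤ, S = N • P) ∧ (¬ (17 : ℤ) ∣ a → ∃ N : ℤ, S = (N + N) • P) := by
  intro h
  induction h using Nat.strong_induction_on with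
  | _ h ih =>
  intro a b S Y ha hb hab hS hH
  have half : ∀ (a b : ℤ) (S : (EC 17 (-289)).Point) (Y : ℚ), 0 < a → 0 < b → IsCoprime a b →
    IsPt S (((a : ℚ) / b) ^ 2) Y → ¬ (17 : ℤ) ∣ a → a ^ 2 ≤ 26 * h → 17 ≤ h → ∃ N : ℤ, S = (N + N) • P := by
    intro a b S Y ha hb hab hS h7 hle h17
    obtain ⟨a', b', S', Y', h', p1, p2, p3, p4, p5, p6, p7⟩ := half17 ha hb hab h7 hS
    have : h' < h := by
      by_contra hcon
      rw [not_lt] at hcon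
      have w1 : (h : ℤ) ≤ h' := by exact_mod_cast hcon
      have w0 : (17 : ℤ) ≤ h := by exact_mod_cast h17
      have w2 : ((h : ℤ) ^ 2) ^ 2 ≤ (10 * a) ^ 2 :=
        pow_le_pow_left₀ (by positivity) ((pow_le_pow_left₀ (by positivity) w1 2).trans p6) 2
      have w3 : (17 : ℤ) ^ 3 ≤ h ^ 3 := pow_le_pow_left₀ (by norm_num) w0 3
      nlinarith
    obtain ⟨⟨N, hN⟩, -⟩ := ih _ this a' b' S' Y' p1 p2 p3 p4 p5
    rcases p7 with p7 | p7
    · exact ⟨N, by rw [p7, hN, add_zsmul]⟩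
    · exact ⟨-N, by rw [p7, hN, add_zsmul, neg_zsmul, neg_add]⟩
  rcases hH with ⟨h7, h1, h2⟩ | ⟨α, rfl, h1, h2⟩
  · have : 17 ≤ h := by
      have : (17 : ℤ) ≤ h := by nlinarith
      exact_mod_cast this
    obtain ⟨N, hN⟩ := half a b S Y ha hb hab hS h7 (by linarith) this
    exact ⟨⟨_, hN⟩, fun _ => ⟨N, hN⟩⟩
  · refine ⟨?_, fun hh => absurd (Dvd.intro _ rfl) hh⟩
    have hα : 0 < α := by omega
    by_cases hne : b = 3 * α
    · have hx : (((17 * α : ℤ) : ℚ) / b) ^ 2 = 289 / 9 := by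
        have hα' : (α : ℚ) ≠ 0 := by exact_mod_cast hα.ne'
        rw [hne]; push_cast; field_simp; norm_num
      rw [hx] at hS
      rcases hS.eq_or_neg hP with q | q
      · exact ⟨1, by simpa using q⟩
      · exact ⟨-1, by simpa using q⟩
    · obtain ⟨a', b', S', Y', p1, p2, p3, p4, p5, p6, p7⟩ := step17 hα hb hab hP hS hne h1 h2
      have : 17 ≤ h := by
        have : (17 : ℤ) ≤ h := by nlinarith
        exact_mod_cast this
      obtain ⟨N, hN⟩ := half a' b' S' Y' p1 p2 p3 p5 p4 p7 this
      rcases p6 with p6 | p6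
      · exact ⟨N + N - 1, by rw [p6, hN, sub_zsmul, one_zsmul, sub_eq_add_neg]⟩
      · exact ⟨N + N + 1, by rw [p6, hN, add_zsmul _ (N + N) 1, one_zsmul]⟩

theorem mw17' {P : (EC 17 (-289)).Point} (hP : IsPt P (289 / 9) (5491 / 27)) {S : (EC 17 (-289)).Point} {a b : ℤ} {Y : ℚ}
    (ha : 0 < a) (hb : 0 < b) (hab : IsCoprime a b) (h7 : ¬ (17 : ℤ) ∣ a)
    (h : IsPt S (((a : ℚ) / b) ^ 2) Y) : ∃ N : ℤ, S = (N + N) • P := by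
  refine (mw17 hP (a ^ 2 + 17 * b ^ 2).natAbs a b S Y ha hb hab h (Or.inl ⟨h7, ?_, ?_⟩)).2 h7
  · rw [Int.natAbs_of_nonneg (by positivity)]; nlinarith [sq_nonneg b]
  · rw [Int.natAbs_of_nonneg (by positivity)]; nlinarith [sq_nonneg a]
end P4

open Polynomial
namespace P4

lemma y17n {a b : ℤ} (ha : a ≠ 0) (hb : b ≠ 0) {S : (EC 17 (-289)).Point} {Y : ℚ}
    (h : IsPt S (((a : ℚ) / b) ^ 2) Y) :
    ∃ z : ℤ, z ^ 2 = a ^ 4 + 17 * a ^ 2 * b ^ 2 - 289 * b ^ 4 ∧ Y = (a : ℚ) / b * (z / b ^ 2) := by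
  have e := h.eqn
  have ha' : (a : ℚ) ≠ 0 := by exact_mod_cast ha
  have hb' : (b : ℚ) ≠ 0 := by exact_mod_cast hb
  have e2 : (Y * b ^ 3 / a) ^ 2 = ((a ^ 4 + 17 * a ^ 2 * b ^ 2 - 289 * b ^ 4 : ℤ) : ℚ) := by
    rw [div_pow, mul_pow, e]; push_cast; field_simp; ring
  obtain ⟨z, hz⟩ := int_of_sq e2
  rw [hz] at e2; push_cast at e2
  rcases sq_eq_sq_iff_eq_or_eq_neg.1 e2 with h | h
  · refine ⟨z, hz.symm, ?_⟩
    rw [← h]; field_simp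
  · refine ⟨-z, by rw [hz]; ring, ?_⟩
    push_cast; rw [← h]; field_simp

structure Good17 (a b : ℤ) : Prop where
  oa : Odd a
  ob : Odd b
  cop : IsCoprime a b
  b5 : (5 : ℤ) ∣ b
  a5 : a % 5 = 3
  n17 : ¬ (17 : ℤ) ∣ a
  e17 : ∃ e : ZMod 17, 2 * (a : ZMod 17) = e ^ 4

lemma pow4mod5 : ∀ a : ZMod 5, a ≠ 0 → a ^ 4 = 1 := by decide
lemma z5a : ∀ a : ZMod 5, 2 * a = 1 → a = 3 := by decide

lemma odd_pow4 {a : ℤ} (ha : Odd a) : ∃ t, a ^ 4 = 4 * t + 1 := by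
  obtain ⟨k, rfl⟩ := ha
  exact ⟨4 * k ^ 4 + 8 * k ^ 3 + 6 * k ^ 2 + 2 * k, by ring⟩

lemma Good17.step {a b : ℤ} (h : Good17 a b) {S : (EC 17 (-289)).Point} {Y : ℚ}
    (hS : IsPt S (((a : ℚ) / b) ^ 2) Y) :
    ∃ a' b' : ℤ, 2 * a' = a ^ 4 + 289 * b ^ 4 ∧ Good17 a' b' ∧ ∃ Y', IsPt (S + S) (((a' : ℚ) / b') ^ 2) Y' := by
  have ha0 : a ≠ 0 := by rintro rfl; have := h.oa; simp at this
  have hb0 : b ≠ 0 := by rintro rfl; have := h.ob; simp at this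
  obtain ⟨z, hz, hY⟩ := y17n ha0 hb0 hS
  obtain ⟨s, hs⟩ := odd_pow4 h.oa
  obtain ⟨t, ht⟩ := odd_pow4 h.ob
  have hzo : Odd z := by
    have : Odd (z ^ 2) := by
      rw [hz]
      exact (h.oa.pow.add_odd (((show Odd (17 : ℤ) by decide).mul h.oa.pow).mul h.ob.pow)).sub_odd
        ((show Odd (289 : ℤ) by decide).mul h.ob.pow)
    exact (Int.odd_pow' two_ne_zero).1 this
  have hz0 : z ≠ 0 := by rintro rfl; simp at hzo
  have hE : 2 * (2 * s + 578 * t + 145) = a ^ 4 + 289 * b ^ 4 := by rw [hs, ht]; ring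
  generalize ha' : 2 * s + 578 * t + 145 = a' at hE
  have hao : Odd a' := ⟨s + 289 * t + 72, by rw [← ha']; ring⟩
  have h5a : ¬ (5 : ℤ) ∣ a := by intro hd; have := h.a5; omega
  -- congruences
  have e5 : a' % 5 = 3 := by
    have q0 : (a : ZMod 5) ≠ 0 := fun q => h5a ((ZMod.intCast_zmod_eq_zero_iff_dvd a 5).1 q)
    have q1 : (b : ZMod 5) = 0 := (ZMod.intCast_zmod_eq_zero_iff_dvd b 5).2 h.b5
    have q2 : ((2 * a' : ℤ) : ZMod 5) = ((a ^ 4 + 289 * b ^ 4 : ℤ) : ZMod 5) := by rw [hE]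
    push_cast at q2
    rw [q1, pow4mod5 _ q0] at q2
    have q3 := z5a _ (by simpa using q2)
    have : ((a' : ℤ) : ZMod 5) = ((3 : ℤ) : ZMod 5) := by rw [q3]; rfl
    have := (ZMod.intCast_eq_intCast_iff' _ _ _).1 this
    simpa using this
  have e17 : 2 * (a' : ZMod 17) = (a : ZMod 17) ^ 4 := by
    have q2 : ((2 * a' : ℤ) : ZMod 17) = ((a ^ 4 + 289 * b ^ 4 : ℤ) : ZMod 17) := by rw [hE]
    push_cast at q2
    rw [q2, show (289 : ZMod 17) = 0 by decide]; ring
  have c17 : IsCoprime a 17 := ((Prime.coprime_iff_not_dvd p17).2 h.n17).symm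
  have hd : a' ∣ a ^ 4 + 289 * b ^ 4 := ⟨2, by rw [← hE]; ring⟩
  have ca : IsCoprime (a ^ 4 + 289 * b ^ 4) a := by
    have h1 : IsCoprime (17 ^ 2 * b ^ 4) a := (c17.pow_right.mul_right h.cop.pow_right).symm
    have := h1.add_mul_right_left (a ^ 3)
    ring_nf at this ⊢; exact this
  have cb : IsCoprime (a ^ 4 + 289 * b ^ 4) b := by
    have := (h.cop.pow_left (m := 4)).add_mul_right_left (289 * b ^ 3)
    ring_nf at this ⊢; exact this
  have c7 : IsCoprime (a ^ 4 + 289 * b ^ 4) 17 := by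
    have := (c17.pow_left (m := 4)).add_mul_right_left (17 * b ^ 4)
    ring_nf at this ⊢; exact this
  have n17 : ¬ (17 : ℤ) ∣ a' := fun hh => not_both p17 (c7.of_isCoprime_of_dvd_left hd) hh (dvd_refl _)
  have hcop : IsCoprime a' (a * b * z) := by
    refine ((ca.of_isCoprime_of_dvd_left hd).mul_right (cb.of_isCoprime_of_dvd_left hd)).mul_right ?_
    by_contra hcop
    have : Int.gcd a' z ≠ 1 := fun h => hcop (Int.isCoprime_iff_gcd_eq_one.2 h)
    obtain ⟨l, hl, hlg⟩ := Nat.exists_prime_and_dvd this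
    have hlZ := Nat.prime_iff_prime_int.1 hl
    have hlp : (l : ℤ) ∣ a' := (Int.natCast_dvd_natCast.2 hlg).trans (Int.gcd_dvd_left _ _)
    have hlq : (l : ℤ) ∣ z := (Int.natCast_dvd_natCast.2 hlg).trans (Int.gcd_dvd_right _ _)
    have hlE := hlp.trans hd
    have n7 : ¬ (l : ℤ) ∣ 17 := fun h => not_both hlZ c7 hlE h
    have nb : ¬ (l : ℤ) ∣ b := fun h => not_both hlZ cb hlE h
    have h1 : (l : ℤ) ∣ (a ^ 2 - 34 * b ^ 2) * (17 * b ^ 2) := by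
      have e : (a ^ 2 - 34 * b ^ 2) * (17 * b ^ 2) = z * z - (a ^ 4 + 289 * b ^ 4) := by linear_combination -hz
      rw [e]; exact dvd_sub (hlq.mul_right _) hlE
    have h2 : (l : ℤ) ∣ a ^ 2 - 34 * b ^ 2 := by
      rcases hlZ.dvd_or_dvd h1 with h | h
      · exact h
      · rcases hlZ.dvd_or_dvd h with h | h
        · exact absurd h n7
        · exact absurd (hlZ.dvd_of_dvd_pow h) nb
    have h3 : (l : ℤ) ∣ 5 * (17 ^ 2 * b ^ 4) := by
      have e : 5 * (17 ^ 2 * b ^ 4) = (a ^ 4 + 289 * b ^ 4) - (a ^ 2 - 34 * b ^ 2) * (a ^ 2 + 34 * b ^ 2) := by ring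
      rw [e]; exact dvd_sub hlE (h2.mul_right _)
    rcases hlZ.dvd_or_dvd h3 with h | h
    · have : l ∣ 5 := by exact_mod_cast h
      have : l = 5 := (Nat.prime_dvd_prime_iff_eq hl (by norm_num)).1 this
      subst this
      push_cast at hlp
      omega
    · rcases hlZ.dvd_or_dvd h with h | h
      · exact n7 (hlZ.dvd_of_dvd_pow h)
      · exact nb (hlZ.dvd_of_dvd_pow h)
  refine ⟨a', a * b * z, hE, ⟨hao, (h.oa.mul h.ob).mul hzo, hcop, (h.b5.mul_left a).mul_right z, e5, n17, _, e17⟩, ?_⟩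
  have haq : (a : ℚ) ≠ 0 := by exact_mod_cast ha0
  have hbq : (b : ℚ) ≠ 0 := by exact_mod_cast hb0
  have hzq : (z : ℚ) ≠ 0 := by exact_mod_cast hz0
  have hY0 : Y ≠ 0 := by
    rw [hY]; exact mul_ne_zero (div_ne_zero haq hbq) (div_ne_zero hzq (pow_ne_zero _ hbq))
  obtain ⟨Y', hY'⟩ := hS.dblX hY0
  refine ⟨Y', ?_⟩
  have hx : ((((a : ℚ) / b) ^ 2) ^ 2 - -289) ^ 2 / (4 * Y ^ 2) = ((a' : ℚ) / ((a * b * z : ℤ) : ℚ)) ^ 2 := by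
    have hEq : (a' : ℚ) = (a ^ 4 + 289 * b ^ 4) / 2 := by
      have : 2 * (a' : ℚ) = a ^ 4 + 289 * b ^ 4 := by exact_mod_cast hE
      linarith
    rw [hY, hEq]; push_cast; field_simp; ring
  rw [hx] at hY'
  exact hY'

lemma seq17 {a b : ℤ} (hg : Good17 a b) {S : (EC 17 (-289)).Point} {Y : ℚ}
    (h : IsPt S (((a : ℚ) / b) ^ 2) Y) (k : ℕ) :
    ∃ a b : ℤ, Good17 a b ∧ ∃ Y, IsPt ((2 ^ k : ℤ) • S) (((a : ℚ) / b) ^ 2) Y := by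
  induction k with
  | zero => exact ⟨a, b, hg, Y, by simpa using h⟩
  | succ k ih =>
    obtain ⟨a, b, hg, Y, hY⟩ := ih
    obtain ⟨a', b', -, hg', Y', hY'⟩ := hg.step hY
    refine ⟨a', b', hg', Y', ?_⟩
    rw [pow_succ, mul_zsmul, two_zsmul, zsmul_add]; exact hY'

lemma leg17 : ∀ a e : ZMod 17, 2 * a = e ^ 4 → a = (3 * e ^ 2) ^ 2 := by decide

lemma jac85 {a b : ℤ} (h : Good17 a b) : jacobiSym a 85 = -1 := by
  have e : jacobiSym a 85 = jacobiSym a 5 * jacobiSym a 17 := jacobiSym.mul_right _ 5 17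
  have e5 : jacobiSym a 5 = -1 := by
    rw [jacobiSym.mod_left, show a % (5 : ℕ) = 3 from h.a5]
    decide +kernel
  have e17 : jacobiSym a 17 = 1 := by
    obtain ⟨e, he⟩ := h.e17
    have : Fact (Nat.Prime 17) := ⟨by norm_num⟩
    rw [← jacobiSym.legendreSym.to_jacobiSym, legendreSym.eq_one_iff 17
      (fun q => h.n17 ((ZMod.intCast_zmod_eq_zero_iff_dvd a 17).1 q))]
    exact ⟨3 * e ^ 2, by rw [← sq]; exact leg17 _ _ he⟩
  rw [e, e5, e17]; rfl

lemma red17_gen {p : ℕ} [Fact p.Prime] {x y ν r x0 y0 ν0 : ℚ} (hx : Cg p x x0) (hy : Cg p y y0)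
    (hs : ν * (x + 9) = 2 * y - 7 * x + 51) (hs0 : ν0 * (x0 + 9) = 2 * y0 - 7 * x0 + 51)
    (hu : Rat.padicValuation p (x0 + 9) = 1)
    (hr : r ^ 2 = ν ^ 2 - 2 * ν + 17) :
    Cg p (r ^ 2) (ν0 ^ 2 - 2 * ν0 + 17) := by
  have hd : Cg p (x + 9) (x0 + 9) := by
    simpa using hx.add (Cg.int (p := p) 9)
  have n1 := v_unit_ne (v_eq_one_of_near hd.2.2 hu)
  have n2 := v_unit_ne hu
  have hss : Cg p ν ν0 := by
    have e1 : ν = (2 * y - 7 * x + 51) / (x + 9) := by rw [eq_div_iff n1, hs]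
    have e2 : ν0 = (2 * y0 - 7 * x0 + 51) / (x0 + 9) := by rw [eq_div_iff n2, hs0]
    rw [e1, e2]
    refine Cg.div ?_ hd hu
    simpa using (((Cg.int (p := p) 2).mul hy).sub ((Cg.int (p := p) 7).mul hx)).add (Cg.int (p := p) 51)
  rw [hr]
  simpa using ((hss.pow 2).sub ((Cg.int (p := p) 2).mul hss)).add (Cg.int (p := p) 17)

lemma red17 {p : ℕ} [Fact p.Prime] (h2 : p ≠ 2) (h3 : p ≠ 3) {x y ν r : ℚ}
    (hx : Rat.padicValuation p x < 1) (hy : Rat.padicValuation p y < 1)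
    (hs : ν * (x + 9) = 2 * y - 7 * x + 51)
    (hr : r ^ 2 = ν ^ 2 - 2 * ν + 17) :
    IsSquare (((85 : ℕ) : ℤ) : ZMod p) := by
  have hp : p.Prime := Fact.out
  have v2 : Rat.padicValuation p (2 : ℚ) = 1 := by
    have n2 : ¬ (p : ℤ) ∣ 2 := by
      intro h
      have : p ∣ 2 := by exact_mod_cast h
      exact h2 ((Nat.prime_dvd_prime_iff_eq hp Nat.prime_two).1 this)
    exact_mod_cast v_not_dvd n2
  have v3 : Rat.padicValuation p (3 : ℚ) = 1 := by
    have n3 : ¬ (p : ℤ) ∣ 3 := by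
      intro h
      have : p ∣ 3 := by exact_mod_cast h
      exact h3 ((Nat.prime_dvd_prime_iff_eq hp Nat.prime_three).1 this)
    exact_mod_cast v_not_dvd n3
  have hC := red17_gen (p := p) (x0 := 0) (y0 := 0) (ν0 := 17 / 3) (.of_near (by simp) (by simpa using hx))
    (.of_near (by simp) (by simpa using hy)) hs (by norm_num)
    (by rw [show (0 + 9 : ℚ) = 3 * 3 by norm_num, map_mul, v3]; rfl) hr
  refine isSquare_of_Cg (d := 2 / 3) hC ?_ (by norm_num)
  rw [map_div₀, v2, v3]; rfl

lemma sq3' : IsSquare (((85 : ℕ) : ℤ) : ZMod 3) := ⟨1, by decide⟩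
lemma sq17' : IsSquare (((85 : ℕ) : ℤ) : ZMod 17) := ⟨0, by decide⟩

lemma final17 {a b : ℤ} (hg : Good17 a b)
    {S R : (EC 17 (-289)).Point} {Y : ℚ} (hS : IsPt S (((a : ℚ) / b) ^ 2) Y) {m : ℤ} (hm : Odd m)
    (hR : R = m • S) {X Z ν r : ℚ} (h : IsPt R X Z) (hs : ν * (X + 9) = 2 * Z - 7 * X + 51)
    (hr : r ^ 2 = ν ^ 2 - 2 * ν + 17) : False := by
  obtain ⟨p, hp, hpa, hns⟩ := prime_of_jac 85 (by norm_num) hg.oa (jac85 hg)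
  have : Fact p.Prime := ⟨hp⟩
  have h2 : p ≠ 2 := by
    rintro rfl
    exact (Int.not_even_iff_odd.2 hg.oa) (even_iff_two_dvd.2 hpa)
  have h3 : p ≠ 3 := by
    rintro rfl
    exact hns sq3'
  have h17 : p ≠ 17 := by
    rintro rfl
    exact hns sq17'
  have hpZ : Prime (p : ℤ) := Nat.prime_iff_prime_int.1 hp
  have n289 : ¬ (p : ℤ) ∣ -289 := by
    intro h
    have h : (p : ℤ) ∣ 17 ^ 2 := by
      have := dvd_neg.1 h
      norm_num
      exact this
    exact h17 (dvd17 hp h)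
  have nb : ¬ (p : ℤ) ∣ b := fun hb => hpZ.not_isUnit (hg.cop.isUnit_of_dvd' hpa hb)
  obtain ⟨T, hT⟩ := exists_isPt (A := 17) (B := -289) (by norm_num) (x := 0) (y := 0) (by norm_num)
  have vB : Rat.padicValuation p (-289 : ℚ) = 1 := by exact_mod_cast v_not_dvd n289
  have hA : Rat.padicValuation p (17 : ℚ) ≤ 1 := by exact_mod_cast v_int (p := p) 17
  have hx : Rat.padicValuation p (((a : ℚ) / b) ^ 2) < 1 :=
    v_pow_lt (v_div_lt (v_dvd hpa) (v_not_dvd nb)) two_ne_zero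
  have hK := (InK.of_T hS hT hx vB).zsmul hA vB.le m
  obtain ⟨x3, y3, q1, -, -, q2, q3⟩ := hK.add_red hA vB.le hT (by simp)
  have hTT : (m • (S + T)) + T = R := by
    rw [zsmul_add, odd_zsmul_T hT hm, hR, add_assoc, hT.dbl_zero, add_zero]
  rw [hTT] at q1
  obtain ⟨rfl, rfl⟩ := h.inj q1
  exact hns (red17 h2 h3 (by simpa using q2) (by simpa using q3) hs hr)

end P4

open Polynomial
namespace P4

lemma v61 {x : ℚ} {n d : ℤ} (e : x = n / d) (hd : ¬ (61 : ℤ) ∣ d) [Fact (Nat.Prime 61)] :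
    Rat.padicValuation 61 x ≤ 1 := by
  rw [e, map_div₀, v_not_dvd (p := 61) hd, div_one]; exact v_int n

lemma v61' {x : ℚ} {n d : ℤ} (e : x = n / d) (hn : ¬ (61 : ℤ) ∣ n) (hd : ¬ (61 : ℤ) ∣ d)
    [Fact (Nat.Prime 61)] : Rat.padicValuation 61 x = 1 := by
  rw [e, map_div₀, v_not_dvd (p := 61) hd, v_not_dvd (p := 61) hn, div_one]

/-- `R = K + Q` with `K` in the kernel of reduction mod 61 -/
lemma core61 [Fact (Nat.Prime 61)] {K Q R : (EC 17 (-289)).Point} (hK : InK 61 K)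
    {x0 y0 ν0 : ℚ} (hQ : IsPt Q x0 y0) (hR : K + Q = R) {X Z ν r : ℚ} (h : IsPt R X Z)
    (hs : ν * (X + 9) = 2 * Z - 7 * X + 51) (hr : r ^ 2 = ν ^ 2 - 2 * ν + 17)
    (hs0 : ν0 * (x0 + 9) = 2 * y0 - 7 * x0 + 51)
    (nx dx ny dy nu du d n : ℤ) (ex : x0 = nx / dx) (hdx : ¬ (61 : ℤ) ∣ dx)
    (ey : y0 = ny / dy) (hdy : ¬ (61 : ℤ) ∣ dy)
    (eu : x0 + 9 = nu / du) (hnu : ¬ (61 : ℤ) ∣ nu) (hdu : ¬ (61 : ℤ) ∣ du)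
    (eq : ν0 ^ 2 - 2 * ν0 + 17 = n / d ^ 2) (hd : ¬ (61 : ℤ) ∣ d) (hd0 : d ≠ 0)
    (hns : ¬ IsSquare ((n : ℤ) : ZMod 61)) : False := by
  have vB : Rat.padicValuation 61 (-289 : ℚ) = 1 := by
    exact_mod_cast v_not_dvd (p := 61) (n := -289) (by norm_num)
  have hA : Rat.padicValuation 61 (17 : ℚ) ≤ 1 := by exact_mod_cast v_int (p := 61) 17
  have hx0 := v61 ex hdx
  obtain ⟨x3, y3, q1, -, -, q2, q3⟩ := hK.add_red hA vB.le hQ hx0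
  rw [hR] at q1
  obtain ⟨rfl, rfl⟩ := h.inj q1
  have := red17_gen (p := 61) (.of_near hx0 q2) (.of_near (v61 ey hdy) q3) hs hs0 (v61' eu hnu hdu) hr
  refine hns (isSquare_of_Cg (d := 1 / d) this (by rw [map_div₀, v_not_dvd (p := 61) hd]; simp) ?_)
  have : (d : ℚ) ≠ 0 := by exact_mod_cast hd0
  rw [eq]; field_simp

lemma ns61a : ¬ IsSquare ((62800 : ℤ) : ZMod 61) := by decide
lemma ns61b : ¬ IsSquare ((75354064 : ℤ) : ZMod 61) := by decide
lemma ns61c : ¬ IsSquare ((72852176036020 : ℤ) : ZMod 61) := by decide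
lemma ns61d : ¬ IsSquare ((18117051373393369 : ℤ) : ZMod 61) := by decide
lemma e17D : 2 * ((-2111017457 : ℤ) : ZMod 17) = 1 ^ 4 := by decide

lemma good2D : Good17 (-2111017457) 34998855 :=
  ⟨by decide, by decide, by rw [Int.isCoprime_iff_gcd_eq_one]; norm_num, by norm_num, by norm_num,
    by norm_num, 1, e17D⟩

lemma pt2D {D : (EC 17 (-289)).Point} (hD : IsPt D (34225/3249) (614015/185193)) :
    ∃ Y, IsPt (D + D) ((((-2111017457 : ℤ) : ℚ) / (34998855 : ℤ)) ^ 2) Y :=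
  ⟨_, hD.dbl_eq (by norm_num) (707344406/11666285) _ _ (by norm_num) (by norm_num) rfl⟩

lemma even_zsmul_T {A B : ℚ} {T : (EC A B).Point} (hT : IsPt T 0 0) (m : ℤ) :
    (2 * m) • T = 0 := by
  rw [mul_comm, mul_zsmul, two_zsmul, hT.dbl_zero, zsmul_zero]

lemma mod61 {D R : (EC 17 (-289)).Point} (hD : IsPt D (34225/3249) (614015/185193)) {N : ℤ}
    (hR : R = N • D) (hN : Odd N) {X Z ν r : ℚ} (h : IsPt R X Z)
    (hs : ν * (X + 9) = 2 * Z - 7 * X + 51) (hr : r ^ 2 = ν ^ 2 - 2 * ν + 17) : False := by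
  have : Fact (Nat.Prime 61) := ⟨by norm_num⟩
  obtain ⟨Y, h2⟩ := pt2D hD
  obtain ⟨a', b', ea, hg, Y', h4⟩ := good2D.step h2
  obtain ⟨T, hT⟩ := exists_isPt (A := 17) (B := -289) (by norm_num) (x := 0) (y := 0) (by norm_num)
  have vB : Rat.padicValuation 61 (-289 : ℚ) = 1 := by
    exact_mod_cast v_not_dvd (p := 61) (n := -289) (by norm_num)
  have hA : Rat.padicValuation 61 (17 : ℚ) ≤ 1 := by exact_mod_cast v_int (p := 61) 17
  have ha : ((61 : ℕ) : ℤ) ∣ a' := by push_cast; omega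
  have hpZ : Prime ((61 : ℕ) : ℤ) := Nat.prime_iff_prime_int.1 Fact.out
  have nb : ¬ ((61 : ℕ) : ℤ) ∣ b' := fun hb => hpZ.not_isUnit (hg.cop.isUnit_of_dvd' ha hb)
  have hx : Rat.padicValuation 61 (((a' : ℚ) / b') ^ 2) < 1 :=
    v_pow_lt (v_div_lt (v_dvd ha) (v_not_dvd nb)) two_ne_zero
  have hK := fun j : ℤ => (InK.of_T h4 hT hx vB).zsmul hA vB.le j
  have hDT : IsPt (D + T) (-938961/34225) (54673887/6331625) := by
    convert hD.addT hT (by norm_num) using 1 <;> norm_num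
  have hDT' : IsPt (-D + T) (-938961/34225) (-54673887/6331625) := by
    convert hD.neg.addT hT (by norm_num) using 1 <;> norm_num
  have hTT := hT.dbl_zero
  have hcase : N % 8 = 1 ∨ N % 8 = 3 ∨ N % 8 = 5 ∨ N % 8 = 7 := by
    obtain ⟨t, rfl⟩ := hN; omega
  have h4D : ∀ k : ℤ, k • (D + D + (D + D) + T) = (4 * k) • D + k • T := by
    intro k
    rw [zsmul_add, mul_comm, mul_zsmul]; congr 2
  rcases hcase with q | q | q | q
  · obtain ⟨j, rfl⟩ : ∃ j, N = 4 * (2 * j) + 1 := ⟨N / 8, by omega⟩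
    refine core61 (hK (2 * j)) hD ?_ h hs hr (ν0 := -47/57) (by norm_num)
      34225 3249 614015 185193 63466 3249 57 62800 (by norm_num) (by norm_num) (by norm_num) (by norm_num)
      (by norm_num) (by norm_num) (by norm_num) (by norm_num) (by norm_num) (by norm_num) ns61a
    rw [hR, h4D, even_zsmul_T hT, add_zero, add_zsmul, one_zsmul]
  · obtain ⟨j, rfl⟩ : ∃ j, N = 4 * (2 * j + 1) + (-1) := ⟨N / 8, by omega⟩
    refine core61 (hK (2 * j + 1)) hDT' ?_ h hs hr (ν0 := -119126633/9726930) (by norm_num)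
      (-938961) 34225 (-54673887) 6331625 (-630936) 34225 9726930 18117051373393369
      (by norm_num) (by norm_num) (by norm_num) (by norm_num)
      (by norm_num) (by norm_num) (by norm_num) (by norm_num) (by norm_num) (by norm_num) ns61d
    rw [hR, h4D, odd_zsmul_T hT ⟨j, rfl⟩, add_zsmul, neg_zsmul, one_zsmul]
    rw [show (4 * (2 * j + 1)) • D + T + (-D + T) = (4 * (2 * j + 1)) • D + -D + (T + T) by abel, hTT,
      add_zero]
  · obtain ⟨j, rfl⟩ : ∃ j, N = 4 * (2 * j + 1) + 1 := ⟨N / 8, by omega⟩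
    refine core61 (hK (2 * j + 1)) hDT ?_ h hs hr (ν0 := -7837/555) (by norm_num)
      (-938961) 34225 (54673887) 6331625 (-630936) 34225 555 75354064
      (by norm_num) (by norm_num) (by norm_num) (by norm_num)
      (by norm_num) (by norm_num) (by norm_num) (by norm_num) (by norm_num) (by norm_num) ns61b
    rw [hR, h4D, odd_zsmul_T hT ⟨j, rfl⟩, add_zsmul, one_zsmul]
    rw [show (4 * (2 * j + 1)) • D + T + (D + T) = (4 * (2 * j + 1)) • D + D + (T + T) by abel, hTT,
      add_zero]
  · obtain ⟨j, rfl⟩ : ∃ j, N = 4 * (2 * j) + (-1) := ⟨N / 8 + 1, by omega⟩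
    refine core61 (hK (2 * j)) hD.neg ?_ h hs hr (ν0 := -2719481/1808781) (by norm_num)
      34225 3249 (-614015) 185193 63466 3249 1808781 72852176036020
      (by norm_num) (by norm_num) (by norm_num) (by norm_num)
      (by norm_num) (by norm_num) (by norm_num) (by norm_num) (by norm_num) (by norm_num) ns61c
    rw [hR, h4D, even_zsmul_T hT, add_zero, add_zsmul, neg_zsmul, one_zsmul]

lemma end17 {a b : ℤ} (ha : 0 < a) (hb : 0 < b) (hab : IsCoprime a b) (h7 : ¬ 17 ∣ a)
    {x y ν r : ℚ} (hx : x = ((a : ℚ) / b) ^ 2) (he : y ^ 2 = x ^ 3 + 17 * x ^ 2 + (-289) * x)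
    (hs : ν * (x + 9) = 2 * y - 7 * x + 51) (hr : r ^ 2 = ν ^ 2 - 2 * ν + 17) : False := by
  obtain ⟨R, h⟩ := exists_isPt (A := 17) (B := -289) (by norm_num) he
  obtain ⟨P, hP⟩ := exists_isPt (A := 17) (B := -289) (by norm_num) (x := 289/9) (y := 5491/27)
    (by norm_num)
  obtain ⟨N, hR⟩ := mw17' hP ha hb hab h7 (hx ▸ h)
  have hD : IsPt (P + P) (34225/3249) (614015/185193) :=
    hP.dbl_eq (by norm_num) (182/19) _ _ (by norm_num) (by norm_num) (by norm_num)
  have hR : R = N • (P + P) := by rw [hR, add_zsmul, zsmul_add]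
  generalize P + P = D at hD hR
  have hN0 : N ≠ 0 := by
    rintro rfl
    rw [zero_zsmul] at hR
    exact h.ne_zero hR
  rcases Int.even_or_odd N with hN | hN
  · obtain ⟨k, m, hm, hkm⟩ : ∃ (k : ℕ) (m : ℤ), Odd m ∧ N = 2 ^ k * m := by
      obtain ⟨m, e, hm⟩ := (FiniteMultiplicity.of_prime_left Int.prime_two hN0).exists_eq_pow_mul_and_not_dvd
      exact ⟨_, m, Int.not_even_iff_odd.1 (fun q => hm (even_iff_two_dvd.1 q)), e⟩
    have hk : k ≠ 0 := by
      rintro rfl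
      rw [hkm] at hN
      simp at hN
      exact (Int.not_even_iff_odd.2 hm) hN
    obtain ⟨k, rfl⟩ := Nat.exists_eq_succ_of_ne_zero hk
    rw [Nat.succ_eq_add_one] at hkm
    obtain ⟨Y, h2⟩ := pt2D hD
    obtain ⟨a1, b1, hg, Y1, h3⟩ := seq17 good2D h2 k
    refine final17 hg h3 hm ?_ h hs hr
    rw [hR, hkm, ← two_zsmul, smul_smul, smul_smul]
    congr 1; ring
  · exact mod61 hD hR hN h hs hr

end P4

open Polynomial
namespace P4

lemma p17Z : Prime (17 : ℤ) := by
  have := Nat.prime_iff_prime_int.1 (by norm_num : Nat.Prime 17)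
  exact_mod_cast this

lemma prime_two_nat {p : ℕ} (hp : p.Prime) (h : (p : ℤ) ∣ 2) : p = 2 := by
  have : p ∣ 2 := by exact_mod_cast h
  exact (Nat.prime_dvd_prime_iff_eq hp Nat.prime_two).1 this

/-- common odd prime divisors are 17 -/
lemma d_common {m n : ℤ} (hmn : IsCoprime m n) {p : ℕ} (hp : p.Prime) (h2 : p ≠ 2)
    (h1 : (p : ℤ) ∣ m ^ 2 + 4 * n ^ 2) (h3 : (p : ℤ) ∣ m ^ 4 + 4 * n ^ 2 * (m + n) ^ 2) :
    p = 17 ∧ (p : ℤ) ∣ 2 * m + n ∧ ¬ (p : ℤ) ∣ n := by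
  have hpZ : Prime (p : ℤ) := Nat.prime_iff_prime_int.1 hp
  have hn : ¬ (p : ℤ) ∣ n := by
    intro hn
    have : (p : ℤ) ∣ m ^ 2 := by
      have e : m ^ 2 = (m ^ 2 + 4 * n ^ 2) - n * (4 * n) := by ring
      rw [e]; exact dvd_sub h1 (hn.mul_right _)
    exact not_both hpZ hmn (hpZ.dvd_of_dvd_pow this) hn
  have h4 : (p : ℤ) ∣ 2 ^ 2 * (n ^ 3 * (2 * m + n)) := by
    have e : 2 ^ 2 * (n ^ 3 * (2 * m + n)) = (m ^ 4 + 4 * n ^ 2 * (m + n) ^ 2) -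
      (m ^ 2 + 4 * n ^ 2) * (m ^ 2) := by ring
    rw [e]; exact dvd_sub h3 (h1.mul_right _)
  have h5 : (p : ℤ) ∣ 2 * m + n := by
    rcases hpZ.dvd_or_dvd h4 with q | q
    · exact absurd (prime_two_nat hp (hpZ.dvd_of_dvd_pow q)) h2
    · rcases hpZ.dvd_or_dvd q with q | q
      · exact absurd (hpZ.dvd_of_dvd_pow q) hn
      · exact q
  refine ⟨?_, h5, hn⟩
  have h6 : (p : ℤ) ∣ 17 * n ^ 2 := by
    have e : 17 * n ^ 2 = (m ^ 2 + 4 * n ^ 2) * 4 - (2 * m + n) * (2 * m - n) := by ring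
    rw [e]; exact dvd_sub (h1.mul_right _) (h5.mul_right _)
  rcases hpZ.dvd_or_dvd h6 with q | q
  · exact dvd17 hp (k := 1) (by simpa using q)
  · exact absurd (hpZ.dvd_of_dvd_pow q) hn

lemma d_split {m n : ℤ} (hn : 0 < n) (hmn : IsCoprime m n) {y : ℚ}
    (h : y ^ 2 = ((m ^ 2 + 4 * n ^ 2 : ℤ) : ℚ) * ((m ^ 4 + 4 * n ^ 2 * (m + n) ^ 2 : ℤ) : ℚ)) :
    (∃ p : ℚ, 0 < p ∧ ((m ^ 2 + 4 * n ^ 2 : ℤ) : ℚ) = p ^ 2) ∨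
      (∃ p : ℚ, 0 < p ∧ ((m ^ 2 + 4 * n ^ 2 : ℤ) : ℚ) = 17 * p ^ 2) := by
  have hpos : 0 < m ^ 2 + 4 * n ^ 2 := by positivity
  rcases Int.even_or_odd m with hm | hm
  · obtain ⟨k, rfl⟩ := hm
    have ho : Odd n := by
      rw [← Int.not_even_iff_odd]
      intro he
      exact not_both Int.prime_two hmn ⟨k, by ring⟩ (even_iff_two_dvd.1 he)
    have eA : (k + k) ^ 2 + 4 * n ^ 2 = 4 * (k ^ 2 + n ^ 2) := by ring
    have eB : (k + k) ^ 4 + 4 * n ^ 2 * (k + k + n) ^ 2 = 4 * (4 * k ^ 4 + n ^ 2 * (k + k + n) ^ 2) := by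
      ring
    obtain ⟨Y, hY⟩ := int_of_sq (k := (k ^ 2 + n ^ 2) * (4 * k ^ 4 + n ^ 2 * (k + k + n) ^ 2)) (q := y / 4)
      (by rw [eA, eB] at h; push_cast at h ⊢; rw [div_pow, h]; ring)
    rcases sq_or_17 (A := k ^ 2 + n ^ 2) (by positivity) hY (by
      intro p hp h1 h2
      refine (d_common hmn hp ?_ (eA ▸ h1.mul_left 4) (eB ▸ h2.mul_left 4)).1
      rintro rfl
      have : Odd (4 * k ^ 4 + n ^ 2 * (k + k + n) ^ 2) := by
        obtain ⟨t, rfl⟩ := ho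
        refine Even.add_odd ⟨2 * k ^ 4, by ring⟩ ?_
        exact (Odd.pow ⟨t, rfl⟩).mul (Odd.pow ⟨k + t, by ring⟩)
      exact (Int.not_even_iff_odd.2 this) (even_iff_two_dvd.2 h2)) with ⟨a, ha, e⟩ | ⟨a, ha, e⟩
    · left; refine ⟨2 * a, by exact_mod_cast (by linarith : 0 < 2 * a), ?_⟩
      rw [eA, e]; push_cast; ring
    · right; refine ⟨2 * a, by exact_mod_cast (by linarith : 0 < 2 * a), ?_⟩
      rw [eA, e]; push_cast; ring
  · obtain ⟨Y, hY⟩ := int_of_sq (k := (m ^ 2 + 4 * n ^ 2) * (m ^ 4 + 4 * n ^ 2 * (m + n) ^ 2)) (q := y)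
      (by rw [h]; push_cast; ring)
    rcases sq_or_17 hpos hY (by
      intro p hp h1 h2
      refine (d_common hmn hp ?_ h1 h2).1
      rintro rfl
      have : Odd (m ^ 2 + 4 * n ^ 2) := hm.pow.add_even ⟨2 * n ^ 2, by ring⟩
      exact (Int.not_even_iff_odd.2 this) (even_iff_two_dvd.2 h1)) with ⟨a, ha, e⟩ | ⟨a, ha, e⟩
    · left; exact ⟨a, by exact_mod_cast ha, by rw [e]; push_cast; ring⟩
    · right; exact ⟨a, by exact_mod_cast ha, by rw [e]; push_cast; ring⟩

lemma int17 {A : ℤ} {p : ℚ} (h : (A : ℚ) = 17 * p ^ 2) : ∃ k : ℤ, A = 17 * k ^ 2 := by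
  obtain ⟨k, hk⟩ := int_of_sq (k := 17 * A) (q := 17 * p) (by push_cast; rw [h]; ring)
  have : (17 : ℤ) ∣ k := p17Z.dvd_of_dvd_pow (n := 2) ⟨A, by rw [← hk]⟩
  obtain ⟨k, rfl⟩ := this
  exact ⟨k, by linarith⟩

/-- the elliptic curve part -/
lemma d_end {n L V : ℤ} (hL : L ≠ 0) (hn : ¬ (17 : ℤ) ∣ n)
    (hV : V ^ 2 = n ^ 4 + 28 * n ^ 3 * L + 374 * n ^ 2 * L ^ 2 - 1156 * n * L ^ 3 + 4913 * L ^ 4)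
    (hpos : 0 < V + n ^ 2 + 14 * n * L + 17 * L ^ 2)
    {r : ℚ} (hr : r ^ 2 = ((n : ℚ) / L) ^ 2 - 2 * (n / L) + 17) : False := by
  have hLq : (L : ℚ) ≠ 0 := by exact_mod_cast hL
  have hVq : (V : ℚ) ^ 2 = n ^ 4 + 28 * n ^ 3 * L + 374 * n ^ 2 * L ^ 2 - 1156 * n * L ^ 3 + 4913 * L ^ 4 := by
    exact_mod_cast hV
  have hpq : (0 : ℚ) < V + n ^ 2 + 14 * n * L + 17 * L ^ 2 := by exact_mod_cast hpos
  obtain ⟨x, hx⟩ : ∃ x : ℚ, x = (V + n ^ 2 + 14 * n * L + 17 * L ^ 2) / (8 * L ^ 2) := ⟨_, rfl⟩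
  have hx' : 8 * (L : ℚ) ^ 2 * x = V + n ^ 2 + 14 * n * L + 17 * L ^ 2 := by rw [hx]; field_simp
  have hx0 : 0 < x := by rw [hx]; positivity
  obtain ⟨ν, hν⟩ : ∃ ν : ℚ, ν = n / L := ⟨_, rfl⟩
  have hn' : (n : ℚ) = ν * L := by rw [hν]; field_simp
  have hq : (x + 9) * ν ^ 2 + (14 * x - 102) * ν - (4 * x ^ 2 - 17 * x - 289) = 0 := by
    have hL4 : (16 * (L : ℚ) ^ 4) ≠ 0 := by positivity
    apply mul_left_cancel₀ hL4
    rw [hn'] at hVq hx'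
    have hV' : (V : ℚ) = 8 * L ^ 2 * x - (ν * L) ^ 2 - 14 * (ν * L) * L - 17 * L ^ 2 := by linarith
    rw [hV'] at hVq
    linear_combination (-1) * hVq
  have he : (((x + 9) * ν + 7 * x - 51) / 2) ^ 2 = x ^ 3 + 17 * x ^ 2 + (-289) * x := by
    linear_combination (x + 9) / 4 * hq
  obtain ⟨ξ, hξ, e⟩ := class17 he hx0
  obtain ⟨a, b, ha, hb, hab, e2⟩ := frac_pos hξ
  refine end17 ha hb hab ?_ (e.trans e2) he (ν := ν) (by ring) (by rw [hν]; exact hr)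
  intro h17
  have hbq : (b : ℚ) ≠ 0 := by exact_mod_cast hb.ne'
  have e3 : (V + n ^ 2 + 14 * n * L + 17 * L ^ 2) * b ^ 2 = 8 * L ^ 2 * a ^ 2 := by
    have : ((V : ℚ) + n ^ 2 + 14 * n * L + 17 * L ^ 2) * b ^ 2 = 8 * L ^ 2 * a ^ 2 := by
      rw [← hx', e, e2]; field_simp
    exact_mod_cast this
  have e4 : a ^ 2 * (n ^ 2 + 14 * n * L + 17 * L ^ 2 - V) = -2 * (3 * n - 17 * L) ^ 2 * b ^ 2 := by
    have hL4 : 8 * L ^ 2 ≠ 0 := by positivity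
    apply mul_left_cancel₀ hL4
    linear_combination (-(n ^ 2 + 14 * n * L + 17 * L ^ 2 - V)) * e3 - b ^ 2 * hV
  have h5 : (17 : ℤ) ∣ 2 * ((3 * n - 17 * L) ^ 2 * b ^ 2) := by
    rw [show 2 * ((3 * n - 17 * L) ^ 2 * b ^ 2) = a * (-a * (n ^ 2 + 14 * n * L + 17 * L ^ 2 - V)) by
      linear_combination e4]
    exact h17.mul_right _
  rcases p17Z.dvd_or_dvd h5 with q | q
  · norm_num at q
  rcases p17Z.dvd_or_dvd q with q | q
  · have := p17Z.dvd_of_dvd_pow q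
    omega
  · exact not_both p17Z hab h17 (p17Z.dvd_of_dvd_pow q)

/-- (d) -/
theorem lem_d {z y : ℚ} (hz : z ≠ 0) (h : y ^ 2 = (z ^ 2 + 4) * (z ^ 4 + 4 * (z + 1) ^ 2)) :
    z = -1 / 2 := by
  obtain ⟨m, n, hmn, hn, hzz⟩ := rat_frac z
  have hnq : (n : ℚ) ≠ 0 := by exact_mod_cast hn.ne'
  have eA : ((m ^ 2 + 4 * n ^ 2 : ℤ) : ℚ) = n ^ 2 * (z ^ 2 + 4) := by
    rw [hzz]; push_cast; field_simp
  have eB : ((m ^ 4 + 4 * n ^ 2 * (m + n) ^ 2 : ℤ) : ℚ) = n ^ 4 * (z ^ 4 + 4 * (z + 1) ^ 2) := by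
    rw [hzz]; push_cast; field_simp
  rcases d_split hn hmn (y := n ^ 3 * y) (by rw [eA, eB, mul_pow, h]; ring) with ⟨p, hp, e⟩ | ⟨p, hp, e⟩
  · exfalso
    have e1 : z ^ 2 + 4 = (p / n) ^ 2 := by rw [div_pow, ← e, eA]; field_simp
    have := quart_d hz (w := y / (p / n)) (by rw [div_pow, h, ← e1]; field_simp)
    subst this
    have : IsSquare (5 : ℚ) := ⟨p / n, by rw [← sq, ← e1]; norm_num⟩
    rw [show (5 : ℚ) = ((5 : ℕ) : ℚ) by norm_num, Rat.isSquare_natCast_iff] at this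
    revert this; decide +kernel
  · have hz4 : z ^ 2 + 4 ≠ 0 := by positivity
    have eB' : ((m ^ 4 + 4 * n ^ 2 * (m + n) ^ 2 : ℤ) : ℚ) = 17 * (n ^ 3 * y / (17 * p)) ^ 2 := by
      rw [eB, div_pow, mul_pow, mul_pow, h]
      have : n ^ 2 * (z ^ 2 + 4) = 17 * p ^ 2 := by rw [← eA, e]
      field_simp
      linear_combination -this
    obtain ⟨a, ha⟩ := int17 e
    obtain ⟨W, hW⟩ := int17 eB'
    obtain ⟨-, h1, h2⟩ := d_common hmn (p := 17) (by norm_num) (by norm_num) ⟨a ^ 2, ha⟩ ⟨W ^ 2, hW⟩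
    obtain ⟨L, hL⟩ := h1
    push_cast at hL h2
    have hmq : (m : ℚ) = (17 * L - n) / 2 := by
      have : 2 * (m : ℚ) + n = 17 * L := by exact_mod_cast hL
      linarith
    by_cases hL0 : L = 0
    · rw [hzz, hmq, hL0]; field_simp; push_cast; ring
    exfalso
    have hLq : (L : ℚ) ≠ 0 := by exact_mod_cast hL0
    have hV : (4 * W) ^ 2 = n ^ 4 + 28 * n ^ 3 * L + 374 * n ^ 2 * L ^ 2 - 1156 * n * L ^ 3 + 4913 * L ^ 4 := by
      have : (m : ℚ) ^ 4 + 4 * n ^ 2 * (m + n) ^ 2 = 17 * W ^ 2 := by exact_mod_cast hW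
      rw [hmq] at this
      have : (4 * (W : ℚ)) ^ 2 = n ^ 4 + 28 * n ^ 3 * L + 374 * n ^ 2 * L ^ 2 - 1156 * n * L ^ 3 + 4913 * L ^ 4 := by
        linear_combination (-16 / 17) * this
      exact_mod_cast this
    have hr : (2 * p / L) ^ 2 = ((n : ℚ) / L) ^ 2 - 2 * (n / L) + 17 := by
      have : (m : ℚ) ^ 2 + 4 * n ^ 2 = 17 * p ^ 2 := by rw [← e]; push_cast; ring
      rw [hmq] at this
      field_simp
      linear_combination (-4 / 17) * this
    have h3 : 3 * n - 17 * L ≠ 0 := by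
      intro q
      exact h2 (by omega)
    have hprod : (4 * W + (n ^ 2 + 14 * n * L + 17 * L ^ 2)) * (-(4 * W) + (n ^ 2 + 14 * n * L + 17 * L ^ 2))
        = -(16 * L ^ 2 * (3 * n - 17 * L) ^ 2) := by linear_combination -hV
    have hneg : 0 < 16 * L ^ 2 * (3 * n - 17 * L) ^ 2 := by positivity
    by_cases hc : 0 < 4 * W + (n ^ 2 + 14 * n * L + 17 * L ^ 2)
    · exact d_end hL0 h2 hV (by linarith) hr
    · refine d_end hL0 h2 (V := -(4 * W)) (by rw [neg_sq]; exact hV) ?_ hr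
      by_contra hc2
      have := mul_nonneg_of_nonpos_of_nonpos (not_lt.1 hc) (b := -(4 * W) + (n ^ 2 + 14 * n * L + 17 * L ^ 2)) (by linarith)
      linarith

end P4

open Polynomial
namespace P4

abbrev Ix := Fin 3 × ZMod 4

/-- the permutation `(i,k) ↦ (π i, a i + k)` -/
def mk (π : Equiv.Perm (Fin 3)) (a : Fin 3 → ZMod 4) : Equiv.Perm Ix where
  toFun x := (π x.1, a x.1 + x.2)
  invFun x := (π.symm x.1, x.2 - a (π.symm x.1))
  left_inv x := by ext <;> simp
  right_inv x := by ext <;> simp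

lemma mk_apply (π : Equiv.Perm (Fin 3)) (a : Fin 3 → ZMod 4) (i : Fin 3) (k : ZMod 4) :
    mk π a (i, k) = (π i, a i + k) := rfl

lemma mk_mul (π ρ : Equiv.Perm (Fin 3)) (a b : Fin 3 → ZMod 4) :
    mk π a * mk ρ b = mk (π * ρ) (fun i => b i + a (ρ i)) := by
  ext x
  · rfl
  · simp [mk]; ring

lemma mk_one : mk 1 0 = 1 := by
  ext x
  · rfl
  · simp [mk]

lemma mk_inv (π : Equiv.Perm (Fin 3)) (a : Fin 3 → ZMod 4) :
    (mk π a)⁻¹ = mk π⁻¹ (fun i => - a (π⁻¹ i)) := by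
  rw [inv_eq_iff_mul_eq_one, mk_mul, mul_inv_cancel, ← mk_one]
  congr 1; funext i; simp

lemma mk_inj {π ρ : Equiv.Perm (Fin 3)} {a b : Fin 3 → ZMod 4} (h : mk π a = mk ρ b) :
    π = ρ ∧ a = b := by
  constructor
  · ext i
    have := congrArg (fun g => (g (i, 0)).1) h
    simpa [mk] using congrArg Fin.val this
  · funext i
    have := congrArg (fun g => (g (i, 0)).2) h
    simpa [mk] using this

/-- total shift -/
def tot (a : Fin 3 → ZMod 4) : ZMod 4 := a 0 + a 1 + a 2

lemma tot_comp (π : Equiv.Perm (Fin 3)) (a : Fin 3 → ZMod 4) : tot (fun i => a (π i)) = tot a := by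
  have h : ∀ a : Fin 3 → ZMod 4, tot a = ∑ i, a i := fun a => by rw [Fin.sum_univ_three]; rfl
  rw [h, h]; exact Equiv.sum_comp π a

lemma tot_add (a b : Fin 3 → ZMod 4) : tot (fun i => a i + b i) = tot a + tot b := by
  simp only [tot]; ring

/-- lemma on vectors: an odd vector of even total has two entries of distinct parity -/
lemma vec1 : ∀ b : Fin 3 → ZMod 4, (tot b = 0 ∨ tot b = 2) → (∃ i, b i = 1 ∨ b i = 3) →
    ∃ i j, i ≠ j ∧ (b i - b j = 1 ∨ b i - b j = 3) := by decide +kernel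

lemma perm_cases : ∀ i j k l : Fin 3, i ≠ j → k ≠ l → ∃ π : Equiv.Perm (Fin 3), π i = k ∧ π j = l := by
  decide +kernel

lemma cube_cases : ∀ π : Equiv.Perm (Fin 3), Equiv.Perm.sign π = 1 →
    π * π * π = 1 ∧ (π = 1 ∨ ∀ a : Fin 3 → ZMod 4, ∀ i, a i + a (π i) + a (π (π i)) = tot a) := by
  decide +kernel

section crit
variable (H : Subgroup (Equiv.Perm Ix))

lemma crit (h0 : ∀ g ∈ H, ∃ π a, g = mk π a ∧ (tot a = 0 ∨ tot a = 2))
    (h1 : ∀ π, ∃ a, mk π a ∈ H)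
    (h2 : ∃ a, mk 1 a ∈ H ∧ ∃ i, a i = 1 ∨ a i = 3)
    (h3 : ∃ π a, mk π a ∈ H ∧ Equiv.Perm.sign π = 1 ∧ tot a = 2) (g : Equiv.Perm Ix) :
    g ∈ H ↔ ∃ π a, g = mk π a ∧ (tot a = 0 ∨ tot a = 2) := by
  have h0' : ∀ π a, mk π a ∈ H → (tot a = 0 ∨ tot a = 2) := by
    intro π a h
    obtain ⟨ρ, b, e, hb⟩ := h0 _ h
    rw [(mk_inj e).2]; exact hb
  refine ⟨h0 g, ?_⟩
  -- the additive subgroup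
  have addc : ∀ a b, mk 1 a ∈ H → mk 1 b ∈ H → mk 1 (a + b) ∈ H := by
    intro a b ha hb
    have := H.mul_mem ha hb
    rw [mk_mul] at this
    convert this using 2
    · rfl
    · funext i; simp [add_comm]
  have negc : ∀ a, mk 1 a ∈ H → mk 1 (-a) ∈ H := by
    intro a ha
    have := H.inv_mem ha
    rw [mk_inv] at this
    convert this using 2
    · rfl
    · rfl
  have zeroc : mk 1 0 ∈ H := by rw [mk_one]; exact H.one_mem
  let S : AddSubgroup (Fin 3 → ZMod 4) :=
    { carrier := {a | mk 1 a ∈ H}, add_mem' := addc _ _, zero_mem' := zeroc, neg_mem' := negc _ }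
  have hS : ∀ a, a ∈ S ↔ mk 1 a ∈ H := fun a => Iff.rfl
  have conj : ∀ (π : Equiv.Perm (Fin 3)) a, a ∈ S → (fun i => a (π i)) ∈ S := by
    intro π b hb
    obtain ⟨a, ha⟩ := h1 π
    have := H.mul_mem (H.mul_mem (H.inv_mem ha) hb) ha
    rw [mul_assoc, mk_mul, mk_inv, mk_mul] at this
    rw [hS]
    convert this using 2
    · simp
    · funext i; simp
  -- basic differences
  have hd : ∃ i j : Fin 3, i ≠ j ∧ (Pi.single i 1 - Pi.single j 1 : Fin 3 → ZMod 4) ∈ S := by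
    obtain ⟨b, hb, ho⟩ := h2
    obtain ⟨i, j, hij, hbb⟩ := vec1 b (h0' _ _ hb) ho
    refine ⟨i, j, hij, ?_⟩
    have e1 : b - (fun k => b (Equiv.swap i j k)) ∈ S := S.sub_mem hb (conj _ _ hb)
    have e2 : b - (fun k => b (Equiv.swap i j k)) = (b i - b j) • (Pi.single i 1 - Pi.single j 1 : Fin 3 → ZMod 4) := by
      funext k
      by_cases hi : k = i
      · subst hi; simp [hij]
      · by_cases hj : k = j
        · subst hj; simp [Ne.symm hij]
        · simp [hi, hj, Equiv.swap_apply_of_ne_of_ne hi hj]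
    rw [e2] at e1
    rcases hbb with q | q
    · rw [q, one_smul] at e1; exact e1
    · rw [q, show (3 : ZMod 4) = -1 by decide, neg_smul, one_smul] at e1
      simpa using S.neg_mem e1
  have hdd : ∀ k l : Fin 3, k ≠ l → (Pi.single k 1 - Pi.single l 1 : Fin 3 → ZMod 4) ∈ S := by
    intro k l hkl
    obtain ⟨i, j, hij, h⟩ := hd
    obtain ⟨π, p1, p2⟩ := perm_cases k l i j hkl hij
    convert conj π _ h using 1
    funext t
    simp only [Pi.sub_apply, Pi.single_apply, ← p1, ← p2, π.injective.eq_iff]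
  have smulc : ∀ (n : ZMod 4) a, a ∈ S → n • a ∈ S := by
    intro n a ha
    have : n • a = n.val • a := by
      rw [← Nat.cast_smul_eq_nsmul (ZMod 4), ZMod.natCast_zmod_val]
    rw [this]; exact S.nsmul_mem ha _
  have hN0 : ∀ a, tot a = 0 → a ∈ S := by
    intro a ha
    have e : a = a 0 • (Pi.single 0 1 - Pi.single 2 1 : Fin 3 → ZMod 4) +
        a 1 • (Pi.single 1 1 - Pi.single 2 1 : Fin 3 → ZMod 4) := by
      funext t
      fin_cases t
      · simp
      · simp
      · simp; simp only [tot] at ha; linear_combination ha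
    rw [e]
    exact S.add_mem (smulc _ _ (hdd _ _ (by decide))) (smulc _ _ (hdd _ _ (by decide)))
  have hc : ∃ a ∈ S, tot a = 2 := by
    obtain ⟨π, a, ha, hs, ht⟩ := h3
    obtain ⟨q1, q2⟩ := cube_cases π hs
    rcases q2 with rfl | q2
    · exact ⟨a, ha, ht⟩
    · refine ⟨fun _ => 2, ?_, by decide⟩
      have := H.mul_mem (H.mul_mem ha ha) ha
      rw [mul_assoc, mk_mul, mk_mul, ← mul_assoc, q1] at this
      rw [hS]
      convert this using 2
      funext i
      rw [← ht, ← q2 a i]; rfl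
  have hN : ∀ a, (tot a = 0 ∨ tot a = 2) → a ∈ S := by
    rintro a (ha | ha)
    · exact hN0 a ha
    · obtain ⟨c, hc, e⟩ := hc
      have : a - c ∈ S := hN0 _ (by
        have : tot (a - c) = tot a - tot c := by simp only [tot, Pi.sub_apply]; ring
        rw [this, ha, e, sub_self])
      simpa using S.add_mem this hc
  rintro ⟨π, a, rfl, ha⟩
  obtain ⟨b, hb⟩ := h1 π
  have hab : a - b ∈ S := hN _ (by
    have : tot (a - b) = tot a - tot b := by simp only [tot, Pi.sub_apply]; ring
    rw [this]
    rcases ha with q | q <;> rcases h0' _ _ hb with q' | q' <;> rw [q, q'] <;> decide)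
  have := H.mul_mem hb hab
  rw [mk_mul] at this
  convert this using 2
  · rfl
  · funext i; simp
end crit

/-- parity -/
def par (k : ZMod 4) : ZMod 2 := ZMod.castHom (by norm_num : 2 ∣ 4) (ZMod 2) k

lemma par_add (k l : ZMod 4) : par (k + l) = par k + par l := map_add _ _ _
lemma par_zero : par 0 = 0 := by decide
lemma par_ne : ∀ k : ZMod 4, par k ≠ 0 → k = 1 ∨ k = 3 := by decide
lemma par_tot : ∀ k : ZMod 4, (k = 0 ∨ k = 2) → par k = 0 := by decide

lemma s3gen : ∀ τ : Equiv.Perm (Fin 3), Equiv.Perm.sign τ = -1 → ∃ i, τ i = i ∧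
    ∀ ρ : Equiv.Perm (Fin 3), ρ i ≠ i → ∀ π, π = 1 ∨ π = τ ∨ π = ρ ∨ π = τ * ρ ∨ π = ρ * τ ∨
      π = ρ * ρ ∨ π = τ * ρ * τ ∨ π = ρ * τ * ρ ∨ π = τ * ρ * ρ ∨ π = ρ * ρ * τ := by decide +kernel

/-- the 3-cycle and the transposition -/
def cc : Equiv.Perm (Fin 3) := finRotate 3
def tt : Equiv.Perm (Fin 3) := Equiv.swap 0 1

lemma s3ct : ∀ π : Equiv.Perm (Fin 3), π = 1 ∨ π = cc ∨ π = cc * cc ∨ π = tt ∨ π = tt * cc ∨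
    π = tt * (cc * cc) := by decide +kernel

lemma ct_rel : tt * (cc * (tt * cc)) = 1 ∧ tt * tt = 1 := by decide +kernel

set_option synthInstance.maxSize 2000 in
set_option synthInstance.maxHeartbeats 200000 in
lemma cocyc : ∀ x y : Fin 3 → ZMod 2, x 0 + x 1 + x 2 = 0 → y 0 + y 1 + y 2 = 0 →
    (∀ i, y i + y (tt i) = 0) →
    (∀ i, ((x i + y (cc i)) + x ((tt * cc) i)) + y ((cc * (tt * cc)) i) = 0) →
    ∃ e : Fin 3 → ZMod 2, e 0 + e 1 + e 2 = 0 ∧ (∀ i, e (cc i) = e i + x i) ∧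
      (∀ i, e (tt i) = e i + y i) := by decide +kernel

lemma crit2 (H : Subgroup (Equiv.Perm Ix))
    (h0 : ∀ g ∈ H, ∃ π a, g = mk π a ∧ (tot a = 0 ∨ tot a = 2))
    (hd : ∀ i, ∃ π a, mk π a ∈ H ∧ π i ≠ i)
    (ha : ∃ π a, mk π a ∈ H ∧ Equiv.Perm.sign π = -1)
    (hb : ∃ π a, mk π a ∈ H ∧ tot a = 2)
    (hc : ∃ π a, mk π a ∈ H ∧ (Equiv.Perm.sign π = -1 ∧ tot a = 0 ∨ Equiv.Perm.sign π = 1 ∧ tot a = 2))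
    (he : ∀ e : Fin 3 → ZMod 2, e 0 + e 1 + e 2 = 0 →
      ∃ π a, mk π a ∈ H ∧ ∃ i, e (π i) ≠ e i + par (a i)) (g : Equiv.Perm Ix) :
    g ∈ H ↔ ∃ π a, g = mk π a ∧ (tot a = 0 ∨ tot a = 2) := by
  have h0' : ∀ π a, mk π a ∈ H → (tot a = 0 ∨ tot a = 2) := by
    intro π a h
    obtain ⟨ρ, b, e, hb⟩ := h0 _ h
    rw [(mk_inj e).2]; exact hb
  have mulc : ∀ {π ρ a b}, mk π a ∈ H → mk ρ b ∈ H → mk (π * ρ) (fun i => b i + a (ρ i)) ∈ H := by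
    intro π ρ a b h1 h2
    rw [← mk_mul]; exact H.mul_mem h1 h2
  have h1 : ∀ π, ∃ a, mk π a ∈ H := by
    let Q : Equiv.Perm (Fin 3) → Prop := fun π => ∃ a, mk π a ∈ H
    have qm : ∀ {π ρ}, Q π → Q ρ → Q (π * ρ) := by
      rintro π ρ ⟨a, h1⟩ ⟨b, h2⟩
      exact ⟨_, mulc h1 h2⟩
    obtain ⟨τ, a, hτ, hs⟩ := ha
    obtain ⟨i, -, hi⟩ := s3gen τ hs
    obtain ⟨ρ, b, hρ, hri⟩ := hd i
    have q1 : Q 1 := ⟨0, by rw [mk_one]; exact H.one_mem⟩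
    have q2 : Q τ := ⟨a, hτ⟩
    have q3 : Q ρ := ⟨b, hρ⟩
    intro π
    change Q π
    rcases hi ρ hri π with r | r | r | r | r | r | r | r | r | r <;> rw [r]
    · exact q1
    · exact q2
    · exact q3
    · exact qm q2 q3
    · exact qm q3 q2
    · exact qm q3 q3
    · exact qm (qm q2 q3) q2
    · exact qm (qm q3 q2) q3
    · exact qm (qm q2 q3) q3
    · exact qm (qm q3 q3) q2
  refine crit H h0 h1 ?_ ?_ g
  · by_contra hcon
    have hker : ∀ a, mk 1 a ∈ H → ∀ i, par (a i) = 0 := by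
      intro a h i
      by_contra q
      exact hcon ⟨a, h, i, par_ne _ q⟩
    choose A hA using h1
    have same : ∀ π a b, mk π a ∈ H → mk π b ∈ H → ∀ i, par (a i) = par (b i) := by
      intro π a b h1 h2 i
      have h := H.mul_mem (H.inv_mem h1) h2
      rw [mk_inv, mk_mul, inv_mul_cancel] at h
      have := hker _ h i
      rw [show π⁻¹ (π i) = i from π.symm_apply_apply i, ← sub_eq_add_neg] at this
      simp only [par, map_sub] at this ⊢
      linear_combination -this
    have coc : ∀ π ρ i, par (A (π * ρ) i) = par (A ρ i) + par (A π (ρ i)) := by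
      intro π ρ i
      rw [← par_add]
      exact same _ _ _ (hA _) (mulc (hA π) (hA ρ)) i
    have c1 : ∀ i, par (A 1 i) = 0 := hker _ (hA 1)
    have ctot : ∀ π, par (A π 0) + par (A π 1) + par (A π 2) = 0 := by
      intro π
      rw [← par_add, ← par_add]
      exact par_tot _ (h0' _ _ (hA π))
    obtain ⟨e, e0, ec, et⟩ := cocyc (fun i => par (A cc i)) (fun i => par (A tt i)) (ctot _) (ctot _)
      (by
        intro i
        have := coc tt tt i
        rw [ct_rel.2, c1] at this
        exact this.symm)
      (by
        intro i
        have := coc tt (cc * (tt * cc)) i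
        rw [ct_rel.1, c1, coc cc, coc tt] at this
        exact this.symm)
    have em : ∀ π ρ, (∀ i, e (π i) = e i + par (A π i)) → (∀ i, e (ρ i) = e i + par (A ρ i)) →
        ∀ i, e ((π * ρ) i) = e i + par (A (π * ρ) i) := by
      intro π ρ h1 h2 i
      rw [Equiv.Perm.mul_apply, h1, h2, coc, add_assoc]
    obtain ⟨π, a, hπ, i, hi⟩ := he e e0
    rw [same _ _ _ hπ (hA π)] at hi
    apply hi
    have hcc := em _ _ ec ec
    have h1 : ∀ i, e ((1 : Equiv.Perm (Fin 3)) i) = e i + par (A 1 i) := by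
      intro i; rw [c1, add_zero]; rfl
    rcases s3ct π with r | r | r | r | r | r <;> rw [r]
    · exact h1 i
    · exact ec i
    · exact hcc i
    · exact et i
    · exact em _ _ et ec i
    · exact em _ _ et hcc i
  · obtain ⟨π, a, hπ, ht⟩ := hb
    rcases Int.units_eq_one_or (Equiv.Perm.sign π) with s | s
    · exact ⟨π, a, hπ, s, ht⟩
    obtain ⟨ρ, b, hρ, ⟨s', t'⟩ | ⟨s', t'⟩⟩ := hc
    · refine ⟨_, _, mulc hπ hρ, by rw [map_mul, s, s']; rfl, ?_⟩
      rw [tot_add, tot_comp, ht, t', zero_add]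
    · exact ⟨ρ, b, hρ, s', t'⟩

end P4

open Polynomial
namespace P4

/-- relabelling -/
def e12 : Fin 12 ≃ Ix where
  toFun n := (⟨n.1 / 4, by omega⟩, (n.1 : ZMod 4))
  invFun x := ⟨4 * x.1.1 + x.2.val, by have := x.2.val_lt; have := x.1.2; omega⟩
  left_inv := by decide
  right_inv := by decide

def sw12 : Equiv.Perm (Fin 3) := Equiv.swap 1 2
def rot : Equiv.Perm (Fin 3) := (finRotate 3)⁻¹

lemma gen1 : e12.permCongrHom (([4, 7, 6, 5] : List (Fin 12)).formPerm *
    ([8, 11, 10, 9] : List (Fin 12)).formPerm) = mk 1 ![0, 3, 3] := by decide +kernel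
lemma gen2 : e12.permCongrHom (([0, 2] : List (Fin 12)).formPerm * ([1, 3] : List (Fin 12)).formPerm *
       ([4, 9, 6, 11] : List (Fin 12)).formPerm * ([5, 10, 7, 8] : List (Fin 12)).formPerm)
       = mk sw12 ![2, 1, 1] := by decide +kernel
lemma gen3 : e12.permCongrHom (([0, 11, 6] : List (Fin 12)).formPerm * ([1, 8, 7] : List (Fin 12)).formPerm *
       ([2, 9, 4] : List (Fin 12)).formPerm * ([3, 10, 5] : List (Fin 12)).formPerm)
       = mk rot ![3, 2, 3] := by decide +kernel

lemma s3sr : ∀ π : Equiv.Perm (Fin 3), π = 1 ∨ π = rot ∨ π = rot * rot ∨ π = sw12 ∨ π = sw12 * rot ∨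
    π = sw12 * (rot * rot) := by decide +kernel

lemma W_mul {x y : ZMod 4} (hx : x = 0 ∨ x = 2) (hy : y = 0 ∨ y = 2) : x + y = 0 ∨ x + y = 2 := by
  revert x y; decide
lemma W_neg {x : ZMod 4} (hx : x = 0 ∨ x = 2) : -x = 0 ∨ -x = 2 := by
  revert x; decide

lemma mem_G (g : Equiv.Perm Ix) : g ∈ Ggroup.map (e12.permCongrHom : _ →* Equiv.Perm Ix) ↔
    ∃ π a, g = mk π a ∧ (tot a = 0 ∨ tot a = 2) := by
  have eH : Ggroup.map (e12.permCongrHom : _ →* Equiv.Perm Ix) =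
      Subgroup.closure {mk 1 ![0, 3, 3], mk sw12 ![2, 1, 1], mk rot ![3, 2, 3]} := by
    rw [Ggroup, MonoidHom.map_closure, Set.image_insert_eq, Set.image_insert_eq, Set.image_singleton]
    rw [← gen1, ← gen2, ← gen3]; rfl
  rw [eH]
  set H := Subgroup.closure {mk 1 ![0, 3, 3], mk sw12 ![2, 1, 1], mk rot ![3, 2, 3]}
  have m1 : mk 1 ![0, 3, 3] ∈ H := Subgroup.subset_closure (by simp)
  have m2 : mk sw12 ![2, 1, 1] ∈ H := Subgroup.subset_closure (by simp)
  have m3 : mk rot ![3, 2, 3] ∈ H := Subgroup.subset_closure (by simp)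
  refine crit H ?_ ?_ ?_ ?_ g
  · intro g hg
    induction hg using Subgroup.closure_induction with
    | mem x hx =>
      rcases hx with rfl | rfl | rfl
      · exact ⟨_, _, rfl, by decide⟩
      · exact ⟨_, _, rfl, by decide⟩
      · exact ⟨_, _, rfl, by decide⟩
    | one => exact ⟨1, 0, mk_one.symm, by decide⟩
    | mul x y _ _ hx hy =>
      obtain ⟨π, a, rfl, ha⟩ := hx
      obtain ⟨ρ, b, rfl, hb⟩ := hy
      refine ⟨_, _, mk_mul _ _ _ _, ?_⟩
      rw [tot_add, tot_comp]; exact W_mul hb ha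
    | inv x _ hx =>
      obtain ⟨π, a, rfl, ha⟩ := hx
      refine ⟨_, _, mk_inv _ _, ?_⟩
      rw [tot_comp π⁻¹ (fun i => - a i)]
      have : tot (fun i => - a i) = - tot a := by simp only [tot]; ring
      rw [this]; exact W_neg ha
  · let Q : Equiv.Perm (Fin 3) → Prop := fun π => ∃ a, mk π a ∈ H
    have qm : ∀ {π ρ}, Q π → Q ρ → Q (π * ρ) := by
      rintro π ρ ⟨a, h1⟩ ⟨b, h2⟩
      exact ⟨_, by rw [← mk_mul]; exact H.mul_mem h1 h2⟩
    have q2 : Q sw12 := ⟨_, m2⟩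
    have q3 : Q rot := ⟨_, m3⟩
    intro π
    change Q π
    rcases s3sr π with r | r | r | r | r | r <;> rw [r]
    · exact ⟨_, m1⟩
    · exact q3
    · exact qm q3 q3
    · exact q2
    · exact qm q2 q3
    · exact qm q2 (qm q3 q3)
  · exact ⟨_, m1, 1, by decide⟩
  · exact ⟨_, _, m1, by decide, by decide⟩

end P4

open Polynomial
namespace P4

/-- the data of the three 4-cycles -/
structure RD (K : Type*) [Field K] (c Q : K) where
  z : Fin 3 → K
  d : Fin 3 → K
  ep : Fin 3 → K
  e1 : z 0 + z 1 + z 2 = 0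
  e2 : z 0 * z 1 + z 0 * z 2 + z 1 * z 2 = 4 * c + 3
  e3 : z 0 * z 1 * z 2 = -4
  hd : ∀ i, d i ^ 2 = z i ^ 2 + 4
  hdp : d 0 * d 1 * d 2 = 2 * Q
  hep : ∀ i, ep i ^ 2 = (z i - d i) - ((z i + d i) / 2) ^ 2 - 4 * c

lemma exists_cubic {K : Type*} [Field K] [IsAlgClosed K] (u : K) : ∃ z : Fin 3 → K,
    z 0 + z 1 + z 2 = 0 ∧ z 0 * z 1 + z 0 * z 2 + z 1 * z 2 = u ∧ z 0 * z 1 * z 2 = -4 := by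
  have hd : (X ^ 3 + C u * X + C 4 : K[X]).natDegree = 3 := by compute_degree!
  obtain ⟨a, ha⟩ := IsAlgClosed.exists_root (X ^ 3 + C u * X + C 4 : K[X]) (by
    rw [degree_eq_natDegree (fun h => by rw [h] at hd; simp at hd), hd]; norm_num)
  have ha' : a ^ 3 + u * a + 4 = 0 := by simpa [IsRoot] using ha
  have hd2 : (X ^ 2 + C a * X + C (a ^ 2 + u) : K[X]).natDegree = 2 := by compute_degree!
  obtain ⟨b, hb⟩ := IsAlgClosed.exists_root (X ^ 2 + C a * X + C (a ^ 2 + u) : K[X]) (by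
    rw [degree_eq_natDegree (fun h => by rw [h] at hd2; simp at hd2), hd2]; norm_num)
  have hb' : b ^ 2 + a * b + (a ^ 2 + u) = 0 := by simpa [IsRoot] using hb
  refine ⟨![a, b, -a - b], ?_, ?_, ?_⟩
  · simp
  · simp; linear_combination -hb'
  · simp; linear_combination -a * hb' + ha'

lemma exists_RD {K : Type*} [Field K] [CharZero K] [IsAlgClosed K] (c Q : K)
    (hQ : Q ^ 2 = (4 * c - 1) ^ 2 + 4) : Nonempty (RD K c Q) := by
  obtain ⟨z, e1, e2, e3⟩ := exists_cubic (4 * c + 3)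
  have hs : ∀ x : K, ∃ y, y ^ 2 = x := fun x => IsAlgClosed.exists_pow_nat_eq x (by norm_num)
  choose d hd using fun i => hs (z i ^ 2 + 4)
  have hp : (d 0 * d 1 * d 2) ^ 2 = (2 * Q) ^ 2 := by
    rw [mul_pow, mul_pow, hd, hd, hd, mul_pow, hQ]
    have e1' : z 2 = - z 0 - z 1 := by linear_combination e1
    rw [e1'] at e2 e3 ⊢
    have hc : c = (z 0 * z 1 + z 0 * (- z 0 - z 1) + z 1 * (- z 0 - z 1) - 3) / 4 := by
      rw [e2]; ring
    rw [hc]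
    linear_combination (z 0 * z 1 * (- z 0 - z 1) - 4) * e3
  have key : ∃ d : Fin 3 → K, (∀ i, d i ^ 2 = z i ^ 2 + 4) ∧ d 0 * d 1 * d 2 = 2 * Q := by
    rcases sq_eq_sq_iff_eq_or_eq_neg.1 hp with q | q
    · exact ⟨d, hd, q⟩
    · refine ⟨![- d 0, d 1, d 2], ?_, ?_⟩
      · intro i; fin_cases i
        · simp [hd]
        · simp [hd]
        · simp [hd]
      · simp; linear_combination -q
  obtain ⟨d, hd, hdp⟩ := key
  choose ep hep using fun i => hs ((z i - d i) - ((z i + d i) / 2) ^ 2 - 4 * c)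
  exact ⟨⟨z, d, ep, e1, e2, e3, hd, hdp, hep⟩⟩

set_option linter.unusedSectionVars false
namespace RD
variable {K : Type*} [Field K] [CharZero K] {c Q : K} (R : RD K c Q)

def s (i : Fin 3) : K := (R.z i + R.d i) / 2
def t (i : Fin 3) : K := (R.z i - R.d i) / 2

lemma st (i : Fin 3) : R.s i * R.t i = -1 := by
  simp only [s, t]; linear_combination (-1 / 4) * R.hd i

lemma hep' (i : Fin 3) : R.ep i ^ 2 = 2 * R.t i - R.s i ^ 2 - 4 * c := by
  rw [R.hep, s, t]; ring

lemma s_ne (i : Fin 3) : R.s i ≠ 0 := by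
  intro h
  have := R.st i
  rw [h, zero_mul] at this
  norm_num at this

lemma cub (i : Fin 3) : R.z i ^ 3 + (4 * c + 3) * R.z i + 4 = 0 := by
  have e1 := R.e1
  have e2 := R.e2
  have e3 := R.e3
  fin_cases i
  · simp only [Fin.zero_eta]; linear_combination (R.z 0) ^ 2 * e1 - R.z 0 * e2 + e3
  · simp only [Fin.mk_one]; linear_combination (R.z 1) ^ 2 * e1 - R.z 1 * e2 + e3
  · simp only [Fin.reduceFinMk]; linear_combination (R.z 2) ^ 2 * e1 - R.z 2 * e2 + e3

lemma z_ne (i : Fin 3) : R.z i ≠ 0 := by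
  intro h
  have := R.cub i
  rw [h] at this
  norm_num at this

/-- the roots -/
def r (i : Fin 3) (k : ZMod 4) : K :=
  (![(R.s i + R.ep i) / 2, (R.t i + R.s i * R.ep i) / 2, (R.s i - R.ep i) / 2,
    (R.t i - R.s i * R.ep i) / 2] : Fin 4 → K) k

lemma r0 (i : Fin 3) : R.r i 0 = (R.s i + R.ep i) / 2 := rfl
lemma r1 (i : Fin 3) : R.r i 1 = (R.t i + R.s i * R.ep i) / 2 := rfl
lemma r2 (i : Fin 3) : R.r i 2 = (R.s i - R.ep i) / 2 := rfl
lemma r3 (i : Fin 3) : R.r i 3 = (R.t i - R.s i * R.ep i) / 2 := rfl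

lemma sext (i : Fin 3) : R.t i ^ 2 + (R.s i * R.ep i) ^ 2 + 4 * c = 2 * R.s i := by
  have h := R.cub i
  have hst := R.st i
  have hz : R.z i = R.s i + R.t i := by simp only [s, t]; ring
  rw [mul_pow, R.hep']
  apply mul_left_cancel₀ (pow_ne_zero 3 (R.s_ne i))
  have ht : R.t i = - (R.s i)⁻¹ := by
    have := R.s_ne i
    field_simp; linear_combination hst
  rw [hz, ht] at h
  rw [ht]
  have hs := R.s_ne i
  field_simp at h ⊢
  linear_combination -h

lemma z4 : ∀ k : ZMod 4, k = 0 ∨ k = 1 ∨ k = 2 ∨ k = 3 := by decide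

lemma step (i : Fin 3) (k : ZMod 4) : R.r i (k + 1) = R.r i k ^ 2 + c := by
  have h1 := R.hep' i
  have h2 := R.sext i
  have h3 := R.st i
  rcases z4 k with rfl | rfl | rfl | rfl
  · rw [show (0 + 1 : ZMod 4) = 1 by decide, r0, r1]; linear_combination (-1 / 4) * h1
  · rw [show (1 + 1 : ZMod 4) = 2 by decide, r1, r2]
    linear_combination (-1 / 4) * h2 - (1 / 2) * R.ep i * h3
  · rw [show (2 + 1 : ZMod 4) = 3 by decide, r2, r3]; linear_combination (-1 / 4) * h1
  · rw [show (3 + 1 : ZMod 4) = 0 by decide, r3, r0]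
    linear_combination (-1 / 4) * h2 + (1 / 2) * R.ep i * h3

lemma sum_r (i : Fin 3) (k : ZMod 4) :
    R.r i k + R.r i (k + 1) + R.r i (k + 2) + R.r i (k + 3) = R.z i := by
  have hz : R.z i = R.s i + R.t i := by simp only [s, t]; ring
  have : R.r i 0 + R.r i 1 + R.r i 2 + R.r i 3 = R.z i := by
    rw [r0, r1, r2, r3, hz]; ring
  rw [← this]
  rcases z4 k with rfl | rfl | rfl | rfl
  · rw [show (0 + 1 : ZMod 4) = 1 by decide, show (0 + 2 : ZMod 4) = 2 by decide,
      show (0 + 3 : ZMod 4) = 3 by decide]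
  · rw [show (1 + 1 : ZMod 4) = 2 by decide, show (1 + 2 : ZMod 4) = 3 by decide,
      show (1 + 3 : ZMod 4) = 0 by decide]; ring
  · rw [show (2 + 1 : ZMod 4) = 3 by decide, show (2 + 2 : ZMod 4) = 0 by decide,
      show (2 + 3 : ZMod 4) = 1 by decide]; ring
  · rw [show (3 + 1 : ZMod 4) = 0 by decide, show (3 + 2 : ZMod 4) = 1 by decide,
      show (3 + 3 : ZMod 4) = 2 by decide]; ring

/-- difference attached to a point of a cycle -/
def D (i : Fin 3) (k : ZMod 4) : K := (if par k = 0 then 1 else -1) * R.d i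
def E (i : Fin 3) (k : ZMod 4) : K := R.r i k - R.r i (k + 2)

lemma D_eq (i : Fin 3) (k : ZMod 4) :
    R.D i k = R.r i k - R.r i (k + 1) + R.r i (k + 2) - R.r i (k + 3) := by
  have hz : R.d i = R.s i - R.t i := by simp only [s, t]; ring
  have h0 : par 0 = 0 := by decide
  have h1 : par 1 ≠ 0 := by decide
  have h2 : par 2 = 0 := by decide
  have h3 : par 3 ≠ 0 := by decide
  rcases z4 k with rfl | rfl | rfl | rfl
  · rw [show (0 + 1 : ZMod 4) = 1 by decide, show (0 + 2 : ZMod 4) = 2 by decide,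
      show (0 + 3 : ZMod 4) = 3 by decide, D, if_pos h0, hz, r0, r1, r2, r3]; ring
  · rw [show (1 + 1 : ZMod 4) = 2 by decide, show (1 + 2 : ZMod 4) = 3 by decide,
      show (1 + 3 : ZMod 4) = 0 by decide, D, if_neg h1, hz, r0, r1, r2, r3]; ring
  · rw [show (2 + 1 : ZMod 4) = 3 by decide, show (2 + 2 : ZMod 4) = 0 by decide,
      show (2 + 3 : ZMod 4) = 1 by decide, D, if_pos h2, hz, r0, r1, r2, r3]; ring
  · rw [show (3 + 1 : ZMod 4) = 0 by decide, show (3 + 2 : ZMod 4) = 1 by decide,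
      show (3 + 3 : ZMod 4) = 2 by decide, D, if_neg h3, hz, r0, r1, r2, r3]; ring

lemma E0 (i : Fin 3) : R.E i 0 = R.ep i := by
  rw [E, show (0 + 2 : ZMod 4) = 2 by decide, r0, r2]; ring
lemma E1 (i : Fin 3) : R.E i 1 = R.s i * R.ep i := by
  rw [E, show (1 + 2 : ZMod 4) = 3 by decide, r1, r3]; ring
lemma E2 (i : Fin 3) : R.E i 2 = - R.ep i := by
  rw [E, show (2 + 2 : ZMod 4) = 0 by decide, r0, r2]; ring
lemma E3 (i : Fin 3) : R.E i 3 = - (R.s i * R.ep i) := by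
  rw [E, show (3 + 2 : ZMod 4) = 1 by decide, r1, r3]; ring

lemma ep_eq (i : Fin 3) : R.ep i ^ 2 * (R.s i * R.z i) = R.d i * (R.z i + 2) := by
  have h := R.cub i
  have hst := R.st i
  have hz : R.z i = R.s i + R.t i := by simp only [s, t]; ring
  have hd : R.d i = R.s i - R.t i := by simp only [s, t]; ring
  have ht : R.t i = - (R.s i)⁻¹ := by
    have := R.s_ne i
    field_simp; linear_combination hst
  rw [hz, ht] at h
  rw [R.hep', hd, hz, ht]
  have hs := R.s_ne i
  field_simp at h ⊢
  linear_combination -h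

end RD
end P4

open Polynomial
namespace P4
set_option linter.unusedSectionVars false
namespace RD
variable {K : Type*} [Field K] [CharZero K] {c Q : K} (R : RD K c Q)

/-- square root of the discriminant of the cubic -/
def vd : K := (R.z 0 - R.z 1) * (R.z 0 - R.z 2) * (R.z 1 - R.z 2)

lemma vd_sq : R.vd ^ 2 = -4 * ((4 * c + 3) ^ 3 + 108) := by
  have h0 := R.cub 0
  have h1 := R.cub 1
  have e1 := R.e1
  have e2 := R.e2
  have e3 := R.e3
  have e1' : R.z 2 = - R.z 0 - R.z 1 := by linear_combination e1
  rw [← e2, vd]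
  rw [e1'] at e3 ⊢
  linear_combination (-27) * (R.z 0 * R.z 1 * (- R.z 0 - R.z 1) - 4) * e3

lemma sigma_sq (i : Fin 3) : R.s i ^ 2 = 1 + R.s i * R.z i := by
  have h := R.st i
  have hz : R.z i = R.s i + R.t i := by simp only [s, t]; ring
  rw [hz]; linear_combination -h

lemma sigma_sq' (i : Fin 3) : 1 + R.s i ^ 2 = R.s i * R.d i := by
  have h := R.st i
  have hz : R.d i = R.s i - R.t i := by simp only [s, t]; ring
  rw [hz]; linear_combination h

/-- the quantity changing sign with the total rotation -/
def rho : K := R.E 0 0 * R.E 1 0 * R.E 2 0 - R.E 0 0 * R.E 1 1 * R.E 2 1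
  - R.E 0 1 * R.E 1 0 * R.E 2 1 - R.E 0 1 * R.E 1 1 * R.E 2 0
  + R.E 0 0 * R.E 1 0 * R.E 2 1 + R.E 0 0 * R.E 1 1 * R.E 2 0
  + R.E 0 1 * R.E 1 0 * R.E 2 0 - R.E 0 1 * R.E 1 1 * R.E 2 1

lemma P_sq : ((1 - (R.s 0 * R.s 1 + R.s 0 * R.s 2 + R.s 1 * R.s 2)) +
    (R.s 0 + R.s 1 + R.s 2 - R.s 0 * R.s 1 * R.s 2)) ^ 2 =
    R.s 0 * R.s 1 * R.s 2 * (2 * Q + 2 * (4 * c - 1)) := by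
  have h1 : (1 - (R.s 0 * R.s 1 + R.s 0 * R.s 2 + R.s 1 * R.s 2)) ^ 2 +
    (R.s 0 + R.s 1 + R.s 2 - R.s 0 * R.s 1 * R.s 2) ^ 2 = R.s 0 * R.s 1 * R.s 2 * (2 * Q) := by
    have : (1 - (R.s 0 * R.s 1 + R.s 0 * R.s 2 + R.s 1 * R.s 2)) ^ 2 +
    (R.s 0 + R.s 1 + R.s 2 - R.s 0 * R.s 1 * R.s 2) ^ 2 =
      (1 + R.s 0 ^ 2) * (1 + R.s 1 ^ 2) * (1 + R.s 2 ^ 2) := by ring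
    rw [this, R.sigma_sq', R.sigma_sq', R.sigma_sq', ← R.hdp]; ring
  have h2 : (1 - (R.s 0 * R.s 1 + R.s 0 * R.s 2 + R.s 1 * R.s 2)) *
    (R.s 0 + R.s 1 + R.s 2 - R.s 0 * R.s 1 * R.s 2) = R.s 0 * R.s 1 * R.s 2 * (4 * c - 1) := by
    have : (1 - (R.s 0 * R.s 1 + R.s 0 * R.s 2 + R.s 1 * R.s 2)) *
    (R.s 0 + R.s 1 + R.s 2 - R.s 0 * R.s 1 * R.s 2) =
      R.s 0 * (1 - R.s 1 ^ 2) * (1 - R.s 2 ^ 2) + R.s 1 * (1 - R.s 0 ^ 2) * (1 - R.s 2 ^ 2)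
      + R.s 2 * (1 - R.s 0 ^ 2) * (1 - R.s 1 ^ 2) - 4 * (R.s 0 * R.s 1 * R.s 2) := by ring
    rw [this, R.sigma_sq, R.sigma_sq, R.sigma_sq]
    linear_combination R.s 0 * R.s 1 * R.s 2 * R.e2
  linear_combination h1 + 2 * h2

lemma ep_prod : (R.ep 0 * R.ep 1 * R.ep 2) ^ 2 * (R.s 0 * R.s 1 * R.s 2) = - Q * (4 * c + 5) := by
  have h0 := R.ep_eq 0
  have h1 := R.ep_eq 1
  have h2 := R.ep_eq 2
  have hz : (R.z 0 + 2) * (R.z 1 + 2) * (R.z 2 + 2) = 2 * (4 * c + 3) + 4 := by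
    linear_combination R.e3 + 2 * R.e2 + 4 * R.e1
  have h : (R.ep 0 * R.ep 1 * R.ep 2) ^ 2 * (R.s 0 * R.s 1 * R.s 2) * (R.z 0 * R.z 1 * R.z 2) =
      (R.d 0 * R.d 1 * R.d 2) * ((R.z 0 + 2) * (R.z 1 + 2) * (R.z 2 + 2)) := by
    calc _ = (R.ep 0 ^ 2 * (R.s 0 * R.z 0)) * (R.ep 1 ^ 2 * (R.s 1 * R.z 1)) *
          (R.ep 2 ^ 2 * (R.s 2 * R.z 2)) := by ring
      _ = _ := by rw [h0, h1, h2]; ring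
  rw [hz, R.hdp, R.e3] at h
  linear_combination (-1 / 4) * h

lemma rho_sq : R.rho ^ 2 = - 2 * Q * (4 * c + 5) * (Q + (4 * c - 1)) := by
  have : R.rho = R.ep 0 * R.ep 1 * R.ep 2 *
    ((1 - (R.s 0 * R.s 1 + R.s 0 * R.s 2 + R.s 1 * R.s 2)) +
    (R.s 0 + R.s 1 + R.s 2 - R.s 0 * R.s 1 * R.s 2)) := by
    rw [rho]; simp only [E0, E1]; ring
  rw [this, mul_pow, P_sq, ← mul_assoc, ep_prod]; ring

lemma psi (g : Fin 3 → K) (hg : ∀ i, g i ^ 2 = 1) (hp : g 0 * g 1 * g 2 = 1) (ψ : K)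
    (h : 2 * ψ = g 0 * R.d 0 + g 1 * R.d 1 + g 2 * R.d 2) :
    ψ ^ 4 + (4 * c - 3) * ψ ^ 2 - 2 * Q * ψ + 4 * c = 0 := by
  set x0 := g 0 * R.d 0 with hx0
  set x1 := g 1 * R.d 1 with hx1
  set x2 := g 2 * R.d 2 with hx2
  have k0 : x0 ^ 2 = R.z 0 ^ 2 + 4 := by rw [hx0, mul_pow, hg, R.hd, one_mul]
  have k1 : x1 ^ 2 = R.z 1 ^ 2 + 4 := by rw [hx1, mul_pow, hg, R.hd, one_mul]
  have k2 : x2 ^ 2 = R.z 2 ^ 2 + 4 := by rw [hx2, mul_pow, hg, R.hd, one_mul]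
  have kp : x0 * x1 * x2 = 2 * Q := by
    rw [← R.hdp, hx0, hx1, hx2]; linear_combination R.d 0 * R.d 1 * R.d 2 * hp
  have e1 := R.e1
  have e2 := R.e2
  have e3 := R.e3
  set S := x0 * x1 + x0 * x2 + x1 * x2 with hS
  have a1 : x0 ^ 2 + x1 ^ 2 + x2 ^ 2 = - 2 * (4 * c + 3) + 12 := by
    rw [k0, k1, k2]; linear_combination (R.z 0 + R.z 1 + R.z 2) * e1 - 2 * e2
  have a2 : (2 * ψ) ^ 2 = - 2 * (4 * c + 3) + 12 + 2 * S := by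
    rw [h, hS]; linear_combination a1
  have a3 : x0 ^ 2 * x1 ^ 2 + x0 ^ 2 * x2 ^ 2 + x1 ^ 2 * x2 ^ 2 =
      (4 * c + 3) ^ 2 - 16 * (4 * c + 3) + 48 := by
    rw [k0, k1, k2, ← e2]
    linear_combination (8 * (R.z 0 + R.z 1 + R.z 2) - 2 * R.z 0 * R.z 1 * R.z 2) * e1
  have a4 : S ^ 2 = (4 * c + 3) ^ 2 - 16 * (4 * c + 3) + 48 + 2 * (2 * Q) * (2 * ψ) := by
    rw [← a3, ← kp, h, hS]; ring
  have a5 : S = 2 * ψ ^ 2 + (4 * c + 3) - 6 := by linear_combination (-1 / 2) * a2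
  rw [a5] at a4
  linear_combination (1 / 4) * a4

end RD
end P4

open Polynomial
namespace P4
set_option linter.unusedSectionVars false

/-- sign character of the parity -/
def chi (K : Type*) [Field K] (k : ZMod 4) : K := if par k = 0 then 1 else -1

lemma chi0 (K : Type*) [Field K] : chi K 0 = 1 := if_pos (by decide)
lemma chi1 (K : Type*) [Field K] : chi K 1 = -1 := if_neg (by decide)
lemma chi2 (K : Type*) [Field K] : chi K 2 = 1 := if_pos (by decide)
lemma chi3 (K : Type*) [Field K] : chi K 3 = -1 := if_neg (by decide)

lemma perm3 : ∀ π : Equiv.Perm (Fin 3),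
    (π 0 = 0 ∧ π 1 = 1 ∧ π 2 = 2 ∧ Equiv.Perm.sign π = 1) ∨
    (π 0 = 0 ∧ π 1 = 2 ∧ π 2 = 1 ∧ Equiv.Perm.sign π = -1) ∨
    (π 0 = 1 ∧ π 1 = 0 ∧ π 2 = 2 ∧ Equiv.Perm.sign π = -1) ∨
    (π 0 = 1 ∧ π 1 = 2 ∧ π 2 = 0 ∧ Equiv.Perm.sign π = 1) ∨
    (π 0 = 2 ∧ π 1 = 0 ∧ π 2 = 1 ∧ Equiv.Perm.sign π = 1) ∨
    (π 0 = 2 ∧ π 1 = 1 ∧ π 2 = 0 ∧ Equiv.Perm.sign π = -1) := by decide +kernel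

lemma phi4_eval {K : Type*} [Field K] (c x : K) : (Phi4 c).eval x =
    1 + (x + ((x ^ 2 + c) ^ 2 + c)) * ((x ^ 2 + c) + (((x ^ 2 + c) ^ 2 + c) ^ 2 + c)) := by
  simp only [Phi4, eval_add, eval_mul, eval_pow, eval_X, eval_C]; ring

lemma phi4_deg {K : Type*} [Field K] (c : K) : (Phi4 c).natDegree = 12 := by
  unfold Phi4; compute_degree!

lemma phi4_monic {K : Type*} [Field K] (c : K) : (Phi4 c).Monic := by
  unfold Phi4; monicity!

lemma phi4_map {K L : Type*} [Field K] [Field L] (f : K →+* L) (c : K) :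
    (Phi4 c).map f = Phi4 (f c) := by
  simp only [Phi4, Polynomial.map_add, Polynomial.map_mul, Polynomial.map_pow, map_X, map_C, map_add,
    map_mul, map_pow, map_ofNat, map_one, Polynomial.map_ofNat, Polynomial.map_one]

namespace RD
variable {K : Type*} [Field K] [CharZero K] {c Q : K} (R : RD K c Q)

lemma z_eq (i : Fin 3) (k : ZMod 4) : R.z i = R.r i k + (R.r i k ^ 2 + c) +
    ((R.r i k ^ 2 + c) ^ 2 + c) + (((R.r i k ^ 2 + c) ^ 2 + c) ^ 2 + c) := by
  rw [← R.sum_r i k, ← R.step, ← R.step, ← R.step, add_assoc k 1 1, add_assoc k _ 1,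
    show (1 + 1 : ZMod 4) = 2 by decide, show (2 + 1 : ZMod 4) = 3 by decide]

lemma shift {i j : Fin 3} {k l : ZMod 4} (h : R.r i k = R.r j l) (n : ZMod 4) :
    R.r i (k + n) = R.r j (l + n) := by
  have h1 : R.r i (k + 1) = R.r j (l + 1) := by rw [R.step, R.step, h]
  have h2 : R.r i (k + 1 + 1) = R.r j (l + 1 + 1) := by rw [R.step, R.step _ (l + 1), h1]
  have h3 : R.r i (k + 1 + 1 + 1) = R.r j (l + 1 + 1 + 1) := by
    rw [R.step, R.step _ (l + 1 + 1), h2]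
  rcases z4 n with rfl | rfl | rfl | rfl
  · simpa using h
  · exact h1
  · rw [add_assoc, add_assoc] at h2; exact h2
  · rw [add_assoc, add_assoc, add_assoc, add_assoc] at h3; exact h3

lemma d_ne (hQ : Q ≠ 0) (i : Fin 3) : R.d i ≠ 0 := by
  have h : R.d 0 * R.d 1 * R.d 2 ≠ 0 := by rw [R.hdp]; simpa using hQ
  rw [mul_ne_zero_iff, mul_ne_zero_iff] at h
  fin_cases i
  · exact h.1.1
  · exact h.1.2
  · exact h.2

lemma ep_ne (hQ : Q ≠ 0) (h5 : 4 * c + 5 ≠ 0) (i : Fin 3) : R.ep i ≠ 0 := by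
  have h : R.ep 0 * R.ep 1 * R.ep 2 ≠ 0 := by
    intro h
    have := R.ep_prod
    rw [h] at this
    have : Q * (4 * c + 5) = 0 := by linear_combination this
    exact mul_ne_zero hQ h5 this
  rw [mul_ne_zero_iff, mul_ne_zero_iff] at h
  fin_cases i
  · exact h.1.1
  · exact h.1.2
  · exact h.2

lemma z_inj (hv : (4 * c + 3) ^ 3 + 108 ≠ 0) : Function.Injective R.z := by
  have h : R.vd ≠ 0 := by
    intro h
    have := R.vd_sq
    rw [h] at this
    apply hv; linear_combination (1 / 4) * this
  rw [vd, mul_ne_zero_iff, mul_ne_zero_iff, sub_ne_zero, sub_ne_zero, sub_ne_zero] at h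
  obtain ⟨⟨h1, h2⟩, h3⟩ := h
  intro i j hij
  fin_cases i <;> fin_cases j <;> first | rfl | exact absurd hij h1 | exact absurd hij h2 | exact absurd hij h3 | exact absurd hij.symm h1 | exact absurd hij.symm h2 | exact absurd hij.symm h3

lemma r_inj (hQ : Q ≠ 0) (h5 : 4 * c + 5 ≠ 0) (hv : (4 * c + 3) ^ 3 + 108 ≠ 0)
    {i j : Fin 3} {k l : ZMod 4} (h : R.r i k = R.r j l) : i = j ∧ k = l := by
  have hij : i = j := by
    apply R.z_inj hv
    rw [R.z_eq i k, R.z_eq j l, h]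
  subst hij
  refine ⟨rfl, ?_⟩
  have h' := R.shift h (-k)
  rw [add_neg_cancel, ← sub_eq_add_neg] at h'
  suffices l - k = 0 by rw [sub_eq_zero] at this; exact this.symm
  generalize l - k = m at h'
  have hd := R.d_ne hQ i
  have he := R.ep_ne hQ h5 i
  have hD := R.D_eq i 0
  rw [D, if_pos (by decide), zero_add, zero_add, zero_add, one_mul] at hD
  have s1 := R.shift h' 1
  have s2 := R.shift h' 2
  have s3 := R.shift h' 3
  rcases z4 m with rfl | rfl | rfl | rfl
  · rfl
  · exfalso; apply hd; rw [hD]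
    rw [zero_add, show (1 + 2 : ZMod 4) = 3 by decide] at s2
    linear_combination h' + s2
  · exfalso; apply he; rw [← R.E0, E, zero_add]; linear_combination h'
  · exfalso; apply hd; rw [hD]
    rw [zero_add, show (3 + 2 : ZMod 4) = 1 by decide] at s2
    linear_combination h' + s2

lemma root (i : Fin 3) (k : ZMod 4) : (Phi4 c).eval (R.r i k) = 0 := by
  rw [phi4_eval, ← R.step, ← R.step, ← R.step, add_assoc k 1 1, add_assoc k _ 1,
    show (1 + 1 : ZMod 4) = 2 by decide, show (2 + 1 : ZMod 4) = 3 by decide]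
  have h := R.st i
  rcases z4 k with rfl | rfl | rfl | rfl
  · rw [show (0 + 1 : ZMod 4) = 1 by decide, show (0 + 2 : ZMod 4) = 2 by decide,
      show (0 + 3 : ZMod 4) = 3 by decide, r0, r1, r2, r3]; linear_combination h
  · rw [show (1 + 1 : ZMod 4) = 2 by decide, show (1 + 2 : ZMod 4) = 3 by decide,
      show (1 + 3 : ZMod 4) = 0 by decide, r0, r1, r2, r3]; linear_combination h
  · rw [show (2 + 1 : ZMod 4) = 3 by decide, show (2 + 2 : ZMod 4) = 0 by decide,
      show (2 + 3 : ZMod 4) = 1 by decide, r0, r1, r2, r3]; linear_combination h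
  · rw [show (3 + 1 : ZMod 4) = 0 by decide, show (3 + 2 : ZMod 4) = 1 by decide,
      show (3 + 3 : ZMod 4) = 2 by decide, r0, r1, r2, r3]; linear_combination h

lemma injIx (hQ : Q ≠ 0) (h5 : 4 * c + 5 ≠ 0) (hv : (4 * c + 3) ^ 3 + 108 ≠ 0) :
    Function.Injective (fun x : Ix => R.r x.1 x.2) := by
  intro x y h
  obtain ⟨a, b⟩ := R.r_inj hQ h5 hv h
  exact Prod.ext a b

lemma all_roots (hQ : Q ≠ 0) (h5 : 4 * c + 5 ≠ 0) (hv : (4 * c + 3) ^ 3 + 108 ≠ 0) {x : K}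
    (hx : (Phi4 c).eval x = 0) : ∃ i k, x = R.r i k := by
  classical
  have hs : Finset.univ.image (fun x : Ix => R.r x.1 x.2) ⊆ (Phi4 c).roots.toFinset := by
    intro y hy
    obtain ⟨w, -, rfl⟩ := Finset.mem_image.1 hy
    rw [Multiset.mem_toFinset, mem_roots (phi4_monic c).ne_zero]
    exact R.root _ _
  have hc : (Finset.univ.image (fun x : Ix => R.r x.1 x.2)).card = 12 := by
    rw [Finset.card_image_of_injective _ (R.injIx hQ h5 hv)]; rfl
  have hc2 : (Phi4 c).roots.toFinset.card ≤ 12 :=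
    (Multiset.toFinset_card_le _).trans ((card_roots' _).trans (phi4_deg c).le)
  have heq := Finset.eq_of_subset_of_card_le hs (by rw [hc]; exact hc2)
  have : x ∈ (Phi4 c).roots.toFinset := by
    rw [Multiset.mem_toFinset, mem_roots (phi4_monic c).ne_zero]; exact hx
  rw [← heq] at this
  obtain ⟨w, -, rfl⟩ := Finset.mem_image.1 this
  exact ⟨_, _, rfl⟩

/-- general form of `rho` -/
def rhoF (j : Fin 3 → Fin 3) (b : Fin 3 → ZMod 4) : K :=
  R.E (j 0) (b 0) * R.E (j 1) (b 1) * R.E (j 2) (b 2)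
  - R.E (j 0) (b 0) * R.E (j 1) (b 1 + 1) * R.E (j 2) (b 2 + 1)
  - R.E (j 0) (b 0 + 1) * R.E (j 1) (b 1) * R.E (j 2) (b 2 + 1)
  - R.E (j 0) (b 0 + 1) * R.E (j 1) (b 1 + 1) * R.E (j 2) (b 2)
  + R.E (j 0) (b 0) * R.E (j 1) (b 1) * R.E (j 2) (b 2 + 1)
  + R.E (j 0) (b 0) * R.E (j 1) (b 1 + 1) * R.E (j 2) (b 2)
  + R.E (j 0) (b 0 + 1) * R.E (j 1) (b 1) * R.E (j 2) (b 2)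
  - R.E (j 0) (b 0 + 1) * R.E (j 1) (b 1 + 1) * R.E (j 2) (b 2 + 1)

lemma rhoF_perm (π : Equiv.Perm (Fin 3)) : R.rhoF π (fun _ => 0) = R.rho := by
  simp only [rhoF, rho, zero_add]
  rcases perm3 π with ⟨h0, h1, h2, -⟩ | ⟨h0, h1, h2, -⟩ | ⟨h0, h1, h2, -⟩ | ⟨h0, h1, h2, -⟩ |
    ⟨h0, h1, h2, -⟩ | ⟨h0, h1, h2, -⟩
  all_goals (rw [h0, h1, h2]; try ring)

lemma rhoF_rot (j : Fin 3 → Fin 3) (b : Fin 3 → ZMod 4) :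
    (tot b = 0 → R.rhoF j b = R.rhoF j (fun _ => 0)) ∧
    (tot b = 2 → R.rhoF j b = - R.rhoF j (fun _ => 0)) := by
  simp only [rhoF, tot]
  have q1 : (1 + 1 : ZMod 4) = 2 := by decide
  have q2 : (2 + 1 : ZMod 4) = 3 := by decide
  have q3 : (3 + 1 : ZMod 4) = 0 := by decide
  generalize b 0 = b0
  generalize b 1 = b1
  generalize b 2 = b2
  rcases z4 b0 with rfl | rfl | rfl | rfl <;> rcases z4 b1 with rfl | rfl | rfl | rfl <;>
    rcases z4 b2 with rfl | rfl | rfl | rfl <;>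
  refine ⟨fun h => ?_, fun h => ?_⟩ <;>
  first
  | exact absurd h (by decide)
  | (simp only [zero_add, q1, q2, q3, E0, E1, E2, E3]; try ring)

section act
variable (hQ : Q ≠ 0) (h5 : 4 * c + 5 ≠ 0) (hv : (4 * c + 3) ^ 3 + 108 ≠ 0)
  (φ : K →+* K) (hφc : φ c = c) (hφQ : φ Q = Q)

lemma act_exists (hQ : Q ≠ 0) (h5 : 4 * c + 5 ≠ 0) (hv : (4 * c + 3) ^ 3 + 108 ≠ 0)
    (φ : K →+* K) (hφc : φ c = c) : ∃ (π : Equiv.Perm (Fin 3)) (a : Fin 3 → ZMod 4),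
    ∀ i k, φ (R.r i k) = R.r (π i) (a i + k) := by
  have h0 : ∀ i, ∃ j l, φ (R.r i 0) = R.r j l := by
    intro i
    apply R.all_roots hQ h5 hv
    have := congrArg φ (R.root i 0)
    rwa [← Polynomial.eval_map_apply, phi4_map, hφc, map_zero] at this
  choose p a hpa using h0
  have h1 : ∀ i k, φ (R.r i k) = R.r (p i) (a i + k) := by
    intro i k
    have st : ∀ k, φ (R.r i k) = R.r (p i) (a i + k) →
        φ (R.r i (k + 1)) = R.r (p i) (a i + (k + 1)) := by
      intro k h
      rw [R.step, map_add, map_pow, h, hφc, ← add_assoc, R.step]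
    have k0 := hpa i
    have k0' : φ (R.r i 0) = R.r (p i) (a i + 0) := by rw [add_zero]; exact k0
    have k1 := st _ k0'
    have k2 := st _ k1
    have k3 := st _ k2
    rcases z4 k with rfl | rfl | rfl | rfl
    · exact k0'
    · exact k1
    · exact k2
    · exact k3
  have hinj : Function.Injective p := by
    intro i j hij
    have e : φ (R.r i (- a i)) = φ (R.r j (- a j)) := by
      rw [h1, h1, hij, add_neg_cancel, add_neg_cancel]
    exact (R.r_inj hQ h5 hv (φ.injective e)).1
  exact ⟨Equiv.ofBijective p (Finite.injective_iff_bijective.1 hinj), a, h1⟩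
end act

variable {φ : K →+* K} {π : Equiv.Perm (Fin 3)} {a : Fin 3 → ZMod 4}

lemma act_z (h : ∀ i k, φ (R.r i k) = R.r (π i) (a i + k)) (i : Fin 3) :
    φ (R.z i) = R.z (π i) := by
  rw [← R.sum_r i 0, ← R.sum_r (π i) (a i)]
  simp only [map_add, h, zero_add, add_zero]

lemma act_E (h : ∀ i k, φ (R.r i k) = R.r (π i) (a i + k)) (i : Fin 3) (k : ZMod 4) :
    φ (R.E i k) = R.E (π i) (a i + k) := by
  simp only [E, map_sub, h, add_assoc]

lemma act_d (h : ∀ i k, φ (R.r i k) = R.r (π i) (a i + k)) (i : Fin 3) :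
    φ (R.d i) = chi K (a i) * R.d (π i) := by
  have h1 : R.d i = R.D i 0 := by rw [D, if_pos (by decide), one_mul]
  have h2 : chi K (a i) * R.d (π i) = R.D (π i) (a i) := rfl
  rw [h1, h2, D_eq, D_eq]
  simp only [map_add, map_sub, h, zero_add, add_zero]

lemma act_tot (hQ : Q ≠ 0) (hφQ : φ Q = Q) (h : ∀ i k, φ (R.r i k) = R.r (π i) (a i + k)) :
    tot a = 0 ∨ tot a = 2 := by
  have e := congrArg φ R.hdp
  rw [map_mul, map_mul, R.act_d h, R.act_d h, R.act_d h, map_mul, hφQ, map_ofNat] at e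
  have e2 : R.d (π 0) * R.d (π 1) * R.d (π 2) = 2 * Q := by
    rw [← R.hdp, ← Fin.prod_univ_three (fun i => R.d (π i)), Equiv.prod_comp π,
      Fin.prod_univ_three]
  have e3 : chi K (a 0) * chi K (a 1) * chi K (a 2) = 1 := by
    have q : (2 * Q : K) ≠ 0 := by simpa using hQ
    apply mul_right_cancel₀ q
    rw [one_mul]
    calc _ = chi K (a 0) * chi K (a 1) * chi K (a 2) * (R.d (π 0) * R.d (π 1) * R.d (π 2)) := by
          rw [e2]
      _ = _ := by rw [← e]; ring
  rw [tot]
  have hm : (-1 : K) ≠ 1 := by norm_num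
  generalize a 0 = b0 at *
  generalize a 1 = b1 at *
  generalize a 2 = b2 at *
  rcases z4 b0 with rfl | rfl | rfl | rfl <;> rcases z4 b1 with rfl | rfl | rfl | rfl <;>
    rcases z4 b2 with rfl | rfl | rfl | rfl <;>
  first
  | decide
  | (exfalso; simp only [chi0, chi1, chi2, chi3] at e3; norm_num at e3)

lemma act_rho (h : ∀ i k, φ (R.r i k) = R.r (π i) (a i + k)) :
    (tot a = 0 → φ R.rho = R.rho) ∧ (tot a = 2 → φ R.rho = - R.rho) := by
  have e : φ R.rho = R.rhoF π a := by
    simp only [rho, rhoF, map_add, map_sub, map_mul, R.act_E h, add_zero]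
  rw [e, ← R.rhoF_perm π]
  exact R.rhoF_rot π a

lemma act_vd (h : ∀ i k, φ (R.r i k) = R.r (π i) (a i + k)) :
    (Equiv.Perm.sign π = 1 ∧ φ R.vd = R.vd) ∨ (Equiv.Perm.sign π = -1 ∧ φ R.vd = - R.vd) := by
  simp only [vd, map_sub, map_mul, R.act_z h]
  rcases perm3 π with ⟨h0, h1, h2, hs⟩ | ⟨h0, h1, h2, hs⟩ | ⟨h0, h1, h2, hs⟩ | ⟨h0, h1, h2, hs⟩ |
    ⟨h0, h1, h2, hs⟩ | ⟨h0, h1, h2, hs⟩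
  · left; rw [h0, h1, h2]; exact ⟨hs, by ring⟩
  · right; rw [h0, h1, h2]; exact ⟨hs, by ring⟩
  · right; rw [h0, h1, h2]; exact ⟨hs, by ring⟩
  · left; rw [h0, h1, h2]; exact ⟨hs, by ring⟩
  · left; rw [h0, h1, h2]; exact ⟨hs, by ring⟩
  · right; rw [h0, h1, h2]; exact ⟨hs, by ring⟩

end RD
end P4

open Polynomial
namespace P4

/-- sign of a parity -/
def sg (K : Type*) [Field K] (x : ZMod 2) : K := if x = 0 then 1 else -1

lemma sg0 (K : Type*) [Field K] : sg K 0 = 1 := if_pos rfl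
lemma sg1 (K : Type*) [Field K] : sg K 1 = -1 := if_neg (by decide)
lemma z2 : ∀ x : ZMod 2, x = 0 ∨ x = 1 := by decide
lemma sg_add (K : Type*) [Field K] (x y : ZMod 2) : sg K (x + y) = sg K x * sg K y := by
  rcases z2 x with rfl | rfl <;> rcases z2 y with rfl | rfl
  · simp [sg0]
  · simp [sg0]
  · simp [sg0]
  · rw [show (1 + 1 : ZMod 2) = 0 by decide, sg0, sg1]; ring
lemma sg_sq (K : Type*) [Field K] (x : ZMod 2) : sg K x ^ 2 = 1 := by
  rcases z2 x with rfl | rfl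
  · simp [sg0]
  · simp [sg1]

local notation "𝕂" => AlgebraicClosure ℚ

lemma closAlg : @Algebra.IsAlgebraic ℚ 𝕂 _ _ DivisionRing.toRatAlgebra := by
  have h := AlgebraicClosure.isAlgebraic ℚ
  have e : (DivisionRing.toRatAlgebra : Algebra ℚ 𝕂) = AlgebraicClosure.instAlgebra ℚ :=
    Subsingleton.elim _ _
  rw [e]; exact h

instance instClos : IsAlgClosure ℚ 𝕂 := ⟨inferInstance, closAlg⟩
instance instIsAlg : Algebra.IsAlgebraic ℚ 𝕂 := closAlg
instance instNorm : Normal ℚ 𝕂 := IsAlgClosure.normal ℚ 𝕂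
instance instGalois : IsGalois ℚ 𝕂 := ⟨⟩

lemma fixed_rat (x : 𝕂) (h : ∀ φ : 𝕂 ≃ₐ[ℚ] 𝕂, φ x = x) : ∃ q : ℚ, (q : 𝕂) = x := by
  obtain ⟨q, hq⟩ := (InfiniteGalois.mem_range_algebraMap_iff_fixed x).2 h
  exact ⟨q, by rw [← hq]; simp⟩

section setup
variable {c w : ℚ} (hw : w ≠ 0) (hcw : 4 * c - 1 = 1 / w - w)

lemma nQ (hw : w ≠ 0) : w + 1 / w ≠ 0 := by
  intro h
  field_simp at h
  nlinarith [sq_nonneg w]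

lemma n5 (hw : w ≠ 0) (hcw : 4 * c - 1 = 1 / w - w) : 4 * c + 5 ≠ 0 := by
  intro h
  refine lem_b (s := w) (y := 0) hw ?_
  have : w ^ 2 - 6 * w - 1 = 0 := by
    have h2 : 1 / w - w + 6 = 0 := by linear_combination h - hcw
    field_simp at h2
    linear_combination -h2
  rw [this]; ring

lemma nv : (4 * c + 3) ^ 3 + 108 ≠ 0 := by
  intro h
  exact lem_a (u := 4 * c + 3) (y := 0) (by rw [h]; ring)

/-- the Galois elements act through `mk` -/
lemma gal_mk (R : RD 𝕂 (c : 𝕂) ((w + 1 / w : ℚ) : 𝕂)) (hw : w ≠ 0) (hcw : 4 * c - 1 = 1 / w - w)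
    (φ : 𝕂 ≃ₐ[ℚ] 𝕂) : ∃ (π : Equiv.Perm (Fin 3)) (a : Fin 3 → ZMod 4),
    (∀ i k, (φ : 𝕂 →+* 𝕂) (R.r i k) = R.r (π i) (a i + k)) ∧ (tot a = 0 ∨ tot a = 2) := by
  have hQ : ((w + 1 / w : ℚ) : 𝕂) ≠ 0 := by exact_mod_cast nQ hw
  have h5 : 4 * (c : 𝕂) + 5 ≠ 0 := by exact_mod_cast n5 hw hcw
  have hv : (4 * (c : 𝕂) + 3) ^ 3 + 108 ≠ 0 := by exact_mod_cast nv
  obtain ⟨π, a, h⟩ := R.act_exists hQ h5 hv (φ : 𝕂 →+* 𝕂) (map_ratCast _ _)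
  exact ⟨π, a, h, R.act_tot hQ (map_ratCast _ _) h⟩

lemma rho_rat (R : RD 𝕂 (c : 𝕂) ((w + 1 / w : ℚ) : 𝕂)) (hw : w ≠ 0)
    (hcw : 4 * c - 1 = 1 / w - w) (q : ℚ)
    (h : R.rho ^ 2 = (q : 𝕂)) : q * w ^ 3 = 4 * (w ^ 2 + 1) * (w ^ 2 - 6 * w - 1) := by
  rw [R.rho_sq] at h
  have h' : - 2 * (w + 1 / w) * (4 * c + 5) * ((w + 1 / w) + (4 * c - 1)) = q := by exact_mod_cast h
  rw [← h', show 4 * c + 5 = (4 * c - 1) + 6 by ring, hcw]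
  field_simp; ring

variable (H : Subgroup (Equiv.Perm Ix))

lemma main_mem (R : RD 𝕂 (c : 𝕂) ((w + 1 / w : ℚ) : 𝕂)) (hw : w ≠ 0)
    (hcw : 4 * c - 1 = 1 / w - w) (hc : c ≠ 19 / 16)
    (h1 : ∀ g ∈ H, ∃ φ : 𝕂 ≃ₐ[ℚ] 𝕂, ∀ x : Ix, (φ : 𝕂 →+* 𝕂) (R.r x.1 x.2) = R.r (g x).1 (g x).2)
    (h2 : ∀ (g : Equiv.Perm Ix) (φ : 𝕂 ≃ₐ[ℚ] 𝕂),
      (∀ x : Ix, (φ : 𝕂 →+* 𝕂) (R.r x.1 x.2) = R.r (g x).1 (g x).2) → g ∈ H)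
    (g : Equiv.Perm Ix) : g ∈ H ↔ ∃ π a, g = mk π a ∧ (tot a = 0 ∨ tot a = 2) := by
  have hQ : ((w + 1 / w : ℚ) : 𝕂) ≠ 0 := by exact_mod_cast nQ hw
  have h5 : 4 * (c : 𝕂) + 5 ≠ 0 := by exact_mod_cast n5 hw hcw
  have hv : (4 * (c : 𝕂) + 3) ^ 3 + 108 ≠ 0 := by exact_mod_cast nv
  have hcu : (4 * c + 3) * w = 1 + 4 * w - w ^ 2 := by
    have : 4 * c + 3 = (1 / w - w) + 4 := by rw [← hcw]; ring
    rw [this]; field_simp; ring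
  have key : ∀ P : Equiv.Perm (Fin 3) → (Fin 3 → ZMod 4) → Prop,
      ¬ (∃ π a, mk π a ∈ H ∧ P π a) → ∀ φ : 𝕂 ≃ₐ[ℚ] 𝕂,
      ∃ (π : Equiv.Perm (Fin 3)) (a : Fin 3 → ZMod 4),
      (∀ i k, (φ : 𝕂 →+* 𝕂) (R.r i k) = R.r (π i) (a i + k)) ∧ (tot a = 0 ∨ tot a = 2) ∧
        ¬ P π a := by
    intro P hP φ
    obtain ⟨π, a, h, ht⟩ := gal_mk R hw hcw φ
    refine ⟨π, a, h, ht, fun hp => hP ⟨π, a, ?_, hp⟩⟩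
    exact h2 _ φ (fun x => h x.1 x.2)
  have sgn : ∀ π : Equiv.Perm (Fin 3), Equiv.Perm.sign π = 1 ∨ Equiv.Perm.sign π = -1 :=
    fun π => Int.units_eq_one_or _
  have n11 : (1 : ℤˣ) ≠ -1 := by decide
  have n02 : (0 : ZMod 4) ≠ 2 := by decide
  refine crit2 H ?_ ?_ ?_ ?_ ?_ ?_ g
  · intro g hg
    obtain ⟨φ, hφ⟩ := h1 g hg
    obtain ⟨π, a, h, ht⟩ := gal_mk R hw hcw φ
    refine ⟨π, a, ?_, ht⟩
    apply Equiv.ext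
    intro x
    have := (hφ x).symm.trans (h x.1 x.2)
    obtain ⟨e1, e2⟩ := R.r_inj hQ h5 hv this
    exact Prod.ext e1 e2
  · intro i
    by_contra hn
    have hf : ∀ φ : 𝕂 ≃ₐ[ℚ] 𝕂, φ (R.z i) = R.z i := by
      intro φ
      obtain ⟨π, a, h, -, hp⟩ := key (fun π _ => π i ≠ i) hn φ
      have := R.act_z h i
      rw [not_ne_iff.1 hp] at this
      exact this
    obtain ⟨z, hz⟩ := fixed_rat _ hf
    have hcub := R.cub i
    rw [← hz] at hcub
    have hcub' : z ^ 3 + (4 * c + 3) * z + 4 = 0 := by exact_mod_cast hcub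
    have hz0 : z ≠ 0 := by
      rintro rfl
      norm_num at hcub'
    have hQ2 : (w + 1 / w) ^ 2 = (4 * c - 1) ^ 2 + 4 := by
      rw [hcw]; field_simp; ring
    have hzz := lem_d (z := z) (y := z * (w + 1 / w)) hz0 (by
      rw [mul_pow, hQ2]
      have : (4 * c - 1) * z = - (z ^ 3 + 4 * z + 4) := by linear_combination hcub'
      calc z ^ 2 * ((4 * c - 1) ^ 2 + 4) = ((4 * c - 1) * z) ^ 2 + 4 * z ^ 2 := by ring
        _ = _ := by rw [this]; ring)
    rw [hzz] at hcub'
    apply hc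
    linear_combination (-1 / 2) * hcub'
  · by_contra hn
    have hf : ∀ φ : 𝕂 ≃ₐ[ℚ] 𝕂, φ R.vd = R.vd := by
      intro φ
      obtain ⟨π, a, h, -, hp⟩ := key (fun π _ => Equiv.Perm.sign π = -1) hn φ
      rcases R.act_vd h with ⟨-, e⟩ | ⟨e, -⟩
      · exact e
      · exact absurd e hp
    obtain ⟨v, hvv⟩ := fixed_rat _ hf
    have hs := R.vd_sq
    rw [← hvv] at hs
    have hs' : v ^ 2 = -4 * ((4 * c + 3) ^ 3 + 108) := by exact_mod_cast hs
    exact lem_a (u := 4 * c + 3) (y := v / 2) (by linear_combination (1 / 4) * hs')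
  · by_contra hn
    have hf : ∀ φ : 𝕂 ≃ₐ[ℚ] 𝕂, φ R.rho = R.rho := by
      intro φ
      obtain ⟨π, a, h, ht, hp⟩ := key (fun _ a => tot a = 2) hn φ
      exact (R.act_rho h).1 (ht.resolve_right hp)
    obtain ⟨v, hvv⟩ := fixed_rat _ hf
    have hs := rho_rat R hw hcw (v ^ 2) (by rw [← hvv]; push_cast; rfl)
    exact lem_b (s := w) (y := v * w ^ 2 / 2) hw (by linear_combination (w / 4) * hs)
  · by_contra hn
    have hf : ∀ φ : 𝕂 ≃ₐ[ℚ] 𝕂, φ (R.rho * R.vd) = R.rho * R.vd := by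
      intro φ
      obtain ⟨π, a, h, ht, hp⟩ := key (fun π a => (Equiv.Perm.sign π = -1 ∧ tot a = 0 ∨
        Equiv.Perm.sign π = 1 ∧ tot a = 2)) hn φ
      rw [not_or, not_and, not_and] at hp
      have hr := R.act_rho h
      rw [map_mul]
      rcases ht with ht | ht
      · have q1 : φ R.rho = R.rho := hr.1 ht
        rcases R.act_vd h with ⟨-, e⟩ | ⟨e, -⟩
        · have q2 : φ R.vd = R.vd := e
          rw [q1, q2]
        · exact absurd ht (hp.1 e)
      · have q1 : φ R.rho = - R.rho := hr.2 ht
        rcases R.act_vd h with ⟨e, -⟩ | ⟨-, e⟩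
        · exact absurd ht (hp.2 e)
        · have q2 : φ R.vd = - R.vd := e
          rw [q1, q2]; ring
    obtain ⟨v, hvv⟩ := fixed_rat _ hf
    have hd0 : -4 * ((4 * c + 3) ^ 3 + 108) ≠ 0 := mul_ne_zero (by norm_num) nv
    have hs := rho_rat R hw hcw (v ^ 2 / (-4 * ((4 * c + 3) ^ 3 + 108))) (by
      have e := R.vd_sq
      have hd0' : (-4 * ((4 * (c : 𝕂) + 3) ^ 3 + 108)) ≠ 0 := by exact_mod_cast hd0
      push_cast
      rw [eq_div_iff hd0', ← e, hvv]; ring)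
    have hs2 : v ^ 2 * w ^ 3 = 4 * (w ^ 2 + 1) * (w ^ 2 - 6 * w - 1) *
        (-4 * ((4 * c + 3) ^ 3 + 108)) := by
      rw [← hs, mul_right_comm, div_mul_cancel₀ _ hd0]
    refine lem_c (s := w) (y := v * w ^ 3 / 4) hw ?_
    have e3 : (1 + 4 * w - w ^ 2) ^ 3 + 108 * w ^ 3 = ((4 * c + 3) ^ 3 + 108) * w ^ 3 := by
      rw [← hcu]; ring
    rw [e3]
    linear_combination (w ^ 3 / 16) * hs2
  · intro e he
    by_contra hn
    set x : 𝕂 := (sg 𝕂 (e 0) * R.d 0 + sg 𝕂 (e 1) * R.d 1 + sg 𝕂 (e 2) * R.d 2) / 2 with hx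
    have hxs : x = (∑ i, sg 𝕂 (e i) * R.d i) / 2 := by rw [hx, Fin.sum_univ_three]
    have hsgf : ∀ (φ : 𝕂 ≃ₐ[ℚ] 𝕂) (y : ZMod 2), φ (sg 𝕂 y) = sg 𝕂 y := by
      intro φ y
      rcases z2 y with rfl | rfl
      · rw [sg0, map_one]
      · rw [sg1, map_neg, map_one]
    have hf : ∀ φ : 𝕂 ≃ₐ[ℚ] 𝕂, φ x = x := by
      intro φ
      obtain ⟨π, a, h, ht, hp⟩ := key (fun π a => ∃ i, e (π i) ≠ e i + par (a i)) hn φ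
      simp only [not_exists, not_ne_iff] at hp
      rw [hxs, map_div₀, map_sum, map_ofNat]
      congr 1
      rw [← Equiv.sum_comp π (fun i => sg 𝕂 (e i) * R.d i)]
      apply Finset.sum_congr rfl
      intro i _
      have q : φ (R.d i) = chi 𝕂 (a i) * R.d (π i) := R.act_d h i
      rw [map_mul, hsgf, q, hp i, sg_add, mul_assoc]
      rfl
    obtain ⟨ψ, hψ⟩ := fixed_rat _ hf
    have hq := R.psi (fun i => sg 𝕂 (e i)) (fun i => sg_sq _ _)
      (by rw [← sg_add, ← sg_add, he, sg0]) x (by rw [hx]; ring)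
    rw [← hψ] at hq
    have hq' : ψ ^ 4 + (4 * c - 3) * ψ ^ 2 - 2 * (w + 1 / w) * ψ + 4 * c = 0 := by exact_mod_cast hq
    refine lem_e (s := w) (ψ := ψ) hw ?_
    have hc4 : 4 * c = 1 / w - w + 1 := by linear_combination hcw
    rw [hc4] at hq'
    field_simp at hq'
    linear_combination hq'

end setup

theorem final (c : ℚ) (hc : c ≠ 19 / 16)
    (hlam : ∃ r : ℚ, r ≠ 0 ∧ c = (r ^ 2 + 2 * r - 4) / (8 * r)) :
    Irreducible (Phi4 c) ∧ Nonempty ((Phi4 c).Gal ≃* Ggroup) := by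
  obtain ⟨r, hr, hcr⟩ := hlam
  obtain ⟨w, hw, hcw⟩ : ∃ w : ℚ, w ≠ 0 ∧ 4 * c - 1 = 1 / w - w := by
    refine ⟨2 / r, by positivity, ?_⟩
    rw [hcr]; field_simp; ring
  have hQ2 : (w + 1 / w) ^ 2 = (4 * c - 1) ^ 2 + 4 := by
    rw [hcw]; field_simp; ring
  obtain ⟨R⟩ := exists_RD (K := 𝕂) (c : 𝕂) ((w + 1 / w : ℚ) : 𝕂) (by exact_mod_cast hQ2)
  have hQ : ((w + 1 / w : ℚ) : 𝕂) ≠ 0 := by exact_mod_cast nQ hw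
  have h5 : 4 * (c : 𝕂) + 5 ≠ 0 := by exact_mod_cast n5 hw hcw
  have hv : (4 * (c : 𝕂) + 3) ^ 3 + 108 ≠ 0 := by exact_mod_cast nv
  have hmap : (Phi4 c).map (algebraMap ℚ 𝕂) = Phi4 (c : 𝕂) := by
    rw [phi4_map]; simp
  have hroot : ∀ x : 𝕂, x ∈ (Phi4 c).rootSet 𝕂 ↔ (Phi4 (c : 𝕂)).eval x = 0 := by
    intro x
    rw [mem_rootSet, ← hmap, eval_map_algebraMap]
    exact ⟨fun h => h.2, fun h => ⟨(phi4_monic c).ne_zero, h⟩⟩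
  let e : Ix ≃ (Phi4 c).rootSet 𝕂 := Equiv.ofBijective
    (fun x => ⟨R.r x.1 x.2, (hroot _).2 (R.root _ _)⟩) (by
      constructor
      · intro x y h
        exact R.injIx hQ h5 hv (congrArg Subtype.val h)
      · rintro ⟨y, hy⟩
        obtain ⟨i, k, hik⟩ := R.all_roots hQ h5 hv ((hroot y).1 hy)
        exact ⟨(i, k), Subtype.ext hik.symm⟩)
  have he : ∀ x, (e x : 𝕂) = R.r x.1 x.2 := fun x => rfl
  have : Fact (((Phi4 c).map (algebraMap ℚ 𝕂)).Splits) := ⟨IsAlgClosed.splits _⟩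
  let f : (Phi4 c).Gal →* Equiv.Perm Ix :=
    (e.symm.permCongrHom : Equiv.Perm ((Phi4 c).rootSet 𝕂) →* Equiv.Perm Ix).comp
      (Gal.galActionHom (Phi4 c) 𝕂)
  have hf : Function.Injective f :=
    e.symm.permCongrHom.injective.comp (Gal.galActionHom_injective (Phi4 c) 𝕂)
  have hfr : ∀ (φ : 𝕂 ≃ₐ[ℚ] 𝕂) (x : Ix),
      R.r (f (Gal.restrict (Phi4 c) 𝕂 φ) x).1 (f (Gal.restrict (Phi4 c) 𝕂 φ) x).2
        = (φ : 𝕂 →+* 𝕂) (R.r x.1 x.2) := by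
    intro φ x
    rw [← he]
    have : f (Gal.restrict (Phi4 c) 𝕂 φ) x =
        e.symm (Gal.galActionHom (Phi4 c) 𝕂 (Gal.restrict (Phi4 c) 𝕂 φ) (e x)) := rfl
    rw [this, Equiv.apply_symm_apply, Gal.galActionHom_restrict]
    rfl
  have h1 : ∀ g ∈ f.range, ∃ φ : 𝕂 ≃ₐ[ℚ] 𝕂,
      ∀ x : Ix, (φ : 𝕂 →+* 𝕂) (R.r x.1 x.2) = R.r (g x).1 (g x).2 := by
    rintro g ⟨y, rfl⟩
    obtain ⟨φ, rfl⟩ := Gal.restrict_surjective (Phi4 c) 𝕂 y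
    exact ⟨φ, fun x => (hfr φ x).symm⟩
  have h2 : ∀ (g : Equiv.Perm Ix) (φ : 𝕂 ≃ₐ[ℚ] 𝕂),
      (∀ x : Ix, (φ : 𝕂 →+* 𝕂) (R.r x.1 x.2) = R.r (g x).1 (g x).2) → g ∈ f.range := by
    intro g φ hg
    refine ⟨Gal.restrict (Phi4 c) 𝕂 φ, Equiv.ext fun x => ?_⟩
    exact R.injIx hQ h5 hv ((hfr φ x).trans (hg x))
  have hmem := main_mem f.range R hw hcw hc h1 h2
  constructor
  · -- irreducibility
    have hintg : IsIntegral ℚ (R.r 0 0) := Algebra.IsIntegral.isIntegral _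
    have hr0 : aeval (R.r 0 0) (Phi4 c) = 0 := by
      rw [← eval_map_algebraMap, hmap]; exact R.root 0 0
    have hall : ∀ x : Ix, aeval (R.r x.1 x.2) (minpoly ℚ (R.r 0 0)) = 0 := by
      rintro ⟨i, k⟩
      obtain ⟨b, hb⟩ : ∃ b : ZMod 4, k + b = 0 := ⟨-k, by ring⟩
      have hg : mk (Equiv.swap 0 i) ![k, b, 0] ∈ f.range := by
        rw [hmem]
        exact ⟨_, _, rfl, Or.inl (by simp [tot, hb])⟩
      obtain ⟨φ, hφ⟩ := h1 _ hg
      have := hφ (0, 0)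
      rw [mk_apply] at this
      simp only [Equiv.swap_apply_left, Matrix.cons_val_zero, add_zero] at this
      rw [← this]
      have q : (φ : 𝕂 →+* 𝕂) (R.r 0 0) = φ (R.r 0 0) := rfl
      rw [q, aeval_algHom_apply φ, minpoly.aeval, map_zero]
    have hdeg : (Phi4 c).natDegree ≤ (minpoly ℚ (R.r 0 0)).natDegree := by
      classical
      rw [phi4_deg]
      have hsub : Finset.univ.image (fun x : Ix => R.r x.1 x.2) ⊆
          ((minpoly ℚ (R.r 0 0)).map (algebraMap ℚ 𝕂)).roots.toFinset := by
        intro y hy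
        obtain ⟨x, -, rfl⟩ := Finset.mem_image.1 hy
        rw [Multiset.mem_toFinset, mem_roots
          (Polynomial.map_ne_zero (minpoly.ne_zero hintg)), IsRoot, eval_map_algebraMap]
        exact hall x
      have hcd : (Finset.univ.image (fun x : Ix => R.r x.1 x.2)).card = 12 := by
        rw [Finset.card_image_of_injective _ (R.injIx hQ h5 hv)]; rfl
      rw [← hcd, ← natDegree_map (algebraMap ℚ 𝕂)]
      exact (Finset.card_le_card hsub).trans ((Multiset.toFinset_card_le _).trans (card_roots' _))
    rw [eq_of_monic_of_dvd_of_natDegree_le (minpoly.monic hintg) (phi4_monic c)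
      (minpoly.dvd ℚ _ hr0) hdeg]
    exact minpoly.irreducible hintg
  · have hG : f.range = Ggroup.map (e12.permCongrHom : _ →* Equiv.Perm Ix) := by
      ext g
      rw [hmem, mem_G]
    exact ⟨(MonoidHom.ofInjective hf).trans ((MulEquiv.subgroupCongr hG).trans
      (Ggroup.equivMapOfInjective _ e12.permCongrHom.injective).symm)⟩

end P4

theorem phi4_galois_lambda (c : ℚ)
    (hc : c ∉ ({-5, -5/2, -155/72, -2, -5/4, 0, 19/16} : Set ℚ))
    (hlam : ∃ r : ℚ, r ≠ 0 ∧ c = (r ^ 2 + 2 * r - 4) / (8 * r)) :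
    Irreducible (Phi4 c) ∧ Nonempty ((Phi4 c).Gal ≃* Ggroup) := by
  exact P4.final c (fun h => hc (by rw [h]; simp)) hlam
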